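/- Let Ω ⊆ ℝ²₊ be open, u ∈ V^{1,2}(Ω) ∩ C⁰ ∩ C², with div(x₁∇u) = 0 in {u > 0} and div((1/x₁)∇u) = 0 in {u < 0}, and suppose the boundary flux conditions x₁ u ∂₁u → 0 from {u>0} and u ∂₁u/x₁ → 0 from {u<0} hold at every point of Ω ∩ {x₁ = 0}. Then for B_r⁺ ⊂⊂ Ω, ∫_{B_r⁺} x₁|∇u⁺|² dx = ∫_{∂B_r⁺} x₁ u⁺ ⟨∇u⁺, ν⟩ dS and ∫_{B_r⁺} (1/x₁)|∇u⁻|² dx = ∫_{∂B_r⁺} (1/x₁) u⁻ ⟨∇u⁻, ν⟩ dS. -/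

import Mathlib

open Real MeasureTheory Set Filter Metric
open scoped RealInnerProductSpace

noncomputable section

/-- The plane `ℝ²` as a Euclidean space; the half-plane is `{x | 0 < x 0}`. -/
abbrev E2 := EuclideanSpace ℝ (Fin 2)

/-- Standard basis vectors of `ℝ²`. -/
def e2 (i : Fin 2) : E2 := EuclideanSpace.single i 1

/-- Divergence of a vector field on `ℝ²`. -/
def div2 (F : E2 → E2) (x : E2) : ℝ :=
  ∑ i, fderiv ℝ (fun y => F y i) x (e2 i)

/-- The gradient of `u` on the positive phase `{u > 0}` (the quantity `∇u⁺`),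
extended by `0` elsewhere. -/
def gp (u : E2 → ℝ) (x : E2) : E2 := if 0 < u x then gradient u x else 0

/-- The gradient of `u` on the negative phase `{u < 0}` (the quantity `∇u⁻`),
extended by `0` elsewhere. -/
def gm (u : E2 → ℝ) (x : E2) : E2 := if u x < 0 then gradient u x else 0

/-- `u` solves the two-phase degenerate system `div(x₁∇u) = 0` in `{u > 0}`,
`div((1/x₁)∇u) = 0` in `{u < 0}` in `Ω ∩ {x₁ > 0}`, with the continuity/regularity
and vanishing-flux conditions on `Ω ∩ {x₁ = 0}`. -/
def SolvesEHD (u : E2 → ℝ) (Ω : Set E2) : Prop :=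
  ContinuousOn u (Ω ∩ {x : E2 | 0 < x 0}) ∧
  ContDiffOn ℝ 2 u (Ω ∩ {x : E2 | 0 < x 0} ∩ {x : E2 | u x ≠ 0}) ∧
  (∀ x ∈ Ω ∩ {x : E2 | 0 < x 0} ∩ {x : E2 | 0 < u x},
    div2 (fun y => y 0 • gradient u y) x = 0) ∧
  (∀ x ∈ Ω ∩ {x : E2 | 0 < x 0} ∩ {x : E2 | u x < 0},
    div2 (fun y => (y 0)⁻¹ • gradient u y) x = 0) ∧
  (∀ p ∈ Ω, p 0 = 0 →
    Tendsto (fun x => x 0 * u x * fderiv ℝ u x (e2 0))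
      (nhdsWithin p (Ω ∩ {x : E2 | 0 < u x})) (nhds 0) ∧
    Tendsto (fun x => u x * fderiv ℝ u x (e2 0) / x 0)
      (nhdsWithin p (Ω ∩ {x : E2 | u x < 0})) (nhds 0))

end



open scoped Topology ENNReal NNReal

/-- the point with coordinates `(x, y)` -/
noncomputable def pt (x y : ℝ) : E2 := !₂[x, y]

@[simp] lemma pt_zero (x y : ℝ) : pt x y 0 = x := by simp [pt]
@[simp] lemma pt_one (x y : ℝ) : pt x y 1 = y := by simp [pt]
lemma pt_eta (p : E2) : pt (p 0) (p 1) = p := by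
  ext i; fin_cases i <;> simp [pt]
lemma pt_eq (x y : ℝ) : pt x y = x • e2 0 + y • e2 1 := by
  ext i; fin_cases i <;> simp [pt, e2]
lemma pt_eta' (p : E2) : p = p 0 • e2 0 + p 1 • e2 1 := by
  rw [← pt_eq, pt_eta]
@[fun_prop] lemma continuous_pt2 : Continuous (fun q : ℝ × ℝ => pt q.1 q.2) := by
  simp only [pt_eq]; fun_prop
lemma continuous_pt_comp {α : Type*} [TopologicalSpace α] {f g : α → ℝ} (hf : Continuous f) (hg : Continuous g) :
    Continuous (fun q => pt (f q) (g q)) := continuous_pt2.comp (hf.prodMk hg)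
lemma norm_pt_sq (x y : ℝ) : ‖pt x y‖ ^ 2 = x ^ 2 + y ^ 2 := by
  rw [EuclideanSpace.norm_sq_eq]; simp [Fin.sum_univ_two]
lemma norm_pt (x y : ℝ) : ‖pt x y‖ = √(x ^ 2 + y ^ 2) := by
  rw [← norm_pt_sq, Real.sqrt_sq (norm_nonneg _)]
lemma pt_sub (x y x' y' : ℝ) : pt x y - pt x' y' = pt (x - x') (y - y') := by
  ext i; fin_cases i <;> simp [pt]

/-- the circle parametrisation -/
noncomputable def gam (r θ : ℝ) : E2 := pt (r * cos θ) (r * sin θ)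

lemma continuous_gam (r : ℝ) : Continuous (gam r) := by
  unfold gam; exact continuous_pt_comp (by fun_prop) (by fun_prop)

lemma dist_gam {r : ℝ} (hr : 0 < r) (θ φ : ℝ) : dist (gam r θ) (gam r φ) = 2 * r * |sin ((θ - φ) / 2)| := by
  rw [dist_eq_norm, gam, gam, pt_sub, norm_pt, ← Real.sqrt_sq (by positivity : 0 ≤ 2 * r * |sin ((θ - φ) / 2)|)]
  congr 1
  rw [mul_pow, sq_abs]
  have h : cos (θ - φ) = 1 - 2 * sin ((θ - φ) / 2) ^ 2 := by
    conv_lhs => rw [show θ - φ = 2 * ((θ - φ) / 2) by ring]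
    rw [Real.cos_two_mul, Real.cos_sq']; ring
  rw [Real.cos_sub] at h
  have h1 := Real.sin_sq_add_cos_sq θ
  have h2 := Real.sin_sq_add_cos_sq φ
  linear_combination (r^2) * h1 + r^2 * h2 - 2 * r^2 * h

lemma lipschitz_gam {r : ℝ} (hr : 0 < r) : LipschitzWith r.toNNReal (gam r) := by
  apply LipschitzWith.of_dist_le_mul
  intro θ φ
  rw [dist_gam hr, Real.coe_toNNReal _ hr.le, Real.dist_eq]
  have : |sin ((θ - φ) / 2)| ≤ |(θ - φ) / 2| := Real.abs_sin_le_abs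
  rw [abs_div, abs_two] at this
  nlinarith

lemma injOn_gam {r : ℝ} (hr : 0 < r) : InjOn (gam r) (Ioo (-(π / 2)) (π / 2)) := by
  intro θ hθ φ hφ h
  have h1 : gam r θ 1 = gam r φ 1 := by rw [h]
  simp only [gam, pt_one] at h1
  exact Real.injOn_sin (Ioo_subset_Icc_self hθ) (Ioo_subset_Icc_self hφ) (mul_left_cancel₀ hr.ne' h1)

lemma image_gam {r : ℝ} (hr : 0 < r) :
    gam r '' (Ioo (-(π / 2)) (π / 2)) = sphere (0 : E2) r ∩ {x : E2 | 0 < x 0} := by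
  ext p; constructor
  · rintro ⟨θ, hθ, rfl⟩
    refine ⟨?_, ?_⟩
    · rw [mem_sphere_zero_iff_norm, gam, norm_pt]
      have h1 := Real.sin_sq_add_cos_sq θ
      rw [show (r * cos θ) ^ 2 + (r * sin θ) ^ 2 = r ^ 2 by linear_combination r^2 * h1, Real.sqrt_sq hr.le]
    · simp only [mem_setOf_eq, gam, pt_zero]
      exact mul_pos hr (Real.cos_pos_of_mem_Ioo hθ)
  · rintro ⟨h1, h2⟩
    rw [mem_sphere_zero_iff_norm] at h1
    simp only [mem_setOf_eq] at h2
    have h3 : p 0 ^ 2 + p 1 ^ 2 = r ^ 2 := by rw [← norm_pt_sq, pt_eta, h1]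
    have hlt : |p 1 / r| < 1 := by
      rw [abs_div, abs_of_pos hr, div_lt_one hr]
      apply abs_lt_of_sq_lt_sq _ hr.le; nlinarith
    rw [abs_lt] at hlt
    refine ⟨arcsin (p 1 / r), ⟨?_, ?_⟩, ?_⟩
    · exact Real.neg_pi_div_two_lt_arcsin.2 hlt.1
    · exact Real.arcsin_lt_pi_div_two.2 hlt.2
    · rw [gam, Real.sin_arcsin hlt.1.le hlt.2.le, Real.cos_arcsin, ← pt_eta p]
      congr 1
      · simp only [pt_zero, pt_one]
        rw [show 1 - (p 1 / r)^2 = (p 0 / r)^2 by field_simp; linarith, Real.sqrt_sq (by positivity)]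
        field_simp
      · simp only [pt_one]; field_simp

lemma exists_sin_ge {c : ℝ} (hc : c < 1) : ∃ δ > 0, ∀ x : ℝ, |x| ≤ δ → c * |x| ≤ |sin x| := by
  have h := (Real.hasDerivAt_sin 0).isLittleO
  rw [Real.cos_zero] at h
  have h2 := h.def (sub_pos.2 hc)
  simp only [sub_zero, Real.sin_zero, smul_eq_mul, mul_one, Real.norm_eq_abs] at h2
  rw [Metric.eventually_nhds_iff] at h2
  obtain ⟨δ, hδ, h3⟩ := h2
  refine ⟨δ / 2, by positivity, fun x hx => ?_⟩
  have h4 := h3 (y := x) (by rw [Real.dist_eq, sub_zero]; linarith)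
  have h5 : |x| - |sin x| ≤ |sin x - x| := by rw [abs_sub_comm]; exact abs_sub_abs_le_abs_sub _ _
  linarith

lemma gam_lower {r : ℝ} (hr : 0 < r) {c : ℝ} (hc0 : 0 < c) (hc : c < 1) {B : Set ℝ} (hB : MeasurableSet B)
    (hBI : B ⊆ Ioo (-(π / 2)) (π / 2)) :
    ENNReal.ofReal (c * r) * volume B ≤ μH[1] (gam r '' B) := by
  obtain ⟨δ, hδ, hs⟩ := exists_sin_ge hc
  let Q : ℤ → Set ℝ := fun k => Ico (k • δ) ((k + 1) • δ)
  have hQ : ∀ k, MeasurableSet (Q k) := fun k => measurableSet_Ico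
  have hQd : Pairwise (Function.onFun Disjoint Q) := by
    have := pairwise_disjoint_Ico_zsmul δ; exact this
  have hQu : ⋃ k, Q k = univ := iUnion_Ico_zsmul hδ
  have hBu : B = ⋃ k, B ∩ Q k := by rw [← inter_iUnion, hQu, inter_univ]
  have hpiece : ∀ k, ENNReal.ofReal (c * r) * volume (B ∩ Q k) ≤ μH[1] (gam r '' (B ∩ Q k)) := by
    intro k
    have hinv : ∀ θ ∈ B, arcsin (gam r θ 1 / r) = θ := by
      intro θ hθ
      simp only [gam, pt_one]
      rw [mul_div_cancel_left₀ _ hr.ne']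
      exact Real.arcsin_sin (hBI hθ).1.le (hBI hθ).2.le
    have hL : LipschitzOnWith (Real.toNNReal (1 / (c * r))) (fun p : E2 => arcsin (p 1 / r)) (gam r '' (B ∩ Q k)) := by
      apply LipschitzOnWith.of_dist_le_mul
      rintro _ ⟨θ, hθ, rfl⟩ _ ⟨φ, hφ, rfl⟩
      simp only
      rw [hinv θ hθ.1, hinv φ hφ.1, dist_gam hr, Real.coe_toNNReal _ (by positivity), Real.dist_eq]
      have h1 : |(θ - φ) / 2| ≤ δ := by
        have h2 := hθ.2.1; have h3 := hθ.2.2; have h4 := hφ.2.1; have h5 := hφ.2.2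
        simp only [zsmul_eq_mul, Int.cast_add, Int.cast_one] at h2 h3 h4 h5
        rw [abs_le]; constructor <;> nlinarith
      have h2 := hs _ h1
      rw [abs_div, abs_two] at h2
      rw [div_mul_eq_mul_div, one_mul, le_div_iff₀ (by positivity)]
      nlinarith
    have h := hL.hausdorffMeasure_image_le (d := 1) zero_le_one
    have him : (fun p : E2 => arcsin (p 1 / r)) '' (gam r '' (B ∩ Q k)) = B ∩ Q k := by
      rw [image_image]
      calc (fun θ => arcsin (gam r θ 1 / r)) '' (B ∩ Q k) = id '' (B ∩ Q k) := by
            apply image_congr; intro θ hθ; exact hinv θ hθ.1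
        _ = _ := image_id _
    rw [him, hausdorffMeasure_real, ENNReal.rpow_one] at h
    calc ENNReal.ofReal (c * r) * volume (B ∩ Q k)
        ≤ ENNReal.ofReal (c * r) * (ENNReal.ofReal (1 / (c * r)) * μH[1] (gam r '' (B ∩ Q k))) := by
          gcongr; exact h
      _ = μH[1] (gam r '' (B ∩ Q k)) := by
          rw [← mul_assoc, ← ENNReal.ofReal_mul (by positivity), mul_one_div_cancel (by positivity)]
          simp
  have hinj := injOn_gam hr
  calc ENNReal.ofReal (c * r) * volume B = ∑' k, ENNReal.ofReal (c * r) * volume (B ∩ Q k) := by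
        rw [ENNReal.tsum_mul_left]; congr 1
        conv_lhs => rw [hBu]
        exact measure_iUnion (fun i j hij => (hQd hij).mono inter_subset_right inter_subset_right)
          (fun k => hB.inter (hQ k))
    _ ≤ ∑' k, μH[1] (gam r '' (B ∩ Q k)) := ENNReal.tsum_le_tsum hpiece
    _ = μH[1] (⋃ k, gam r '' (B ∩ Q k)) := by
        rw [measure_iUnion]
        · intro i j hij
          have hd : Disjoint (B ∩ Q i) (B ∩ Q j) := (hQd hij).mono inter_subset_right inter_subset_right
          rw [Function.onFun]
          rw [Set.disjoint_left] at hd ⊢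
          rintro _ ⟨θ, hθ, rfl⟩ ⟨φ, hφ, he⟩
          exact hd hθ (hinj (hBI hφ.1) (hBI hθ.1) he ▸ hφ)
        · intro k
          exact (hB.inter (hQ k)).image_of_continuousOn_injOn (continuous_gam r).continuousOn
            (hinj.mono (inter_subset_left.trans hBI))
    _ = μH[1] (gam r '' B) := by rw [← image_iUnion, ← hBu]

lemma gam_measure {r : ℝ} (hr : 0 < r) {B : Set ℝ} (hB : MeasurableSet B)
    (hBI : B ⊆ Ioo (-(π / 2)) (π / 2)) :
    μH[1] (gam r '' B) = ENNReal.ofReal r * volume B := by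
  apply le_antisymm
  · have := (lipschitz_gam hr).hausdorffMeasure_image_le (d := 1) zero_le_one B
    rw [ENNReal.rpow_one, hausdorffMeasure_real] at this
    exact this
  · have hfin : volume B ≠ ∞ := ((measure_mono hBI).trans_lt (by simp)).ne
    have ht : Tendsto (fun c : ℝ => ENNReal.ofReal (c * r) * volume B) (𝓝[<] 1) (𝓝 (ENNReal.ofReal (1 * r) * volume B)) := by
      apply ENNReal.Tendsto.mul_const
      · apply ENNReal.tendsto_ofReal
        apply Tendsto.mono_left _ nhdsWithin_le_nhds
        exact (continuous_id.mul continuous_const).tendsto _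
      · right; exact hfin
    rw [one_mul] at ht
    apply le_of_tendsto ht
    filter_upwards [Ioo_mem_nhdsLT (show (0:ℝ) < 1 by norm_num)] with c hc
    exact gam_lower hr hc.1 hc.2 hB hBI

lemma hausdorff_arc {r : ℝ} (hr : 0 < r) :
    (μH[1] : Measure E2).restrict (sphere (0 : E2) r ∩ {x : E2 | 0 < x 0})
      = Measure.map (gam r) (ENNReal.ofReal r • volume.restrict (Ioo (-(π / 2)) (π / 2))) := by
  ext A hA
  rw [Measure.restrict_apply hA, Measure.map_apply (continuous_gam r).measurable hA, Measure.smul_apply,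
    Measure.restrict_apply ((continuous_gam r).measurable hA), smul_eq_mul,
    ← gam_measure hr (((continuous_gam r).measurable hA).inter measurableSet_Ioo) inter_subset_right,
    ← image_gam hr]
  congr 1
  rw [inter_comm A, inter_comm _ (Ioo _ _), image_inter_preimage]

lemma integral_arc {r : ℝ} (hr : 0 < r) (f : E2 → ℝ)
    (P : Set E2) (hP : MeasurableSet ((sphere (0 : E2) r ∩ {x : E2 | 0 < x 0}) ∩ P))
    (hf : AEStronglyMeasurable (P.indicator f) (Measure.map (gam r) (ENNReal.ofReal r • volume.restrict (Ioo (-(π / 2)) (π / 2))))) :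
    ∫ x in sphere (0 : E2) r ∩ {x : E2 | 0 < x 0} ∩ P, f x ∂μH[1]
      = ∫ θ in Ioo (-(π / 2)) (π / 2), r * P.indicator f (gam r θ) := by
  have hA : MeasurableSet (sphere (0 : E2) r ∩ {x : E2 | 0 < x 0}) := by
    apply MeasurableSet.inter isClosed_sphere.measurableSet
    exact (isOpen_lt continuous_const (by fun_prop)).measurableSet
  have h1 : ∫ x in sphere (0 : E2) r ∩ {x : E2 | 0 < x 0} ∩ P, f x ∂μH[1]
      = ∫ x in sphere (0 : E2) r ∩ {x : E2 | 0 < x 0}, P.indicator f x ∂μH[1] := by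
    rw [← integral_indicator hP, ← integral_indicator hA]
    congr 1
    rw [indicator_indicator]
  rw [h1, hausdorff_arc hr, integral_map (continuous_gam r).aemeasurable hf, integral_smul_measure,
    ENNReal.toReal_ofReal hr.le, smul_eq_mul, integral_const_mul]



/-- smooth cutoff: `0` for `u ≤ ε`, `1` for `u ≥ 2 ε` -/
noncomputable def S0 (ε u : ℝ) : ℝ := Real.smoothTransition (u / ε - 1)
noncomputable def S1 (ε u : ℝ) : ℝ := ∫ τ in (0:ℝ)..u, S0 ε τ
noncomputable def S2 (ε u : ℝ) : ℝ := ∫ τ in (0:ℝ)..u, S1 ε τ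

lemma S0_contDiff (ε : ℝ) : ContDiff ℝ 1 (S0 ε) := by
  unfold S0
  exact (Real.smoothTransition.contDiff (n := 1)).comp ((contDiff_id.div_const _).sub contDiff_const)
lemma S0_cont (ε : ℝ) : Continuous (S0 ε) := (S0_contDiff ε).continuous
lemma S0_nonneg (ε u : ℝ) : 0 ≤ S0 ε u := Real.smoothTransition.nonneg _
lemma S0_le_one (ε u : ℝ) : S0 ε u ≤ 1 := Real.smoothTransition.le_one _
lemma S0_zero {ε u : ℝ} (hε : 0 < ε) (h : u ≤ ε) : S0 ε u = 0 := by
  apply Real.smoothTransition.zero_of_nonpos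
  rw [sub_nonpos, div_le_one hε]; exact h
lemma S0_one {ε u : ℝ} (hε : 0 < ε) (h : 2 * ε ≤ u) : S0 ε u = 1 := by
  apply Real.smoothTransition.one_of_one_le
  rw [le_sub_iff_add_le, le_div_iff₀ hε]; linarith
lemma S0_mono {ε : ℝ} (hε : 0 < ε) : Monotone (S0 ε) := by
  intro a b hab
  apply Real.smoothTransition.monotone
  gcongr

lemma S1_deriv (ε u : ℝ) : HasDerivAt (S1 ε) (S0 ε u) u :=
  intervalIntegral.integral_hasDerivAt_right ((S0_cont ε).intervalIntegrable _ _)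
    ((S0_cont ε).stronglyMeasurableAtFilter _ _) (S0_cont ε).continuousAt
lemma S1_cont (ε : ℝ) : Continuous (S1 ε) :=
  continuous_iff_continuousAt.2 fun u => (S1_deriv ε u).continuousAt
lemma S2_deriv (ε u : ℝ) : HasDerivAt (S2 ε) (S1 ε u) u :=
  intervalIntegral.integral_hasDerivAt_right ((S1_cont ε).intervalIntegrable _ _)
    ((S1_cont ε).stronglyMeasurableAtFilter _ _) (S1_cont ε).continuousAt
lemma S2_cont (ε : ℝ) : Continuous (S2 ε) :=
  continuous_iff_continuousAt.2 fun u => (S2_deriv ε u).continuousAt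
lemma S1_mono (ε : ℝ) : Monotone (S1 ε) :=
  monotone_of_hasDerivAt_nonneg (S1_deriv ε) (fun u => S0_nonneg ε u)

lemma S1_zero {ε u : ℝ} (hε : 0 < ε) (h : u ≤ ε) : S1 ε u = 0 := by
  unfold S1
  rw [intervalIntegral.integral_congr (g := fun _ => (0:ℝ))]
  · simp
  · intro τ hτ
    apply S0_zero hε
    rw [uIcc, mem_Icc] at hτ
    exact hτ.2.trans (max_le hε.le h)
lemma S1_nonneg {ε : ℝ} (hε : 0 < ε) (u : ℝ) : 0 ≤ S1 ε u := by
  rcases le_total u ε with h | h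
  · rw [S1_zero hε h]
  · calc (0:ℝ) = S1 ε ε := (S1_zero hε le_rfl).symm
      _ ≤ _ := S1_mono ε h
lemma S2_mono {ε : ℝ} (hε : 0 < ε) : Monotone (S2 ε) :=
  monotone_of_hasDerivAt_nonneg (S2_deriv ε) (fun u => S1_nonneg hε u)
lemma S2_zero {ε u : ℝ} (hε : 0 < ε) (h : u ≤ ε) : S2 ε u = 0 := by
  unfold S2
  rw [intervalIntegral.integral_congr (g := fun _ => (0:ℝ))]
  · simp
  · intro τ hτ
    apply S1_zero hε
    rw [uIcc, mem_Icc] at hτ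
    exact hτ.2.trans (max_le hε.le h)
lemma S2_nonneg {ε : ℝ} (hε : 0 < ε) (u : ℝ) : 0 ≤ S2 ε u := by
  rcases le_total u ε with h | h
  · rw [S2_zero hε h]
  · calc (0:ℝ) = S2 ε ε := (S2_zero hε le_rfl).symm
      _ ≤ _ := S2_mono hε h
lemma S1_le {ε : ℝ} (hε : 0 < ε) (u : ℝ) : S1 ε u ≤ max u 0 := by
  rcases le_total u 0 with h | h
  · rw [S1_zero hε (h.trans hε.le), max_eq_right h]
  · rw [max_eq_left h]
    have : S1 ε u ≤ ∫ τ in (0:ℝ)..u, (1:ℝ) :=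
      intervalIntegral.integral_mono_on h ((S0_cont ε).intervalIntegrable _ _) (by simp) (fun x _ => S0_le_one ε x)
    simpa using this
lemma S2_le {ε : ℝ} (hε : 0 < ε) (u : ℝ) : S2 ε u ≤ (max u 0) ^ 2 / 2 := by
  rcases le_total u 0 with h | h
  · rw [S2_zero hε (h.trans hε.le)]; positivity
  · rw [max_eq_left h]
    have : S2 ε u ≤ ∫ τ in (0:ℝ)..u, τ := by
      apply intervalIntegral.integral_mono_on h ((S1_cont ε).intervalIntegrable _ _) (by simp)
      intro x hx
      have := S1_le hε x
      rwa [max_eq_left hx.1] at this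
    rw [integral_id] at this
    linarith
lemma S1_ge {ε : ℝ} (hε : 0 < ε) (u : ℝ) : max u 0 - 2 * ε ≤ S1 ε u := by
  rcases le_total u (2 * ε) with h | h
  · have h1 := S1_nonneg hε u
    have : max u 0 ≤ 2 * ε := max_le h (by positivity)
    linarith
  · have h0 : 0 ≤ u := by linarith
    rw [max_eq_left h0]
    have : ∫ τ in (2 * ε)..u, (1:ℝ) = ∫ τ in (2 * ε)..u, S0 ε τ := by
      apply intervalIntegral.integral_congr
      intro τ hτ
      rw [uIcc_of_le h] at hτ
      exact (S0_one hε hτ.1).symm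
    have h2 : S1 ε u = S1 ε (2 * ε) + ∫ τ in (2 * ε)..u, S0 ε τ := by
      unfold S1
      rw [intervalIntegral.integral_add_adjacent_intervals] <;> exact (S0_cont ε).intervalIntegrable _ _
    rw [h2, ← this, intervalIntegral.integral_const]
    have := S1_nonneg hε (2 * ε)
    simp; linarith
lemma S2_ge {ε : ℝ} (hε : 0 < ε) (u : ℝ) : (max u 0) ^ 2 / 2 - 2 * ε * max u 0 ≤ S2 ε u := by
  rcases le_total u 0 with h | h
  · rw [max_eq_right h, S2_zero hε (h.trans hε.le)]; norm_num
  · rw [max_eq_left h]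
    have : ∫ τ in (0:ℝ)..u, (τ - 2 * ε) ≤ S2 ε u := by
      apply intervalIntegral.integral_mono_on h (by apply Continuous.intervalIntegrable; fun_prop) ((S1_cont ε).intervalIntegrable _ _)
      intro x hx
      have := S1_ge hε x
      rwa [max_eq_left hx.1] at this
    rw [intervalIntegral.integral_sub (by simp) (by simp), integral_id, intervalIntegral.integral_const] at this
    simp at this
    linarith

/-- sequence of cutoff parameters -/
noncomputable def en (n : ℕ) : ℝ := 1 / ((n : ℝ) + 1)
lemma en_pos (n : ℕ) : 0 < en n := by unfold en; positivity
lemma en_tendsto : Tendsto en atTop (𝓝 0) := tendsto_one_div_add_atTop_nhds_zero_nat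
lemma S0_tendsto {u : ℝ} (hu : 0 < u) : Tendsto (fun n => S0 (en n) u) atTop (𝓝 1) := by
  apply tendsto_const_nhds.congr'
  filter_upwards [en_tendsto.eventually (gt_mem_nhds (show 0 < u / 2 by positivity))] with n hn
  exact (S0_one (en_pos n) (by linarith)).symm
lemma S1_tendsto (u : ℝ) : Tendsto (fun n => S1 (en n) u) atTop (𝓝 (max u 0)) := by
  apply tendsto_of_tendsto_of_tendsto_of_le_of_le (g := fun n => max u 0 - 2 * en n) (h := fun _ => max u 0)
  · have := (tendsto_const_nhds (x := max u 0)).sub (en_tendsto.const_mul 2)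
    simpa using this
  · exact tendsto_const_nhds
  · intro n; exact S1_ge (en_pos n) u
  · intro n; exact S1_le (en_pos n) u
lemma S2_tendsto (u : ℝ) : Tendsto (fun n => S2 (en n) u) atTop (𝓝 ((max u 0) ^ 2 / 2)) := by
  apply tendsto_of_tendsto_of_tendsto_of_le_of_le (g := fun n => (max u 0) ^ 2 / 2 - 2 * en n * max u 0) (h := fun _ => (max u 0) ^ 2 / 2)
  · have := (tendsto_const_nhds (x := (max u 0) ^ 2 / 2)).sub ((en_tendsto.const_mul 2).mul_const (max u 0))
    simpa using this
  · exact tendsto_const_nhds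
  · intro n; exact S2_ge (en_pos n) u
  · intro n; exact S2_le (en_pos n) u

/-- convex cutoff functions -/
structure Cut (G G1 G2 : ℝ → ℝ) (ε : ℝ) : Prop where
  pos : 0 < ε
  d1 : ∀ u, HasDerivAt G (G1 u) u
  d2 : ∀ u, HasDerivAt G1 (G2 u) u
  cont : Continuous G2
  z0 : ∀ u ≤ ε, G u = 0
  z1 : ∀ u ≤ ε, G1 u = 0
  z2 : ∀ u ≤ ε, G2 u = 0
  nonneg : ∀ u, 0 ≤ G2 u

lemma cut_S2 {ε : ℝ} (hε : 0 < ε) : Cut (S2 ε) (S1 ε) (S0 ε) ε :=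
  ⟨hε, S2_deriv ε, S1_deriv ε, S0_cont ε, fun _ => S2_zero hε, fun _ => S1_zero hε, fun _ => S0_zero hε, S0_nonneg ε⟩

lemma cut_S1 {ε : ℝ} (hε : 0 < ε) : Cut (S1 ε) (S0 ε) (deriv (S0 ε)) ε := by
  have hd : ∀ u, HasDerivAt (S0 ε) (deriv (S0 ε) u) u := fun u =>
    ((S0_contDiff ε).differentiable (by norm_num)).differentiableAt.hasDerivAt
  refine ⟨hε, S1_deriv ε, hd, (S0_contDiff ε).continuous_deriv (by norm_num), fun _ => S1_zero hε, fun _ => S0_zero hε, ?_, fun u => (S0_mono hε).deriv_nonneg⟩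
  intro u hu
  have h1 : HasDerivWithinAt (S0 ε) (deriv (S0 ε) u) (Iic u) u := (hd u).hasDerivWithinAt
  have h2 : HasDerivWithinAt (S0 ε) 0 (Iic u) u := by
    apply (hasDerivWithinAt_const u (Iic u) (0:ℝ)).congr
    · intro y hy; exact S0_zero hε (le_trans hy hu)
    · exact S0_zero hε hu
  exact (uniqueDiffWithinAt_Iic u).eq_deriv _ h1 h2

lemma Cut.contDiff {G G1 G2 : ℝ → ℝ} {ε : ℝ} (h : Cut G G1 G2 ε) : ContDiff ℝ 2 G := by
  have e1 : deriv G = G1 := funext fun u => (h.d1 u).deriv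
  have e2 : deriv G1 = G2 := funext fun u => (h.d2 u).deriv
  have c1 : ContDiff ℝ 1 G1 := by
    rw [contDiff_one_iff_deriv]
    exact ⟨fun u => (h.d2 u).differentiableAt, by rw [e2]; exact h.cont⟩
  rw [show (2 : WithTop ℕ∞) = 1 + 1 by norm_num, contDiff_succ_iff_deriv]
  exact ⟨fun u => (h.d1 u).differentiableAt, by simp, by rw [e1]; exact c1⟩



lemma rect_integrable {a b c d : ℝ} {f : ℝ → ℝ → ℝ}
    (hf : ContinuousOn (fun p : ℝ × ℝ => f p.1 p.2) (Icc a b ×ˢ Icc c d)) :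
    Integrable (fun p : ℝ × ℝ => f p.1 p.2) ((volume.restrict (Ioc a b)).prod (volume.restrict (Ioc c d))) := by
  rw [Measure.prod_restrict]
  have := hf.integrableOn_compact (μ := volume) (isCompact_Icc.prod isCompact_Icc)
  exact this.mono_set (prod_mono Ioc_subset_Icc_self Ioc_subset_Icc_self)

lemma rect_swap {a b c d : ℝ} {f : ℝ → ℝ → ℝ} (hab : a ≤ b) (hcd : c ≤ d)
    (hf : ContinuousOn (fun p : ℝ × ℝ => f p.1 p.2) (Icc a b ×ˢ Icc c d)) :
    ∫ x in a..b, ∫ y in c..d, f x y = ∫ y in c..d, ∫ x in a..b, f x y := by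
  simp only [intervalIntegral.integral_of_le hab, intervalIntegral.integral_of_le hcd]
  exact integral_integral_swap (rect_integrable hf)

lemma rect_slice {a b c d : ℝ} {f : ℝ → ℝ → ℝ} (hab : a ≤ b) (hcd : c ≤ d)
    (hf : ContinuousOn (fun p : ℝ × ℝ => f p.1 p.2) (Icc a b ×ˢ Icc c d)) :
    IntervalIntegrable (fun y => ∫ x in a..b, f x y) volume c d := by
  simp only [intervalIntegral.integral_of_le hab]
  rw [intervalIntegrable_iff_integrableOn_Ioc_of_le hcd]
  exact (rect_integrable hf).integral_prod_right

def dom (T : ℝ) : Set (ℝ × ℝ) := Ioo (-T) T ×ˢ Ioo (-(π/2)) (π/2)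

structure D2 (T : ℝ) (f ft ftt fh fhh : ℝ → ℝ → ℝ) : Prop where
  dt : ∀ t h, (t, h) ∈ dom T → HasDerivAt (fun s => f s h) (ft t h) t
  dtt : ∀ t h, (t, h) ∈ dom T → HasDerivAt (fun s => ft s h) (ftt t h) t
  dh : ∀ t h, (t, h) ∈ dom T → HasDerivAt (fun s => f t s) (fh t h) h
  dhh : ∀ t h, (t, h) ∈ dom T → HasDerivAt (fun s => fh t s) (fhh t h) h
  c : ContinuousOn (fun p : ℝ × ℝ => f p.1 p.2) (dom T)
  ct : ContinuousOn (fun p : ℝ × ℝ => ft p.1 p.2) (dom T)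
  ctt : ContinuousOn (fun p : ℝ × ℝ => ftt p.1 p.2) (dom T)
  ch : ContinuousOn (fun p : ℝ × ℝ => fh p.1 p.2) (dom T)
  chh : ContinuousOn (fun p : ℝ × ℝ => fhh p.1 p.2) (dom T)

lemma D2.reflect {T : ℝ} {f ft ftt fh fhh : ℝ → ℝ → ℝ} (H : D2 T f ft ftt fh fhh) :
    D2 T (fun t h => f (-t) h) (fun t h => - ft (-t) h) (fun t h => ftt (-t) h)
      (fun t h => fh (-t) h) (fun t h => fhh (-t) h) := by
  have hm : ∀ {t h}, (t, h) ∈ dom T → (-t, h) ∈ dom T := by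
    intro t h ht
    simp only [dom, mem_prod, mem_Ioo] at ht ⊢
    exact ⟨⟨by linarith [ht.1.2], by linarith [ht.1.1]⟩, ht.2⟩
  have hc : ∀ {g : ℝ → ℝ → ℝ}, ContinuousOn (fun p : ℝ × ℝ => g p.1 p.2) (dom T) →
      ContinuousOn (fun p : ℝ × ℝ => g (-p.1) p.2) (dom T) := by
    intro g hg
    exact hg.comp (f := fun p : ℝ × ℝ => (-p.1, p.2)) (by fun_prop) (fun p hp => hm hp)
  refine ⟨?_, ?_, ?_, ?_, hc H.c, (hc H.ct).neg, hc H.ctt, hc H.ch, hc H.chh⟩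
  · intro t h ht
    have := (H.dt _ _ (hm ht)).scomp t (hasDerivAt_neg t)
    simpa [Function.comp_def] using this
  · intro t h ht
    have := ((H.dtt _ _ (hm ht)).scomp t (hasDerivAt_neg t)).fun_neg
    simpa [Function.comp_def] using this
  · intro t h ht
    exact H.dh _ _ (hm ht)
  · intro t h ht
    exact H.dhh _ _ (hm ht)

lemma D2.add {T : ℝ} {f ft ftt fh fhh g gt gtt gh ghh : ℝ → ℝ → ℝ} (H : D2 T f ft ftt fh fhh)
    (K : D2 T g gt gtt gh ghh) :
    D2 T (fun t h => f t h + g t h) (fun t h => ft t h + gt t h) (fun t h => ftt t h + gtt t h)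
      (fun t h => fh t h + gh t h) (fun t h => fhh t h + ghh t h) :=
  ⟨fun t h ht => (H.dt t h ht).add (K.dt t h ht), fun t h ht => (H.dtt t h ht).add (K.dtt t h ht),
   fun t h ht => (H.dh t h ht).add (K.dh t h ht), fun t h ht => (H.dhh t h ht).add (K.dhh t h ht),
   H.c.add K.c, H.ct.add K.ct, H.ctt.add K.ctt, H.ch.add K.ch, H.chh.add K.chh⟩

lemma D2.sub {T : ℝ} {f ft ftt fh fhh g gt gtt gh ghh : ℝ → ℝ → ℝ} (H : D2 T f ft ftt fh fhh)
    (K : D2 T g gt gtt gh ghh) :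
    D2 T (fun t h => f t h - g t h) (fun t h => ft t h - gt t h) (fun t h => ftt t h - gtt t h)
      (fun t h => fh t h - gh t h) (fun t h => fhh t h - ghh t h) :=
  ⟨fun t h ht => (H.dt t h ht).sub (K.dt t h ht), fun t h ht => (H.dtt t h ht).sub (K.dtt t h ht),
   fun t h ht => (H.dh t h ht).sub (K.dh t h ht), fun t h ht => (H.dhh t h ht).sub (K.dhh t h ht),
   H.c.sub K.c, H.ct.sub K.ct, H.ctt.sub K.ctt, H.ch.sub K.ch, H.chh.sub K.chh⟩

lemma D2.comp {T : ℝ} {f ft ftt fh fhh : ℝ → ℝ → ℝ} (H : D2 T f ft ftt fh fhh)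
    {G G1 G2 : ℝ → ℝ} (h1 : ∀ u, HasDerivAt G (G1 u) u) (h2 : ∀ u, HasDerivAt G1 (G2 u) u)
    (hc : Continuous G2) :
    D2 T (fun t h => G (f t h)) (fun t h => G1 (f t h) * ft t h)
      (fun t h => G2 (f t h) * ft t h * ft t h + G1 (f t h) * ftt t h)
      (fun t h => G1 (f t h) * fh t h)
      (fun t h => G2 (f t h) * fh t h * fh t h + G1 (f t h) * fhh t h) := by
  have c0 : Continuous G := continuous_iff_continuousAt.2 fun u => (h1 u).continuousAt
  have c1 : Continuous G1 := continuous_iff_continuousAt.2 fun u => (h2 u).continuousAt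
  have k0 := c0.comp_continuousOn H.c
  have k1 := c1.comp_continuousOn H.c
  have k2 := hc.comp_continuousOn H.c
  refine ⟨?_, ?_, ?_, ?_, k0, k1.mul H.ct, ((k2.mul H.ct).mul H.ct).add (k1.mul H.ctt), k1.mul H.ch,
    ((k2.mul H.ch).mul H.ch).add (k1.mul H.chh)⟩
  · intro t h ht
    exact (h1 _).comp t (H.dt t h ht)
  · intro t h ht
    exact ((h2 _).comp t (H.dt t h ht)).mul (H.dtt t h ht)
  · intro t h ht
    exact (h1 _).comp h (H.dh t h ht)
  · intro t h ht
    exact ((h2 _).comp h (H.dh t h ht)).mul (H.dhh t h ht)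

lemma rect_sub_dom {T t0 κ Θ : ℝ} (ht0 : -T < t0) (hκ : κ < T) (hΘ : Θ < π/2) :
    Icc t0 κ ×ˢ Icc (-Θ) Θ ⊆ dom T := by
  rintro ⟨t, h⟩ ⟨h1, h2⟩
  simp only [mem_Icc] at h1 h2
  simp only [dom, mem_prod, mem_Ioo]
  exact ⟨⟨by linarith, by linarith⟩, by linarith, by linarith⟩

lemma sliceT {D : Set (ℝ × ℝ)} {f : ℝ → ℝ → ℝ} {a b c d : ℝ}
    (hf : ContinuousOn (fun p : ℝ × ℝ => f p.1 p.2) D) (hD : Icc a b ×ˢ Icc c d ⊆ D) {h : ℝ}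
    (hh : h ∈ Icc c d) : ContinuousOn (fun t => f t h) (Icc a b) :=
  hf.comp (f := fun t : ℝ => (t, h)) (by fun_prop) (fun t ht => hD ⟨ht, hh⟩)

lemma sliceH {D : Set (ℝ × ℝ)} {f : ℝ → ℝ → ℝ} {a b c d : ℝ}
    (hf : ContinuousOn (fun p : ℝ × ℝ => f p.1 p.2) D) (hD : Icc a b ×ˢ Icc c d ⊆ D) {t : ℝ}
    (ht : t ∈ Icc a b) : ContinuousOn (fun h => f t h) (Icc c d) :=
  hf.comp (f := fun h : ℝ => (t, h)) (by fun_prop) (fun h hh => hD ⟨ht, hh⟩)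

lemma green {T t0 κ Θ : ℝ} {f ft ftt fh fhh g gt gtt gh ghh : ℝ → ℝ → ℝ} {m m' : ℝ → ℝ}
    (H : D2 T f ft ftt fh fhh) (K : D2 T g gt gtt gh ghh)
    (ht0 : -T < t0) (ht0κ : t0 ≤ κ) (hκ : κ < T) (hΘ0 : 0 < Θ) (hΘ : Θ < π/2)
    (hm : ∀ h ∈ Ioo (-(π/2)) (π/2), HasDerivAt m (m' h) h)
    (hm' : ContinuousOn m' (Ioo (-(π/2)) (π/2)))
    (b1 : ∀ h ∈ Icc (-Θ) Θ, g κ h = 0) (b2 : ∀ h ∈ Icc (-Θ) Θ, gt κ h = 0)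
    (b3 : ∀ t, g t Θ = 0) (b4 : ∀ t, g t (-Θ) = 0)
    (b5 : ∀ t, gh t Θ = 0) (b6 : ∀ t, gh t (-Θ) = 0) :
    ∫ h in (-Θ)..Θ, m h * (g t0 h * ft t0 h - f t0 h * gt t0 h) =
    ∫ h in (-Θ)..Θ, ∫ t in t0..κ, (f t h * (m h * (gtt t h + ghh t h) + m' h * gh t h)
      - g t h * (m h * (ftt t h + fhh t h) + m' h * fh t h)) := by
  have hR := rect_sub_dom ht0 hκ hΘ
  have hm0 : ContinuousOn m (Ioo (-(π/2)) (π/2)) := fun h hh => (hm h hh).continuousAt.continuousWithinAt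
  have mc : ContinuousOn (fun p : ℝ × ℝ => m p.2) (dom T) :=
    hm0.comp continuousOn_snd (fun p hp => hp.2)
  have mc' : ContinuousOn (fun p : ℝ × ℝ => m' p.2) (dom T) :=
    hm'.comp continuousOn_snd (fun p hp => hp.2)
  set A : ℝ → ℝ → ℝ := fun t h => m h * (f t h * gtt t h - g t h * ftt t h) with hA
  set B : ℝ → ℝ → ℝ := fun t h => f t h * (m h * ghh t h + m' h * gh t h) - g t h * (m h * fhh t h + m' h * fh t h) with hB
  have cA : ContinuousOn (fun p : ℝ × ℝ => A p.1 p.2) (dom T) :=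
    mc.mul ((H.c.mul K.ctt).sub (K.c.mul H.ctt))
  have cB : ContinuousOn (fun p : ℝ × ℝ => B p.1 p.2) (dom T) :=
    (H.c.mul ((mc.mul K.chh).add (mc'.mul K.ch))).sub (K.c.mul ((mc.mul H.chh).add (mc'.mul H.ch)))
  have e1 : ∫ h in (-Θ)..Θ, ∫ t in t0..κ, (f t h * (m h * (gtt t h + ghh t h) + m' h * gh t h)
      - g t h * (m h * (ftt t h + fhh t h) + m' h * fh t h)) =
      ∫ h in (-Θ)..Θ, ((∫ t in t0..κ, A t h) + ∫ t in t0..κ, B t h) := by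
    apply intervalIntegral.integral_congr
    intro h hh
    rw [uIcc_of_le (by linarith)] at hh
    simp only
    rw [← intervalIntegral.integral_add]
    · congr 1; funext t; simp only [hA, hB]; ring
    · apply ContinuousOn.intervalIntegrable; rw [uIcc_of_le ht0κ]; exact sliceT cA hR hh
    · apply ContinuousOn.intervalIntegrable; rw [uIcc_of_le ht0κ]; exact sliceT cB hR hh
  rw [e1, intervalIntegral.integral_add (rect_slice ht0κ (by linarith) (cA.mono hR))
    (rect_slice ht0κ (by linarith) (cB.mono hR))]
  have e2 : ∫ h in (-Θ)..Θ, ∫ t in t0..κ, B t h = 0 := by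
    rw [← rect_swap ht0κ (by linarith) (cB.mono hR)]
    rw [intervalIntegral.integral_congr (g := fun _ => (0:ℝ))]
    · simp
    intro t ht
    rw [uIcc_of_le ht0κ] at ht
    simp only
    rw [intervalIntegral.integral_eq_sub_of_hasDerivAt (f := fun h => m h * (f t h * gh t h - g t h * fh t h))]
    · simp [b3, b4, b5, b6]
    · intro h hh
      rw [uIcc_of_le (by linarith)] at hh
      have hd := hR (mk_mem_prod ht hh)
      have := (hm h hd.2).mul (((H.dh t h hd).mul (K.dhh t h hd)).sub ((K.dh t h hd).mul (H.dhh t h hd)))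
      refine this.congr_deriv ?_
      simp only [hB, Pi.mul_apply, Pi.sub_apply]; ring
    · apply ContinuousOn.intervalIntegrable; rw [uIcc_of_le (by linarith)]; exact sliceH cB hR ht
  rw [e2, add_zero]
  apply intervalIntegral.integral_congr
  intro h hh
  rw [uIcc_of_le (by linarith)] at hh
  simp only
  rw [intervalIntegral.integral_eq_sub_of_hasDerivAt (f := fun t => m h * (f t h * gt t h - g t h * ft t h))]
  · simp only [b1 h hh, b2 h hh]; ring
  · intro t ht
    rw [uIcc_of_le ht0κ] at ht
    have hd := hR (mk_mem_prod ht hh)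
    have := (((H.dt t h hd).mul (K.dtt t h hd)).sub ((K.dt t h hd).mul (H.dtt t h hd))).const_mul (m h)
    refine this.congr_deriv ?_
    simp only [hA]; ring
  · apply ContinuousOn.intervalIntegrable; rw [uIcc_of_le ht0κ]; exact sliceT cA hR hh



lemma hasDerivAt_pp (n : ℕ) (s : ℝ) :
    HasDerivAt (fun s : ℝ => (max s 0) ^ (n + 2)) (((n:ℝ) + 2) * (max s 0) ^ (n + 1)) s := by
  rcases lt_trichotomy s 0 with h | h | h
  · have : (fun s : ℝ => (max s 0) ^ (n + 2)) =ᶠ[𝓝 s] fun _ => 0 := by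
      filter_upwards [gt_mem_nhds h] with x hx
      rw [max_eq_right hx.le]; simp
    rw [max_eq_right h.le]
    simpa using (hasDerivAt_const s (0:ℝ)).congr_of_eventuallyEq this
  · subst h
    rw [hasDerivAt_iff_isLittleO_nhds_zero]
    simp only [zero_add, max_self, ne_eq, Nat.add_eq_zero_iff, OfNat.ofNat_ne_zero, and_false, not_false_eq_true, zero_pow, sub_zero]
    have : (fun h : ℝ => (max h 0) ^ (n + 2)) =O[𝓝 0] fun h => h ^ (n + 2) := by
      apply Asymptotics.isBigO_of_le
      intro x
      simp only [norm_pow, Real.norm_eq_abs]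
      apply pow_le_pow_left₀ (abs_nonneg _)
      rw [abs_of_nonneg (le_max_right x 0)]
      exact max_le (le_abs_self x) (abs_nonneg x)
    have h2 : (fun h : ℝ => h ^ (n + 2)) =o[𝓝 0] fun h => h := by
      have := Asymptotics.isLittleO_pow_pow (𝕜 := ℝ) (m := 1) (n := n + 2) (by omega)
      simpa using this
    simpa using this.trans_isLittleO h2
  · have : (fun s : ℝ => (max s 0) ^ (n + 2)) =ᶠ[𝓝 s] fun s => s ^ (n + 2) := by
      filter_upwards [lt_mem_nhds h] with x hx
      rw [max_eq_left hx.le]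
    rw [max_eq_left h.le]
    refine ((hasDerivAt_pow (n+2) s).congr_of_eventuallyEq this).congr_deriv ?_
    push_cast; simp

noncomputable def ph0 (s : ℝ) : ℝ := (max s 0) ^ 3
noncomputable def ph1 (s : ℝ) : ℝ := 3 * (max s 0) ^ 2
noncomputable def ph2 (s : ℝ) : ℝ := 6 * max s 0
lemma ph0_deriv (s : ℝ) : HasDerivAt ph0 (ph1 s) s := by
  refine (hasDerivAt_pp 1 s).congr_deriv ?_
  unfold ph1; norm_num
lemma ph1_deriv (s : ℝ) : HasDerivAt ph1 (ph2 s) s := by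
  refine ((hasDerivAt_pp 0 s).const_mul 3).congr_deriv ?_
  unfold ph2; norm_num; ring
lemma ph2_cont : Continuous ph2 := by unfold ph2; fun_prop
lemma ph_zero {s : ℝ} (h : s ≤ 0) : ph0 s = 0 ∧ ph1 s = 0 ∧ ph2 s = 0 := by
  simp [ph0, ph1, ph2, max_eq_right h]
lemma ph0_nonneg (s : ℝ) : 0 ≤ ph0 s := by unfold ph0; positivity

/-- `sec²` -/
noncomputable def sc (h : ℝ) : ℝ := ((cos h) ^ 2)⁻¹

lemma cos_pos_dom {T t h : ℝ} (hd : (t, h) ∈ dom T) : 0 < cos h := cos_pos_of_mem_Ioo hd.2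

lemma sc_deriv {h : ℝ} (hc : 0 < cos h) : HasDerivAt sc (2 * sc h * tan h) h := by
  unfold sc
  refine (((hasDerivAt_cos h).pow 2).inv (pow_ne_zero 2 hc.ne')).congr_deriv ?_
  rw [tan_eq_sin_div_cos]; simp; field_simp
lemma sc_deriv2 {h : ℝ} (hc : 0 < cos h) : HasDerivAt (fun h => 2 * sc h * tan h) (6 * sc h ^ 2 - 4 * sc h) h := by
  refine (((sc_deriv hc).const_mul 2).mul (hasDerivAt_tan hc.ne')).congr_deriv ?_
  rw [tan_eq_sin_div_cos]
  unfold sc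
  have := sin_sq h
  field_simp
  rw [this]; ring
lemma sc_cont (T : ℝ) : ContinuousOn (fun p : ℝ × ℝ => sc p.2) (dom T) := by
  intro p hp
  exact ((sc_deriv (cos_pos_dom (T := T) (t := p.1) hp)).continuousAt.comp continuous_snd.continuousAt).continuousWithinAt
lemma tan_cont (T : ℝ) : ContinuousOn (fun p : ℝ × ℝ => tan p.2) (dom T) := by
  intro p hp
  exact ((hasDerivAt_tan (cos_pos_dom (T := T) (t := p.1) hp).ne').continuousAt.comp continuous_snd.continuousAt).continuousWithinAt

noncomputable def qq (κ δ t h : ℝ) : ℝ := κ ^ 2 - (κ ^ 2 * δ ^ 2 + t ^ 2) * sc h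

lemma D2_qq (T κ δ : ℝ) : D2 T (qq κ δ) (fun t h => - (2 * t * sc h)) (fun t h => - (2 * sc h))
    (fun t h => - ((κ ^ 2 * δ ^ 2 + t ^ 2) * (2 * sc h * tan h)))
    (fun t h => - ((κ ^ 2 * δ ^ 2 + t ^ 2) * (6 * sc h ^ 2 - 4 * sc h))) := by
  have c1 := sc_cont T
  have c2 := tan_cont T
  unfold qq
  refine ⟨?_, ?_, ?_, ?_, ?_, ?_, ?_, ?_, ?_⟩
  · intro t h hd
    refine ((((hasDerivAt_id t).pow 2).const_add (κ ^ 2 * δ ^ 2)).mul_const (sc h)).const_sub (κ ^ 2) |>.congr_deriv ?_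
    simp
  · intro t h hd
    refine (((hasDerivAt_id t).const_mul 2).mul_const (sc h)).fun_neg.congr_deriv ?_
    simp
  · intro t h hd
    exact ((sc_deriv (cos_pos_dom hd)).const_mul _).const_sub _
  · intro t h hd
    exact ((sc_deriv2 (cos_pos_dom hd)).const_mul _).fun_neg
  all_goals fun_prop

/-- bounds for the test function in its support -/
lemma eta_bound {κ δ t h a : ℝ} (hκ0 : 0 < κ) (hκ1 : κ ≤ 1) (hδ : 0 < δ) (ha : |a| ≤ 1) (hc : 0 < cos h) :
    |(ph2 (qq κ δ t h) * (-(2 * t * sc h)) * (-(2 * t * sc h)) + ph1 (qq κ δ t h) * (-(2 * sc h)))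
      + (ph2 (qq κ δ t h) * (- ((κ ^ 2 * δ ^ 2 + t ^ 2) * (2 * sc h * tan h))) * (- ((κ ^ 2 * δ ^ 2 + t ^ 2) * (2 * sc h * tan h)))
        + ph1 (qq κ δ t h) * (- ((κ ^ 2 * δ ^ 2 + t ^ 2) * (6 * sc h ^ 2 - 4 * sc h))))
      - a * tan h * (ph1 (qq κ δ t h) * (- ((κ ^ 2 * δ ^ 2 + t ^ 2) * (2 * sc h * tan h))))| ≤ 100 * sc h := by
  set q := qq κ δ t h with hq
  set S := sc h with hS
  have hS1 : 1 ≤ S := by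
    rw [hS, sc]; apply (one_le_inv₀ (by positivity)).2
    nlinarith [cos_le_one h]
  have hSt : tan h ^ 2 = S - 1 := by
    rw [hS, sc, tan_eq_sin_div_cos]; have := sin_sq h; field_simp; linarith
  set w := κ ^ 2 * δ ^ 2 + t ^ 2 with hw
  have hw0 : 0 ≤ w := by positivity
  rcases le_or_gt q 0 with h0 | h0
  · obtain ⟨_, e1, e2⟩ := ph_zero h0
    rw [e1, e2]; simp; positivity
  · have hκ2 : κ ^ 2 ≤ 1 := by nlinarith
    have hwS : w * S ≤ 1 := by
      have : q = κ ^ 2 - w * S := rfl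
      linarith
    have hq1 : q ≤ 1 := by
      have : q = κ ^ 2 - w * S := rfl
      have : 0 ≤ w * S := by positivity
      linarith
    have p2 : ph2 q ≤ 6 ∧ 0 ≤ ph2 q := by unfold ph2; rw [max_eq_left h0.le]; constructor <;> linarith
    have p1 : ph1 q ≤ 3 ∧ 0 ≤ ph1 q := by unfold ph1; rw [max_eq_left h0.le]; constructor <;> nlinarith
    have ht : t ^ 2 ≤ w := by rw [hw]; nlinarith [sq_nonneg (κ * δ)]
    have hS0 : 0 ≤ S := by linarith
    have b1 : t ^ 2 * S ≤ 1 := le_trans (by gcongr) hwS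
    have hwS0 : 0 ≤ w * S := by positivity
    have i1 : |ph2 q * (-(2 * t * S)) * (-(2 * t * S))| ≤ 24 * S := by
      rw [show ph2 q * (-(2 * t * S)) * (-(2 * t * S)) = ph2 q * (4 * (t ^ 2 * S) * S) by ring, abs_of_nonneg (by have := p2.2; positivity)]
      calc ph2 q * (4 * (t ^ 2 * S) * S) ≤ 6 * (4 * 1 * S) := by gcongr; exact p2.1
        _ = _ := by ring
    have i2 : |ph1 q * (-(2 * S))| ≤ 6 * S := by
      rw [mul_neg, abs_neg, abs_of_nonneg (by have := p1.2; positivity)]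
      calc ph1 q * (2 * S) ≤ 3 * (2 * S) := by gcongr; exact p1.1
        _ = _ := by ring
    have i3 : |ph2 q * (-(w * (2 * S * tan h))) * (-(w * (2 * S * tan h)))| ≤ 24 * S := by
      rw [show ph2 q * (-(w * (2 * S * tan h))) * (-(w * (2 * S * tan h))) = ph2 q * (4 * ((w * S) * (w * S)) * tan h ^ 2) by ring, abs_of_nonneg (by have := p2.2; positivity)]
      calc ph2 q * (4 * ((w * S) * (w * S)) * tan h ^ 2) ≤ 6 * (4 * (1 * 1) * S) := by
            gcongr
            · exact p2.1
            · linarith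
        _ = _ := by ring
    have i4 : |ph1 q * (-(w * (6 * S ^ 2 - 4 * S)))| ≤ 18 * S := by
      have : 0 ≤ 6 * S - 4 := by linarith
      rw [show ph1 q * (-(w * (6 * S ^ 2 - 4 * S))) = - (ph1 q * ((w * S) * (6 * S - 4))) by ring, abs_neg, abs_of_nonneg (by have := p1.2; positivity)]
      calc ph1 q * ((w * S) * (6 * S - 4)) ≤ 3 * (1 * (6 * S)) := by
            gcongr
            · exact p1.1
            · linarith
        _ = _ := by ring
    have i5 : |a * tan h * (ph1 q * (-(w * (2 * S * tan h))))| ≤ 6 * S := by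
      rw [show a * tan h * (ph1 q * (-(w * (2 * S * tan h)))) = - (a * (ph1 q * (2 * (w * S) * tan h ^ 2))) by ring, abs_neg, abs_mul, abs_of_nonneg (a := ph1 q * _) (by have := p1.2; positivity)]
      calc |a| * (ph1 q * (2 * (w * S) * tan h ^ 2)) ≤ 1 * (3 * (2 * 1 * S)) := by
            have := p1.2
            gcongr
            · exact p1.1
            · linarith
        _ = _ := by ring
    rw [abs_le] at *
    constructor <;> linarith [i1.1, i1.2, i2.1, i2.2, i3.1, i3.2, i4.1, i4.2, i5.1, i5.2]

/-- regularised absolute value -/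
noncomputable def J0 (d V : ℝ) : ℝ := √(V ^ 2 + d ^ 2) - d
noncomputable def J1 (d V : ℝ) : ℝ := V / √(V ^ 2 + d ^ 2)
noncomputable def J2 (d V : ℝ) : ℝ := d ^ 2 / ((V ^ 2 + d ^ 2) * √(V ^ 2 + d ^ 2))
lemma J0_deriv {d : ℝ} (hd : 0 < d) (V : ℝ) : HasDerivAt (J0 d) (J1 d V) V := by
  have hp : 0 < V ^ 2 + d ^ 2 := by positivity
  refine (((((hasDerivAt_id V).pow 2).add_const (d ^ 2)).sqrt hp.ne').sub_const d).congr_deriv ?_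
  unfold J1; simp; field_simp
lemma J1_deriv {d : ℝ} (hd : 0 < d) (V : ℝ) : HasDerivAt (J1 d) (J2 d V) V := by
  have hp : 0 < V ^ 2 + d ^ 2 := by positivity
  have hs : 0 < √(V ^ 2 + d ^ 2) := Real.sqrt_pos.2 hp
  refine ((hasDerivAt_id V).div ((((hasDerivAt_id V).pow 2).add_const (d ^ 2)).sqrt hp.ne') hs.ne').congr_deriv ?_
  unfold J2; simp
  have e : √(V ^ 2 + d ^ 2) ^ 2 = V ^ 2 + d ^ 2 := Real.sq_sqrt hp.le
  field_simp
  rw [e]; ring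
lemma J2_cont {d : ℝ} (hd : 0 < d) : Continuous (J2 d) := by
  unfold J2
  apply Continuous.div (by fun_prop) (by fun_prop)
  intro V
  have hp : 0 < V ^ 2 + d ^ 2 := by positivity
  have hs : 0 < √(V ^ 2 + d ^ 2) := Real.sqrt_pos.2 hp
  positivity
lemma J2_nonneg (d V : ℝ) : 0 ≤ J2 d V := by unfold J2; positivity
lemma J1_abs {d : ℝ} (hd : 0 < d) (V : ℝ) : |J1 d V| ≤ 1 := by
  have hp : 0 < V ^ 2 + d ^ 2 := by positivity
  have hs : 0 < √(V ^ 2 + d ^ 2) := Real.sqrt_pos.2 hp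
  unfold J1
  rw [abs_div, abs_of_pos hs, div_le_one hs]
  apply Real.abs_le_sqrt; nlinarith
lemma J0_abs {d : ℝ} (hd : 0 < d) (V : ℝ) : |J0 d V| ≤ |V| := by
  have h1 : d ≤ √(V ^ 2 + d ^ 2) := by
    apply Real.le_sqrt_of_sq_le; nlinarith [sq_nonneg V]
  unfold J0
  rw [abs_of_nonneg (by linarith)]
  have : √(V ^ 2 + d ^ 2) ≤ |V| + d := by
    apply Real.sqrt_le_iff.2
    refine ⟨by positivity, ?_⟩
    have := sq_abs V
    nlinarith [abs_nonneg V]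
  linarith



lemma integrable_inv_sqrt_cos : IntegrableOn (fun h => 1 / √(cos h)) (Ioo (-(π/2)) (π/2)) := by
  have hpi := Real.pi_pos
  have hr : IntegrableOn (fun h => 1 / √(cos h)) (Ioo 0 (π/2)) := by
    have h1 : IntervalIntegrable (fun x : ℝ => x ^ (-(1/2:ℝ))) volume 0 (π/2) :=
      intervalIntegral.intervalIntegrable_rpow' (by norm_num)
    have h2 := (h1.comp_sub_left (π/2)).symm
    simp only [sub_self, sub_zero] at h2
    rw [intervalIntegrable_iff_integrableOn_Ioo_of_le (by positivity)] at h2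
    refine (h2.const_mul (√(π/2))).mono' ?_ ?_
    · apply ContinuousOn.aestronglyMeasurable _ measurableSet_Ioo
      apply ContinuousOn.div (by fun_prop) (by fun_prop)
      intro x hx
      exact (Real.sqrt_pos.2 (cos_pos_of_mem_Ioo ⟨by linarith [hx.1], hx.2⟩)).ne'
    · filter_upwards [ae_restrict_mem measurableSet_Ioo] with x hx
      have hx0 : 0 < π/2 - x := by linarith [hx.2]
      have hc := Real.one_sub_mul_le_cos hx.1.le hx.2.le
      have e : 1 - 2 / π * x = (π/2 - x) / (π/2) := by field_simp
      rw [e] at hc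
      have hs : √((π/2 - x) / (π/2)) ≤ √(cos x) := Real.sqrt_le_sqrt hc
      have hs0 : 0 < √((π/2 - x) / (π/2)) := Real.sqrt_pos.2 (by positivity)
      rw [Real.norm_of_nonneg (by positivity)]
      calc 1 / √(cos x) ≤ 1 / √((π/2 - x) / (π/2)) := by gcongr
        _ = _ := by
          rw [Real.rpow_neg hx0.le, ← Real.sqrt_eq_rpow, Real.sqrt_div hx0.le]
          field_simp
  have hl : IntegrableOn (fun h => 1 / √(cos h)) (Ioo (-(π/2)) 0) := by
    have h1 : IntervalIntegrable (fun h => 1 / √(cos h)) volume 0 (π/2) := by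
      rwa [intervalIntegrable_iff_integrableOn_Ioo_of_le (by positivity)]
    have h2 := (h1.comp_sub_left 0).symm
    simp only [zero_sub, cos_neg, sub_self, neg_zero] at h2
    rwa [intervalIntegrable_iff_integrableOn_Ioo_of_le (by linarith)] at h2
  have h3 : IntervalIntegrable (fun h => 1 / √(cos h)) volume (-(π/2)) (π/2) := by
    apply IntervalIntegrable.trans (b := 0)
    · rwa [intervalIntegrable_iff_integrableOn_Ioo_of_le (by linarith)]
    · rwa [intervalIntegrable_iff_integrableOn_Ioo_of_le (by linarith)]
  rwa [intervalIntegrable_iff_integrableOn_Ioo_of_le (by linarith)] at h3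

lemma eta_small {κ δ t h : ℝ} (hκ0 : 0 < κ) (hc : 0 < cos h) (ht : κ * cos h ≤ t) : qq κ δ t h ≤ 0 := by
  unfold qq sc
  have : κ ^ 2 * cos h ^ 2 ≤ κ ^ 2 * δ ^ 2 + t ^ 2 := by
    have : (κ * cos h) ^ 2 ≤ t ^ 2 := by gcongr
    nlinarith [sq_nonneg (κ * δ)]
  have h2 : κ ^ 2 ≤ (κ ^ 2 * δ ^ 2 + t ^ 2) * (cos h ^ 2)⁻¹ := by
    rw [← div_eq_mul_inv, le_div_iff₀ (by positivity)]; exact this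
  linarith

lemma eta_le_one {κ δ t h : ℝ} (hκ0 : 0 < κ) (hκ1 : κ ≤ 1) : ph0 (qq κ δ t h) ≤ 1 := by
  have hS : 0 ≤ sc h := by unfold sc; positivity
  have : qq κ δ t h ≤ 1 := by
    unfold qq
    have : 0 ≤ (κ ^ 2 * δ ^ 2 + t ^ 2) * sc h := by positivity
    nlinarith
  unfold ph0
  exact pow_le_one₀ (le_max_right _ _) (max_le this zero_le_one)

lemma kato_aux {s z : ℝ} (h1 : -1 ≤ s) (h2 : s ≤ 1) : -(|z| / 2) ≤ (1 + s) * (z / 4) := by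
  have k1 := mul_nonneg (show 0 ≤ 1 + s by linarith) (show 0 ≤ z + |z| by linarith [neg_abs_le z])
  have k2 := mul_nonneg (show 0 ≤ 1 - s by linarith) (abs_nonneg z)
  nlinarith

set_option maxHeartbeats 1000000 in
lemma kato_t0 {T κ M a t0 d δ Θ : ℝ} (hκ0 : 0 < κ) (hκ1 : κ ≤ 1) (hκT : κ < T) (ha : |a| ≤ 1)
    {m : ℝ → ℝ} (hm : ∀ h ∈ Ioo (-(π/2)) (π/2), HasDerivAt m (-(a * tan h) * m h) h)
    (hmp : ∀ h ∈ Ioo (-(π/2)) (π/2), 0 < m h)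
    {z zt ztt zh zhh : ℝ → ℝ → ℝ} (H : D2 T z zt ztt zh zhh)
    (hz : ∀ t h, (t, h) ∈ dom T → z t h / 4 ≤ ztt t h + zhh t h - a * tan h * zh t h)
    (hM : ∀ t h, (t, h) ∈ dom T → |t| ≤ κ * cos h → m h * |z t h| ≤ M * √(cos h))
    (hM0 : 0 ≤ M)
    (hδ : 0 < δ) (hΘ0 : 0 < Θ) (hΘ : Θ < π/2) (hcΘ : cos Θ = δ)
    (ht0 : 0 < t0) (ht0κ : t0 ≤ κ) (hd : 0 < d) :
    ∫ h in (-Θ)..Θ, m h * (ph0 (qq κ δ t0 h) * (J1 d (z t0 h - z (-t0) h) * (zt t0 h - - zt (-t0) h) + (zt t0 h + - zt (-t0) h))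
      - (J0 d (z t0 h - z (-t0) h) + (z t0 h + z (-t0) h)) * (ph1 (qq κ δ t0 h) * (-(2 * t0 * sc h))))
      ≤ ∫ h in (-Θ)..Θ, 401 * M * (1 / √(cos h)) := by
  have HV := (H.sub H.reflect).comp (J0_deriv hd) (J1_deriv hd) (J2_cont hd)
  have HY := HV.add (H.add H.reflect)
  have Hη := (D2_qq T κ δ).comp ph0_deriv ph1_deriv ph2_cont
  have hcos : ∀ h ∈ Icc (-Θ) Θ, 0 < cos h := fun h hh => cos_pos_of_mem_Ioo ⟨by linarith [hh.1], by linarith [hh.2]⟩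
  have hqκ : ∀ h ∈ Icc (-Θ) Θ, qq κ δ κ h ≤ 0 := fun h hh => by
    apply eta_small hκ0 (hcos h hh); nlinarith [cos_le_one h]
  have hqΘ : ∀ t, qq κ δ t Θ ≤ 0 := fun t => by
    unfold qq sc; rw [hcΘ]
    have : (κ ^ 2 * δ ^ 2 + t ^ 2) * (δ ^ 2)⁻¹ = κ ^ 2 + t ^ 2 * (δ ^ 2)⁻¹ := by field_simp
    rw [this]
    have : 0 ≤ t ^ 2 * (δ ^ 2)⁻¹ := by positivity
    linarith
  have hqΘ' : ∀ t, qq κ δ t (-Θ) ≤ 0 := fun t => by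
    have := hqΘ t
    unfold qq sc at *; rwa [cos_neg]
  have hmc : ContinuousOn m (Ioo (-(π/2)) (π/2)) := fun h hh => (hm h hh).continuousAt.continuousWithinAt
  have htc : ContinuousOn tan (Ioo (-(π/2)) (π/2)) := fun h hh =>
    (hasDerivAt_tan (cos_pos_of_mem_Ioo hh).ne').continuousAt.continuousWithinAt
  have hmc' : ContinuousOn (fun h => -(a * tan h) * m h) (Ioo (-(π/2)) (π/2)) := by fun_prop
  have G := green (t0 := t0) (κ := κ) (Θ := Θ) (m := m) (m' := fun h => -(a * tan h) * m h) HY Hη (by linarith) ht0κ hκT hΘ0 hΘ hm hmc'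
    (fun h hh => (ph_zero (hqκ h hh)).1) (fun h hh => by simp only [(ph_zero (hqκ h hh)).2.1, zero_mul])
    (fun t => (ph_zero (hqΘ t)).1) (fun t => (ph_zero (hqΘ' t)).1)
    (fun t => by simp only [(ph_zero (hqΘ t)).2.1, zero_mul]) (fun t => by simp only [(ph_zero (hqΘ' t)).2.1, zero_mul])
  rw [G]
  clear G
  have hR := rect_sub_dom (T := T) (t0 := t0) (κ := κ) (Θ := Θ) (by linarith) hκT hΘ
  have mc : ContinuousOn (fun p : ℝ × ℝ => m p.2) (dom T) :=
    hmc.comp continuousOn_snd (fun p hp => hp.2)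
  have mc' : ContinuousOn (fun p : ℝ × ℝ => -(a * tan p.2) * m p.2) (dom T) :=
    hmc'.comp continuousOn_snd (fun p hp => hp.2)
  have cP := (HY.c.mul ((mc.mul (Hη.ctt.add Hη.chh)).add (mc'.mul Hη.ch))).sub
    (Hη.c.mul ((mc.mul (HY.ctt.add HY.chh)).add (mc'.mul HY.ch)))
  apply intervalIntegral.integral_mono_on (by linarith)
  · exact rect_slice ht0κ (by linarith) (cP.mono hR)
  · apply ContinuousOn.intervalIntegrable
    rw [uIcc_of_le (by linarith)]
    apply ContinuousOn.mul (by fun_prop)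
    apply ContinuousOn.div (by fun_prop) (by fun_prop)
    intro x hx
    exact (Real.sqrt_pos.2 (hcos x hx)).ne'
  intro h hh
  have hc := hcos h hh
  have hs : 0 < √(cos h) := Real.sqrt_pos.2 hc
  have hs2 : √(cos h) * √(cos h) = cos h := Real.mul_self_sqrt hc.le
  set Cst : ℝ := 401 * M * (√(cos h) * sc h) with hCst
  have hCst0 : 0 ≤ Cst := by rw [hCst]; unfold sc; positivity
  have hpt : ∀ t ∈ Icc t0 κ, (J0 d (z t h - z (-t) h) + (z t h + z (-t) h)) *
          (m h *
              (ph2 (qq κ δ t h) * -(2 * t * sc h) * -(2 * t * sc h) + ph1 (qq κ δ t h) * -(2 * sc h) +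
                (ph2 (qq κ δ t h) * -((κ ^ 2 * δ ^ 2 + t ^ 2) * (2 * sc h * tan h)) *
                    -((κ ^ 2 * δ ^ 2 + t ^ 2) * (2 * sc h * tan h)) +
                  ph1 (qq κ δ t h) * -((κ ^ 2 * δ ^ 2 + t ^ 2) * (6 * sc h ^ 2 - 4 * sc h)))) +
            -(a * tan h) * m h * (ph1 (qq κ δ t h) * -((κ ^ 2 * δ ^ 2 + t ^ 2) * (2 * sc h * tan h)))) -
        ph0 (qq κ δ t h) *
          (m h *
              (J2 d (z t h - z (-t) h) * (zt t h - -zt (-t) h) * (zt t h - -zt (-t) h) +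
                    J1 d (z t h - z (-t) h) * (ztt t h - ztt (-t) h) +
                  (ztt t h + ztt (-t) h) +
                (J2 d (z t h - z (-t) h) * (zh t h - zh (-t) h) * (zh t h - zh (-t) h) +
                    J1 d (z t h - z (-t) h) * (zhh t h - zhh (-t) h) +
                  (zhh t h + zhh (-t) h))) +
            -(a * tan h) * m h * (J1 d (z t h - z (-t) h) * (zh t h - zh (-t) h) + (zh t h + zh (-t) h))) ≤
      (Ioc 0 (κ * cos h)).indicator (fun _ => Cst) t := by
    intro t ht
    have hdm := hR (mk_mem_prod ht hh)
    have hdm' : (-t, h) ∈ dom T := by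
      simp only [dom, mem_prod, mem_Ioo] at hdm ⊢
      exact ⟨⟨by linarith [hdm.1.2], by linarith [hdm.1.1]⟩, hdm.2⟩
    have ht0' : 0 < t := by linarith [ht.1]
    rcases le_or_gt t (κ * cos h) with hk | hk
    · rw [indicator_of_mem (by exact ⟨ht0', hk⟩)]
      have hm0 := hmp h hdm.2
      have e1 := hM t h hdm (by rwa [abs_of_pos ht0'])
      have e2 := hM (-t) h hdm' (by rwa [abs_neg, abs_of_pos ht0'])
      have f1 := hz t h hdm
      have f2 := hz (-t) h hdm'
      have g1 := eta_bound (t := t) hκ0 hκ1 hδ ha hc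
      have g2 := J0_abs hd (z t h - z (-t) h)
      have g3 := J1_abs hd (z t h - z (-t) h)
      have g4 := J2_nonneg d (z t h - z (-t) h)
      have g5 := ph0_nonneg (qq κ δ t h)
      have g6 := eta_le_one (δ := δ) (t := t) (h := h) hκ0 hκ1
      set Lη := ph2 (qq κ δ t h) * -(2 * t * sc h) * -(2 * t * sc h) + ph1 (qq κ δ t h) * -(2 * sc h) +
                (ph2 (qq κ δ t h) * -((κ ^ 2 * δ ^ 2 + t ^ 2) * (2 * sc h * tan h)) *
                    -((κ ^ 2 * δ ^ 2 + t ^ 2) * (2 * sc h * tan h)) +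
                  ph1 (qq κ δ t h) * -((κ ^ 2 * δ ^ 2 + t ^ 2) * (6 * sc h ^ 2 - 4 * sc h))) - a * tan h * (ph1 (qq κ δ t h) * -((κ ^ 2 * δ ^ 2 + t ^ 2) * (2 * sc h * tan h))) with hLη
      set s := J1 d (z t h - z (-t) h) with hs'
      set j2 := J2 d (z t h - z (-t) h)
      set Y := J0 d (z t h - z (-t) h) + (z t h + z (-t) h) with hY
      set LY := j2 * ((zt t h - -zt (-t) h) ^ 2 + (zh t h - zh (-t) h) ^ 2) + (1 + s) * (ztt t h + zhh t h - a * tan h * zh t h)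
        + (1 - s) * (ztt (-t) h + zhh (-t) h - a * tan h * zh (-t) h) with hLY
      set η := ph0 (qq κ δ t h)
      set W := |z t h| + |z (-t) h| with hW
      have hS1 : 1 ≤ sc h := by
        rw [sc]; apply (one_le_inv₀ (by positivity)).2
        nlinarith [cos_le_one h]
      have k1 : |Y| ≤ 2 * W := by
        calc |Y| ≤ |J0 d (z t h - z (-t) h)| + (|z t h| + |z (-t) h|) := (abs_add_le _ _).trans (by gcongr; exact abs_add_le _ _)
          _ ≤ |z t h - z (-t) h| + (|z t h| + |z (-t) h|) := by gcongr
          _ ≤ 2 * W := by have := abs_sub (z t h) (z (-t) h); rw [hW]; linarith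
      have k2 : -(W / 2) ≤ LY := by
        rw [abs_le] at g3
        have n1 : 0 ≤ j2 * ((zt t h - -zt (-t) h) ^ 2 + (zh t h - zh (-t) h) ^ 2) := by positivity
        have n2 : (1 + s) * (z t h / 4) ≤ (1 + s) * (ztt t h + zhh t h - a * tan h * zh t h) :=
          mul_le_mul_of_nonneg_left f1 (by linarith [g3.1])
        have n3 : (1 - s) * (z (-t) h / 4) ≤ (1 - s) * (ztt (-t) h + zhh (-t) h - a * tan h * zh (-t) h) :=
          mul_le_mul_of_nonneg_left f2 (by linarith [g3.2])
        have n4 : -(|z t h| / 2) ≤ (1 + s) * (z t h / 4) := kato_aux g3.1 g3.2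
        have n5 : -(|z (-t) h| / 2) ≤ (1 - s) * (z (-t) h / 4) := by
          have := kato_aux (s := -s) (z := z (-t) h) (by linarith [g3.2]) (by linarith [g3.1])
          rwa [← sub_eq_add_neg] at this
        rw [hLY, hW]; linarith
      have k3 : Y * Lη ≤ 2 * W * (100 * sc h) := by
        calc Y * Lη ≤ |Y * Lη| := le_abs_self _
          _ = |Y| * |Lη| := abs_mul _ _
          _ ≤ _ := by gcongr
      have hW0 : 0 ≤ W := by positivity
      have k4 : - (η * LY) ≤ W / 2 := by
        have p1 := mul_le_mul_of_nonneg_left k2 g5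
        have p2 := mul_le_mul_of_nonneg_right g6 (show 0 ≤ W / 2 by positivity)
        linarith
      have k5 : m h * W ≤ 2 * (M * √(cos h)) := by rw [hW]; linarith
      calc _ = m h * (Y * Lη + -(η * LY)) := by rw [hLη, hLY]; ring
        _ ≤ m h * (2 * W * (100 * sc h) + W / 2 * sc h) := by
            have := mul_le_mul_of_nonneg_left hS1 (show 0 ≤ W / 2 by positivity)
            apply mul_le_mul_of_nonneg_left _ hm0.le
            linarith
        _ = (m h * W) * (200.5 * sc h) := by ring
        _ ≤ (2 * (M * √(cos h))) * (200.5 * sc h) := by gcongr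
        _ = Cst := by rw [hCst]; ring
    · obtain ⟨z0, z1, z2⟩ := ph_zero (eta_small (δ := δ) hκ0 hc hk.le)
      rw [z0, z1, z2, indicator_of_notMem (by rintro ⟨_, h2⟩; linarith)]
      simp
  calc _ ≤ ∫ t in t0..κ, (Ioc 0 (κ * cos h)).indicator (fun _ => Cst) t := by
        apply intervalIntegral.integral_mono_on ht0κ
        · apply ContinuousOn.intervalIntegrable; rw [uIcc_of_le ht0κ]; exact cP.comp (f := fun t : ℝ => (t, h)) (by fun_prop) (fun t ht => hR ⟨ht, hh⟩)
        · rw [intervalIntegrable_iff_integrableOn_Ioc_of_le ht0κ]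
          exact (integrableOn_const (by simp) (by simp)).indicator measurableSet_Ioc
        · exact hpt
    _ = Cst * (volume.real (Ioc t0 κ ∩ Ioc 0 (κ * cos h))) := by
        rw [intervalIntegral.integral_of_le ht0κ, setIntegral_indicator measurableSet_Ioc, setIntegral_const, smul_eq_mul, mul_comm]
    _ ≤ Cst * (κ * cos h) := by
        gcongr
        calc volume.real (Ioc t0 κ ∩ Ioc 0 (κ * cos h)) ≤ volume.real (Ioc 0 (κ * cos h)) :=
              measureReal_mono inter_subset_right (by simp)
          _ = κ * cos h := by
              rw [Measure.real, Real.volume_Ioc, ENNReal.toReal_ofReal] <;> simp; positivity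
    _ ≤ Cst * cos h := by
        gcongr; nlinarith
    _ = _ := by
        have k : √(cos h) * (cos h ^ 2)⁻¹ * cos h = 1 / √(cos h) := by
          rw [eq_div_iff hs.ne']
          calc _ = (√(cos h) * √(cos h)) * (cos h ^ 2)⁻¹ * cos h := by ring
            _ = 1 := by rw [hs2]; field_simp
        rw [hCst, sc, ← k]; ring



lemma slH {D : Set (ℝ × ℝ)} {f : ℝ × ℝ → ℝ} {a b c d : ℝ}
    (hf : ContinuousOn f D) (hD : Icc a b ×ˢ Icc c d ⊆ D) {t : ℝ}
    (ht : t ∈ Icc a b) : ContinuousOn (fun h => f (t, h)) (Icc c d) :=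
  hf.comp (f := fun h : ℝ => (t, h)) (by fun_prop) (fun h hh => hD ⟨ht, hh⟩)

lemma J1_limit {V W : ℝ → ℝ} {p : ℝ} {s : ℕ → ℝ} (hs : ∀ n, 0 < s n) (hs0 : Tendsto s atTop (𝓝 0))
    (hV : Tendsto (fun n => V (s n) / s n) atTop (𝓝 p)) (hW : Tendsto (fun n => W (s n)) atTop (𝓝 p)) :
    Tendsto (fun n => J1 (s n ^ 2) (V (s n)) * W (s n)) atTop (𝓝 |p|) := by
  by_cases hp : p = 0
  · subst hp
    rw [abs_zero]
    apply squeeze_zero_norm (a := fun n => |W (s n)|)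
    · intro n
      rw [Real.norm_eq_abs, abs_mul]
      have := J1_abs (d := s n ^ 2) (by have := hs n; positivity) (V (s n))
      nlinarith [abs_nonneg (W (s n))]
    · simpa using hW.abs
  · have e : ∀ n, J1 (s n ^ 2) (V (s n)) = (V (s n) / s n) / √((V (s n) / s n) ^ 2 + s n ^ 2) := by
      intro n
      have h := hs n
      unfold J1
      have : V (s n) ^ 2 + (s n ^ 2) ^ 2 = s n ^ 2 * ((V (s n) / s n) ^ 2 + s n ^ 2) := by field_simp
      rw [this, Real.sqrt_mul (by positivity), Real.sqrt_sq h.le, div_div]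
    have h1 : Tendsto (fun n => √((V (s n) / s n) ^ 2 + s n ^ 2)) atTop (𝓝 √(p ^ 2 + 0 ^ 2)) :=
      ((hV.pow 2).add (hs0.pow 2)).sqrt
    have hp' : √(p ^ 2 + 0 ^ 2) = |p| := by rw [zero_pow two_ne_zero, add_zero, Real.sqrt_sq_eq_abs]
    rw [hp'] at h1
    have h2 := (hV.div h1 (abs_ne_zero.2 hp)).mul hW
    have h3 : p / |p| * p = |p| := by
      rw [div_mul_eq_mul_div, div_eq_iff (abs_ne_zero.2 hp), abs_mul_abs_self]
    rw [h3] at h2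
    refine h2.congr fun n => ?_
    rw [e]; rfl

set_option maxHeartbeats 1000000 in
lemma kato {T κ M a δ Θ : ℝ} (hκ0 : 0 < κ) (hκ1 : κ ≤ 1) (hκT : κ < T) (ha : |a| ≤ 1)
    {m : ℝ → ℝ} (hm : ∀ h ∈ Ioo (-(π/2)) (π/2), HasDerivAt m (-(a * tan h) * m h) h)
    (hmp : ∀ h ∈ Ioo (-(π/2)) (π/2), 0 < m h)
    {z zt ztt zh zhh : ℝ → ℝ → ℝ} (H : D2 T z zt ztt zh zhh)
    (hz : ∀ t h, (t, h) ∈ dom T → z t h / 4 ≤ ztt t h + zhh t h - a * tan h * zh t h)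
    (hM : ∀ t h, (t, h) ∈ dom T → |t| ≤ κ * cos h → m h * |z t h| ≤ M * √(cos h))
    (hM0 : 0 ≤ M)
    (hδ : 0 < δ) (hΘ0 : 0 < Θ) (hΘ : Θ < π/2) (hcΘ : cos Θ = δ) :
    ∫ h in (-Θ)..Θ, m h * (ph0 (qq κ δ 0 h) * |2 * zt 0 h|) ≤ ∫ h in (-Θ)..Θ, 401 * M * (1 / √(cos h)) := by
  set s : ℕ → ℝ := fun n => κ * en n with hs
  have s0 : ∀ n, 0 < s n := fun n => mul_pos hκ0 (en_pos n)
  have sle : ∀ n, s n ≤ κ := fun n => by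
    have : en n ≤ 1 := by
      unfold en; rw [div_le_one (by positivity)]; have : (0:ℝ) ≤ n := by positivity
      linarith
    simp only [hs]; nlinarith
  have st : Tendsto s atTop (𝓝 0) := by simpa using en_tendsto.const_mul κ
  have hR := rect_sub_dom (T := T) (t0 := -κ) (κ := κ) (Θ := Θ) (by linarith) hκT hΘ
  have hK : IsCompact (Icc (-κ) κ ×ˢ Icc (-Θ) Θ) := isCompact_Icc.prod isCompact_Icc
  have mem : ∀ n, s n ∈ Icc (-κ) κ ∧ -s n ∈ Icc (-κ) κ ∧ (0:ℝ) ∈ Icc (-κ) κ := fun n =>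
    ⟨⟨by linarith [s0 n], sle n⟩, ⟨by linarith [sle n], by linarith [s0 n]⟩, ⟨by linarith, by linarith⟩⟩
  have Hη := (D2_qq T κ δ).comp ph0_deriv ph1_deriv ph2_cont
  have hmc : ContinuousOn m (Ioo (-(π/2)) (π/2)) := fun h hh => (hm h hh).continuousAt.continuousWithinAt
  have hIcc : Icc (-Θ) Θ ⊆ Ioo (-(π/2)) (π/2) := fun h hh => ⟨by linarith [hh.1], by linarith [hh.2]⟩
  obtain ⟨B1, hB1⟩ := hK.exists_bound_of_continuousOn (H.c.mono hR)
  obtain ⟨B2, hB2⟩ := hK.exists_bound_of_continuousOn (H.ct.mono hR)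
  obtain ⟨B3, hB3⟩ := hK.exists_bound_of_continuousOn (Hη.ct.mono hR)
  obtain ⟨B4, hB4⟩ := isCompact_Icc.exists_bound_of_continuousOn (hmc.mono hIcc)
  set I : ℕ → ℝ → ℝ := fun n h => m h * (ph0 (qq κ δ (s n) h) * (J1 (s n ^ 2) (z (s n) h - z (-s n) h) * (zt (s n) h - - zt (-s n) h) + (zt (s n) h + - zt (-s n) h))
      - (J0 (s n ^ 2) (z (s n) h - z (-s n) h) + (z (s n) h + z (-s n) h)) * (ph1 (qq κ δ (s n) h) * (-(2 * s n * sc h)))) with hI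
  have hle : ∀ n, ∫ h in (-Θ)..Θ, I n h ≤ ∫ h in (-Θ)..Θ, 401 * M * (1 / √(cos h)) := fun n =>
    kato_t0 hκ0 hκ1 hκT ha hm hmp H hz hM hM0 hδ hΘ0 hΘ hcΘ (s0 n) (sle n) (by have := s0 n; positivity)
  have hΘ' : uIoc (-Θ) Θ ⊆ Icc (-Θ) Θ := by rw [uIoc_of_le (by linarith)]; exact Ioc_subset_Icc_self
  have lim : Tendsto (fun n => ∫ h in (-Θ)..Θ, I n h) atTop (𝓝 (∫ h in (-Θ)..Θ, m h * (ph0 (qq κ δ 0 h) * |2 * zt 0 h|))) := by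
    apply intervalIntegral.tendsto_integral_filter_of_dominated_convergence (fun _ => B4 * (1 * (1 * (B2 + B2) + (B2 + B2)) + ((B1 + B1) + (B1 + B1)) * B3))
    · refine Eventually.of_forall fun n => ?_
      have HV := (H.sub H.reflect).comp (J0_deriv (d := s n ^ 2) (by have := s0 n; positivity)) (J1_deriv (by have := s0 n; positivity)) (J2_cont (by have := s0 n; positivity))
      have HY := HV.add (H.add H.reflect)
      have a1 := slH HY.c hR (mem n).1
      have a2 := slH HY.ct hR (mem n).1
      have a3 := slH Hη.c hR (mem n).1
      have a4 := slH Hη.ct hR (mem n).1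
      have : ContinuousOn (I n) (Icc (-Θ) Θ) := (hmc.mono hIcc).mul ((a3.mul a2).sub (a1.mul a4))
      exact (this.aestronglyMeasurable measurableSet_Icc).mono_measure (Measure.restrict_mono hΘ' le_rfl)
    · refine Eventually.of_forall fun n => Eventually.of_forall fun h hh => ?_
      have hh := hΘ' hh
      have d0 : 0 < s n ^ 2 := by have := s0 n; positivity
      have v1 := hB1 (s n, h) ⟨(mem n).1, hh⟩
      have v2 := hB1 (-s n, h) ⟨(mem n).2.1, hh⟩
      have v3 := hB2 (s n, h) ⟨(mem n).1, hh⟩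
      have v4 := hB2 (-s n, h) ⟨(mem n).2.1, hh⟩
      have v5 := hB3 (s n, h) ⟨(mem n).1, hh⟩
      have v6 := hB4 h hh
      simp only [Real.norm_eq_abs] at v1 v2 v3 v4 v5 v6
      have n1 : 0 ≤ B1 := (abs_nonneg _).trans v1
      have n2 : 0 ≤ B2 := (abs_nonneg _).trans v3
      have n3 : 0 ≤ B3 := (abs_nonneg _).trans v5
      simp only [hI, Real.norm_eq_abs]
      rw [abs_mul]
      refine mul_le_mul v6 ?_ (abs_nonneg _) ((abs_nonneg _).trans v6)
      refine (abs_sub _ _).trans (add_le_add ?_ ?_)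
      · rw [abs_mul]
        refine mul_le_mul ?_ ?_ (abs_nonneg _) zero_le_one
        · rw [abs_of_nonneg (ph0_nonneg _)]; exact eta_le_one hκ0 hκ1
        · refine (abs_add_le _ _).trans (add_le_add ?_ ?_)
          · rw [abs_mul]
            refine mul_le_mul (J1_abs d0 _) ?_ (abs_nonneg _) zero_le_one
            refine (abs_sub _ _).trans (add_le_add v3 ?_)
            rwa [abs_neg]
          · refine (abs_add_le _ _).trans (add_le_add v3 ?_)
            rwa [abs_neg]
      · rw [abs_mul]
        refine mul_le_mul ?_ v5 (abs_nonneg _) (by positivity)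
        refine (abs_add_le _ _).trans (add_le_add ?_ ?_)
        · exact (J0_abs d0 _).trans ((abs_sub _ _).trans (add_le_add v1 v2))
        · exact (abs_add_le _ _).trans (add_le_add v1 v2)
    · exact intervalIntegrable_const
    · refine Eventually.of_forall fun h hh => ?_
      have hh := hΘ' hh
      have hd0 : ((0:ℝ), h) ∈ dom T := hR ⟨(mem 0).2.2, hh⟩
      have stn : Tendsto (fun n => - s n) atTop (𝓝 0) := by simpa using st.neg
      have cz : ContinuousAt (fun t => z t h) 0 := (H.dt 0 h hd0).continuousAt
      have czt : ContinuousAt (fun t => zt t h) 0 := (H.dtt 0 h hd0).continuousAt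
      have l1 : Tendsto (fun n => z (s n) h) atTop (𝓝 (z 0 h)) := cz.tendsto.comp st
      have l2 : Tendsto (fun n => z (- s n) h) atTop (𝓝 (z 0 h)) := cz.tendsto.comp stn
      have l3 : Tendsto (fun n => zt (s n) h) atTop (𝓝 (zt 0 h)) := czt.tendsto.comp st
      have l4 : Tendsto (fun n => zt (- s n) h) atTop (𝓝 (zt 0 h)) := czt.tendsto.comp stn
      have cη : ContinuousAt (fun t => ph0 (qq κ δ t h)) 0 := (Hη.dt 0 h hd0).continuousAt
      have cηt : ContinuousAt (fun t => ph1 (qq κ δ t h) * (-(2 * t * sc h))) 0 := (Hη.dtt 0 h hd0).continuousAt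
      have l5 : Tendsto (fun n => ph0 (qq κ δ (s n) h)) atTop (𝓝 (ph0 (qq κ δ 0 h))) := cη.tendsto.comp st
      have l6 : Tendsto (fun n => ph1 (qq κ δ (s n) h) * (-(2 * s n * sc h))) atTop (𝓝 0) := by
        have := cηt.tendsto.comp st
        simpa [Function.comp_def] using this
      have l7 : Tendsto (fun n => J0 (s n ^ 2) (z (s n) h - z (-s n) h)) atTop (𝓝 0) := by
        apply squeeze_zero_norm (a := fun n => |z (s n) h - z (-s n) h|)
        · intro n; exact J0_abs (by have := s0 n; positivity) _
        · simpa using (l1.sub l2).abs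
      have l8 : Tendsto (fun n => J1 (s n ^ 2) (z (s n) h - z (-s n) h) * (zt (s n) h - - zt (-s n) h)) atTop (𝓝 |2 * zt 0 h|) := by
        apply J1_limit (V := fun t => z t h - z (-t) h) (W := fun t => zt t h - - zt (-t) h) s0 st
        · have hdV : HasDerivAt (fun t => z t h - z (-t) h) (zt 0 h - - zt (-0) h) 0 := (H.sub H.reflect).dt 0 h hd0
          have := hdV.tendsto_slope.comp (tendsto_nhdsWithin_iff.2 ⟨st, Eventually.of_forall fun n => (s0 n).ne'⟩)
          have e : zt 0 h - - zt (-0) h = 2 * zt 0 h := by rw [neg_zero]; ring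
          rw [e] at this
          refine this.congr fun n => ?_
          simp [slope_def_field]
        · have := l3.sub l4.neg
          rwa [show zt 0 h - - zt 0 h = 2 * zt 0 h by ring] at this
      have := ((l5.mul (l8.add (l3.add l4.neg))).sub ((l7.add (l1.add l2)).mul l6)).const_mul (m h)
      simp only [add_neg_cancel, add_zero, mul_zero, sub_zero] at this
      exact this
  exact le_of_tendsto lim (Eventually.of_forall hle)

/-- lintegral form of the Kato estimate, uniform in `δ` -/
lemma kato_lintegral {T κ M a δ : ℝ} (hκ0 : 0 < κ) (hκ1 : κ ≤ 1) (hκT : κ < T) (ha : |a| ≤ 1)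
    {m : ℝ → ℝ} (hm : ∀ h ∈ Ioo (-(π/2)) (π/2), HasDerivAt m (-(a * tan h) * m h) h)
    (hmp : ∀ h ∈ Ioo (-(π/2)) (π/2), 0 < m h)
    {z zt ztt zh zhh : ℝ → ℝ → ℝ} (H : D2 T z zt ztt zh zhh)
    (hz : ∀ t h, (t, h) ∈ dom T → z t h / 4 ≤ ztt t h + zhh t h - a * tan h * zh t h)
    (hM : ∀ t h, (t, h) ∈ dom T → |t| ≤ κ * cos h → m h * |z t h| ≤ M * √(cos h))
    (hM0 : 0 ≤ M) (hδ : 0 < δ) (hδ1 : δ < 1) :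
    ∫⁻ h in Ioo (-(π/2)) (π/2), ENNReal.ofReal (m h * (ph0 (qq κ δ 0 h) * |2 * zt 0 h|)) ≤
      ENNReal.ofReal (401 * M * ∫ h in Ioo (-(π/2)) (π/2), 1 / √(cos h)) := by
  set Θ := arccos δ with hΘd
  have hΘ0 : 0 < Θ := Real.arccos_pos.2 hδ1
  have hΘ : Θ < π/2 := Real.arccos_lt_pi_div_two.2 hδ
  have hcΘ : cos Θ = δ := Real.cos_arccos (by linarith) hδ1.le
  have K := kato hκ0 hκ1 hκT ha hm hmp H hz hM hM0 hδ hΘ0 hΘ hcΘ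
  have hIcc : Icc (-Θ) Θ ⊆ Ioo (-(π/2)) (π/2) := fun h hh => ⟨by linarith [hh.1], by linarith [hh.2]⟩
  have hIoc : Ioc (-Θ) Θ ⊆ Ioo (-(π/2)) (π/2) := Ioc_subset_Icc_self.trans hIcc
  have hmc : ContinuousOn m (Ioo (-(π/2)) (π/2)) := fun h hh => (hm h hh).continuousAt.continuousWithinAt
  have Hη := (D2_qq T κ δ).comp ph0_deriv ph1_deriv ph2_cont
  have hR := rect_sub_dom (T := T) (t0 := -κ) (κ := κ) (Θ := Θ) (by linarith) hκT hΘ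
  have m0 : (0:ℝ) ∈ Icc (-κ) κ := ⟨by linarith, by linarith⟩
  have cI : ContinuousOn (fun h => m h * (ph0 (qq κ δ 0 h) * |2 * zt 0 h|)) (Icc (-Θ) Θ) :=
    by
    have a1 : ContinuousOn (fun h => ph0 (qq κ δ 0 h)) (Icc (-Θ) Θ) := slH Hη.c hR m0
    have a2 : ContinuousOn (fun h => zt 0 h) (Icc (-Θ) Θ) := slH H.ct hR m0
    have a3 := hmc.mono hIcc
    fun_prop
  have hnn : ∀ h ∈ Ioo (-(π/2)) (π/2), 0 ≤ m h * (ph0 (qq κ δ 0 h) * |2 * zt 0 h|) := fun h hh =>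
    mul_nonneg (hmp h hh).le (mul_nonneg (ph0_nonneg _) (abs_nonneg _))
  have hzero : ∀ h ∈ Ioo (-(π/2)) (π/2) \ Ioc (-Θ) Θ, ENNReal.ofReal (m h * (ph0 (qq κ δ 0 h) * |2 * zt 0 h|)) = 0 := by
    rintro h ⟨h1, h2⟩
    have hc : 0 < cos h := cos_pos_of_mem_Ioo h1
    have hcδ : cos h ≤ δ := by
      rw [← hcΘ, ← Real.cos_abs h]
      apply Real.cos_le_cos_of_nonneg_of_le_pi hΘ0.le
      · exact (abs_le.2 ⟨h1.1.le, h1.2.le⟩).trans (by linarith [Real.pi_pos])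
      · by_contra hcon
        push Not at hcon
        rw [abs_lt] at hcon
        exact h2 ⟨hcon.1, hcon.2.le⟩
    have : qq κ δ 0 h ≤ 0 := by
      unfold qq sc
      have h2 : κ ^ 2 ≤ (κ ^ 2 * δ ^ 2 + 0 ^ 2) * (cos h ^ 2)⁻¹ := by
        rw [← div_eq_mul_inv, le_div_iff₀ (by positivity)]
        have : cos h ^ 2 ≤ δ ^ 2 := by gcongr
        nlinarith [sq_nonneg κ]
      linarith
    rw [(ph_zero this).1]; simp
  have e1 : ∫⁻ h in Ioo (-(π/2)) (π/2), ENNReal.ofReal (m h * (ph0 (qq κ δ 0 h) * |2 * zt 0 h|)) =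
      ∫⁻ h in Ioc (-Θ) Θ, ENNReal.ofReal (m h * (ph0 (qq κ δ 0 h) * |2 * zt 0 h|)) := by
    rw [← lintegral_inter_add_diff _ (Ioo (-(π/2)) (π/2)) (measurableSet_Ioc (a := -Θ) (b := Θ)),
      inter_eq_right.2 hIoc, setLIntegral_congr_fun (measurableSet_Ioo.diff measurableSet_Ioc) hzero]
    simp
  rw [e1, ← ofReal_integral_eq_lintegral_ofReal]
  · apply ENNReal.ofReal_le_ofReal
    rw [intervalIntegral.integral_of_le (by linarith), intervalIntegral.integral_of_le (by linarith)] at K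
    refine K.trans ?_
    rw [integral_const_mul]
    apply mul_le_mul_of_nonneg_left _ (by positivity)
    apply setIntegral_mono_set integrable_inv_sqrt_cos
    · exact Eventually.of_forall fun x => by simp
    · exact hIoc.eventuallyLE
  · exact (cI.integrableOn_Icc).mono_set Ioc_subset_Icc_self
  · filter_upwards [ae_restrict_mem measurableSet_Ioc] with h hh
    exact hnn h (hIoc hh)



/-- partial derivative -/
noncomputable def dd (i : Fin 2) (f : E2 → ℝ) (x : E2) : ℝ := fderiv ℝ f x (e2 i)

lemma hasDerivAt_pt {X Y : ℝ → ℝ} {x' y' s : ℝ} (hX : HasDerivAt X x' s) (hY : HasDerivAt Y y' s) :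
    HasDerivAt (fun s => pt (X s) (Y s)) (x' • e2 0 + y' • e2 1) s := by
  have : (fun s => pt (X s) (Y s)) = fun s => X s • e2 0 + Y s • e2 1 := by
    funext s; rw [pt_eq]
  rw [this]
  exact (hX.smul_const (e2 0)).add (hY.smul_const (e2 1))

lemma chain_pt {g : E2 → ℝ} {X Y : ℝ → ℝ} {x' y' s : ℝ} (hg : DifferentiableAt ℝ g (pt (X s) (Y s)))
    (hX : HasDerivAt X x' s) (hY : HasDerivAt Y y' s) :
    HasDerivAt (fun s => g (pt (X s) (Y s))) (x' * dd 0 g (pt (X s) (Y s)) + y' * dd 1 g (pt (X s) (Y s))) s := by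
  have := hg.hasFDerivAt.comp_hasDerivAt s (hasDerivAt_pt hX hY)
  refine this.congr_deriv ?_
  simp [dd]

lemma dd_contDiffOn {n : ℕ} {f : E2 → ℝ} {N : Set E2} (hN : IsOpen N) (hf : ContDiffOn ℝ (n + 1 : ℕ) f N) (i : Fin 2) :
    ContDiffOn ℝ n (dd i f) N := by
  have := hf.fderiv_of_isOpen hN (m := n) (by norm_cast)
  exact this.clm_apply contDiffOn_const

lemma dd_congr {f g : E2 → ℝ} {x : E2} (h : f =ᶠ[𝓝 x] g) (i : Fin 2) : dd i f x = dd i g x := by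
  unfold dd; rw [h.fderiv_eq]

lemma dd_congr' {f g : E2 → ℝ} {x : E2} (h : f =ᶠ[𝓝 x] g) (i : Fin 2) : dd i f =ᶠ[𝓝 x] dd i g := by
  filter_upwards [h.eventuallyEq_nhds] with y hy using dd_congr hy i

lemma dd_const (c : ℝ) (i : Fin 2) : dd i (fun _ => c) = fun _ => 0 := by
  funext x; simp [dd]

lemma dd_comp {G : ℝ → ℝ} {G' : ℝ} {f : E2 → ℝ} {x : E2} (hG : HasDerivAt G G' (f x)) (hf : DifferentiableAt ℝ f x) (i : Fin 2) :
    dd i (fun y => G (f y)) x = G' * dd i f x := by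
  have := hG.comp_hasFDerivAt x hf.hasFDerivAt
  unfold dd
  rw [show (fun y => G (f y)) = G ∘ f from rfl, this.fderiv]
  simp

lemma dd_mul {f g : E2 → ℝ} {x : E2} (hf : DifferentiableAt ℝ f x) (hg : DifferentiableAt ℝ g x) (i : Fin 2) :
    dd i (fun y => f y * g y) x = f x * dd i g x + g x * dd i f x := by
  unfold dd
  rw [fderiv_fun_mul hf hg]; simp

/-- A one-phase problem, with weight `x₀ ^ a`. -/
structure Ph (a : ℤ) (u : E2 → ℝ) (Ω : Set E2) (r : ℝ) : Prop where
  ha : a = 1 ∨ a = -1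
  op : IsOpen Ω
  rpos : 0 < r
  ball : closedBall (0 : E2) r ∩ {x : E2 | 0 ≤ x 0} ⊆ Ω
  cont : ContinuousOn u (Ω ∩ {x : E2 | 0 < x 0})
  c2 : ContDiffOn ℝ 2 u (Ω ∩ {x : E2 | 0 < x 0} ∩ {x : E2 | 0 < u x})
  pde : ∀ x ∈ Ω ∩ {x : E2 | 0 < x 0} ∩ {x : E2 | 0 < u x},
    x 0 * (dd 0 (dd 0 u) x + dd 1 (dd 1 u) x) + a * dd 0 u x = 0
  flux : ∀ p ∈ Ω, p 0 = 0 → Tendsto (fun x : E2 => (x 0) ^ a * (u x * dd 0 u x))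
      (𝓝[Ω ∩ {x : E2 | 0 < x 0} ∩ {x : E2 | 0 < u x}] p) (𝓝 0)

lemma isOpen_half : IsOpen {x : E2 | 0 < x 0} :=
  isOpen_lt continuous_const (by fun_prop)

lemma Ph.isOpenN {a : ℤ} {u : E2 → ℝ} {Ω : Set E2} {r : ℝ} (h : Ph a u Ω r) : IsOpen (Ω ∩ {x : E2 | 0 < x 0}) :=
  h.op.inter isOpen_half

lemma Ph.isOpenP {a : ℤ} {u : E2 → ℝ} {Ω : Set E2} {r : ℝ} (h : Ph a u Ω r) :
    IsOpen (Ω ∩ {x : E2 | 0 < x 0} ∩ {x : E2 | 0 < u x}) :=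
  h.cont.isOpen_inter_preimage h.isOpenN isOpen_Ioi

section comp
variable {a : ℤ} {u : E2 → ℝ} {Ω : Set E2} {r ε : ℝ} {G G1 G2 : ℝ → ℝ}

lemma Ph.local_zero (h : Ph a u Ω r) (hG : Cut G G1 G2 ε) {x : E2} (hx : x ∈ Ω ∩ {x : E2 | 0 < x 0}) (hu : ¬ 0 < u x) :
    (fun y => G (u y)) =ᶠ[𝓝 x] fun _ => 0 := by
  have hc : ContinuousAt u x := h.cont.continuousAt (h.isOpenN.mem_nhds hx)
  filter_upwards [hc.eventually (gt_mem_nhds (show u x < ε by linarith [hG.pos]))] with y hy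
  exact hG.z0 _ (le_of_lt hy)

lemma Ph.contDiff_comp (h : Ph a u Ω r) (hG : Cut G G1 G2 ε) : ContDiffOn ℝ 2 (fun y => G (u y)) (Ω ∩ {x : E2 | 0 < x 0}) := by
  intro x hx
  apply ContDiffAt.contDiffWithinAt
  by_cases hu : 0 < u x
  · exact hG.contDiff.contDiffAt.comp x (h.c2.contDiffAt (h.isOpenP.mem_nhds ⟨hx, hu⟩))
  · exact (contDiffAt_const (c := (0:ℝ))).congr_of_eventuallyEq (h.local_zero hG hx hu)

lemma Ph.diffu (h : Ph a u Ω r) {x : E2} (hx : x ∈ Ω ∩ {x : E2 | 0 < x 0} ∩ {x : E2 | 0 < u x}) :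
    DifferentiableAt ℝ u x :=
  (h.c2.contDiffAt (h.isOpenP.mem_nhds hx)).differentiableAt (by norm_num)

lemma Ph.diffddu (h : Ph a u Ω r) {x : E2} (hx : x ∈ Ω ∩ {x : E2 | 0 < x 0} ∩ {x : E2 | 0 < u x}) (i : Fin 2) :
    DifferentiableAt ℝ (dd i u) x :=
  ((dd_contDiffOn (n := 1) h.isOpenP h.c2 i).contDiffAt (h.isOpenP.mem_nhds hx)).differentiableAt (by norm_num)

lemma Ph.dd_comp (h : Ph a u Ω r) (hG : Cut G G1 G2 ε) {x : E2} (hx : x ∈ Ω ∩ {x : E2 | 0 < x 0}) (i : Fin 2) :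
    dd i (fun y => G (u y)) x = G1 (u x) * dd i u x := by
  by_cases hu : 0 < u x
  · exact _root_.dd_comp (hG.d1 _) (h.diffu ⟨hx, hu⟩) i
  · rw [dd_congr (h.local_zero hG hx hu) i, dd_const, hG.z1 _ (by linarith [hG.pos]), zero_mul]

lemma Ph.dd2_comp (h : Ph a u Ω r) (hG : Cut G G1 G2 ε) {x : E2} (hx : x ∈ Ω ∩ {x : E2 | 0 < x 0}) (i : Fin 2) :
    dd i (dd i (fun y => G (u y))) x = G2 (u x) * (dd i u x) ^ 2 + G1 (u x) * dd i (dd i u) x := by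
  by_cases hu : 0 < u x
  · have e : dd i (fun y => G (u y)) =ᶠ[𝓝 x] fun y => G1 (u y) * dd i u y := by
      filter_upwards [h.isOpenN.mem_nhds hx] with y hy using h.dd_comp hG hy i
    rw [dd_congr e i, dd_mul (f := fun y => G1 (u y)), _root_.dd_comp (hG.d2 _) (h.diffu ⟨hx, hu⟩) i]
    · ring
    · exact (hG.d2 (u x)).differentiableAt.comp x (h.diffu ⟨hx, hu⟩)
    · exact h.diffddu ⟨hx, hu⟩ i
  · rw [dd_congr (dd_congr' (h.local_zero hG hx hu) i) i, dd_const, dd_const, hG.z1 _ (by linarith [hG.pos]), hG.z2 _ (by linarith [hG.pos])]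
    simp

lemma Ph.eq_comp (h : Ph a u Ω r) (hG : Cut G G1 G2 ε) {x : E2} (hx : x ∈ Ω ∩ {x : E2 | 0 < x 0}) :
    x 0 * (dd 0 (dd 0 (fun y => G (u y))) x + dd 1 (dd 1 (fun y => G (u y))) x) + a * dd 0 (fun y => G (u y)) x
      = x 0 * (G2 (u x) * ((dd 0 u x) ^ 2 + (dd 1 u x) ^ 2)) := by
  rw [h.dd2_comp hG hx, h.dd2_comp hG hx, h.dd_comp hG hx]
  by_cases hu : 0 < u x
  · have := h.pde x ⟨hx, hu⟩
    linear_combination G1 (u x) * this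
  · rw [hG.z1 _ (by linarith [hG.pos]), hG.z2 _ (by linarith [hG.pos])]; ring
end comp

/-- log-polar coordinates -/
noncomputable def PP (r t h : ℝ) : E2 := pt (r * exp t * cos h) (r * exp t * sin h)

lemma D2_polar {a : ℤ} (ha : a = 1 ∨ a = -1) {v : E2 → ℝ} {N : Set E2} {r T k : ℝ} (hr : 0 < r) (hN : IsOpen N)
    (hv : ContDiffOn ℝ 2 v N) (hT : ∀ t h, (t, h) ∈ dom T → PP r t h ∈ N)
    (hsub : ∀ x ∈ N, 0 ≤ x 0 * (dd 0 (dd 0 v) x + dd 1 (dd 1 v) x) + a * dd 0 v x) :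
    ∃ ztt zh zhh : ℝ → ℝ → ℝ, D2 T (fun t h => exp (a * t / 2) * (v (PP r t h) - k))
      (fun t h => exp (a * t / 2) * (r * exp t * cos h * dd 0 v (PP r t h) + r * exp t * sin h * dd 1 v (PP r t h) + a / 2 * (v (PP r t h) - k))) ztt zh zhh ∧
      ∀ t h, (t, h) ∈ dom T → exp (a * t / 2) * (v (PP r t h) - k) / 4 ≤ ztt t h + zhh t h - a * tan h * zh t h := by
  set v1 := dd 0 v with hv1
  set v2 := dd 1 v with hv2
  have c1 : ContDiffOn ℝ 1 v1 N := dd_contDiffOn (n := 1) hN hv 0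
  have c2 : ContDiffOn ℝ 1 v2 N := dd_contDiffOn (n := 1) hN hv 1
  have d0 : ∀ x ∈ N, DifferentiableAt ℝ v x := fun x hx => (hv.contDiffAt (hN.mem_nhds hx)).differentiableAt (by norm_num)
  have d1 : ∀ x ∈ N, DifferentiableAt ℝ v1 x := fun x hx => (c1.contDiffAt (hN.mem_nhds hx)).differentiableAt (by norm_num)
  have d2 : ∀ x ∈ N, DifferentiableAt ℝ v2 x := fun x hx => (c2.contDiffAt (hN.mem_nhds hx)).differentiableAt (by norm_num)
  have hXt : ∀ t h, HasDerivAt (fun t => r * exp t * cos h) (r * exp t * cos h) t := fun t h =>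
    ((hasDerivAt_exp t).const_mul r).mul_const _
  have hYt : ∀ t h, HasDerivAt (fun t => r * exp t * sin h) (r * exp t * sin h) t := fun t h =>
    ((hasDerivAt_exp t).const_mul r).mul_const _
  have hXh : ∀ t h, HasDerivAt (fun h => r * exp t * cos h) (-(r * exp t * sin h)) h := fun t h =>
    ((hasDerivAt_cos h).const_mul _).congr_deriv (by ring)
  have hYh : ∀ t h, HasDerivAt (fun h => r * exp t * sin h) (r * exp t * cos h) h := fun t h =>
    ((hasDerivAt_sin h).const_mul _)
  have gt : ∀ g : E2 → ℝ, (∀ x ∈ N, DifferentiableAt ℝ g x) → ∀ t h, (t, h) ∈ dom T →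
      HasDerivAt (fun s => g (PP r s h)) (r * exp t * cos h * dd 0 g (PP r t h) + r * exp t * sin h * dd 1 g (PP r t h)) t :=
    fun g hg t h hd => chain_pt (hg _ (hT t h hd)) (hXt t h) (hYt t h)
  have gh : ∀ g : E2 → ℝ, (∀ x ∈ N, DifferentiableAt ℝ g x) → ∀ t h, (t, h) ∈ dom T →
      HasDerivAt (fun s => g (PP r t s)) (-(r * exp t * sin h) * dd 0 g (PP r t h) + r * exp t * cos h * dd 1 g (PP r t h)) h :=
    fun g hg t h hd => chain_pt (hg _ (hT t h hd)) (hXh t h) (hYh t h)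
  have het : ∀ t : ℝ, HasDerivAt (fun t : ℝ => exp (a * t / 2)) (exp (a * t / 2) * (a / 2)) t := fun t =>
    (((hasDerivAt_id t).const_mul (a:ℝ)).div_const 2).exp.congr_deriv (by simp)
  have cP : ContinuousOn (fun p : ℝ × ℝ => PP r p.1 p.2) (dom T) := by
    unfold PP
    exact (continuous_pt_comp (by fun_prop) (by fun_prop)).continuousOn
  have cc : ∀ g : E2 → ℝ, ContinuousOn g N → ContinuousOn (fun p : ℝ × ℝ => g (PP r p.1 p.2)) (dom T) :=
    fun g hg => hg.comp cP (fun p hp => hT p.1 p.2 hp)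
  have kX : ContinuousOn (fun p : ℝ × ℝ => r * exp p.1 * cos p.2) (dom T) := by fun_prop
  have kY : ContinuousOn (fun p : ℝ × ℝ => r * exp p.1 * sin p.2) (dom T) := by fun_prop
  have kE : ContinuousOn (fun p : ℝ × ℝ => exp (a * p.1 / 2)) (dom T) := by
    simp only [div_eq_mul_inv]; fun_prop
  have kc : ContinuousOn (fun p : ℝ × ℝ => k) (dom T) := continuousOn_const
  have k0 := cc v hv.continuousOn
  have k1 := cc v1 c1.continuousOn
  have k2 := cc v2 c2.continuousOn
  have k11 := cc _ (dd_contDiffOn (n := 0) hN c1 0).continuousOn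
  have k12 := cc _ (dd_contDiffOn (n := 0) hN c1 1).continuousOn
  have k21 := cc _ (dd_contDiffOn (n := 0) hN c2 0).continuousOn
  have k22 := cc _ (dd_contDiffOn (n := 0) hN c2 1).continuousOn
  refine ⟨fun t h => exp (a * t / 2) * ((r * exp t * cos h * v1 (PP r t h) + r * exp t * cos h * (r * exp t * cos h * dd 0 v1 (PP r t h) + r * exp t * sin h * dd 1 v1 (PP r t h)))
      + (r * exp t * sin h * v2 (PP r t h) + r * exp t * sin h * (r * exp t * cos h * dd 0 v2 (PP r t h) + r * exp t * sin h * dd 1 v2 (PP r t h)))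
      + a * (r * exp t * cos h * v1 (PP r t h) + r * exp t * sin h * v2 (PP r t h)) + a / 2 * (a / 2) * (v (PP r t h) - k)),
    fun t h => exp (a * t / 2) * (-(r * exp t * sin h) * v1 (PP r t h) + r * exp t * cos h * v2 (PP r t h)),
    fun t h => exp (a * t / 2) * (-(r * exp t * cos h) * v1 (PP r t h) + -(r * exp t * sin h) * (-(r * exp t * sin h) * dd 0 v1 (PP r t h) + r * exp t * cos h * dd 1 v1 (PP r t h))
      + (-(r * exp t * sin h) * v2 (PP r t h) + r * exp t * cos h * (-(r * exp t * sin h) * dd 0 v2 (PP r t h) + r * exp t * cos h * dd 1 v2 (PP r t h)))),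
    ⟨?_, ?_, ?_, ?_, ?_, ?_, ?_, ?_, ?_⟩, ?_⟩
  · intro t h hd
    refine ((het t).mul ((gt v d0 t h hd).sub_const k)).congr_deriv ?_
    ring
  · intro t h hd
    refine ((het t).mul ((((hXt t h).mul (gt v1 d1 t h hd)).add ((hYt t h).mul (gt v2 d2 t h hd))).add
      (((gt v d0 t h hd).sub_const k).const_mul ((a:ℝ) / 2)))).congr_deriv ?_
    simp only [Pi.add_apply, Pi.mul_apply, ← hv1, ← hv2]
    ring
  · intro t h hd
    exact ((gh v d0 t h hd).sub_const k).const_mul _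
  · intro t h hd
    refine (((((hXh t h).mul (gh v2 d2 t h hd))).add ((hYh t h).fun_neg.mul (gh v1 d1 t h hd))).const_mul (exp (a * t / 2))).congr_deriv ?_ |>.congr_of_eventuallyEq ?_
    · ring
    · refine Eventually.of_forall fun s => ?_
      simp only [Pi.add_apply, Pi.mul_apply]; ring
  · exact kE.mul (k0.sub kc)
  · exact kE.mul (((kX.mul k1).add (kY.mul k2)).add (continuousOn_const.mul (k0.sub kc)))
  · exact kE.mul (((((kX.mul k1).add (kX.mul ((kX.mul k11).add (kY.mul k12)))).add ((kY.mul k2).add (kY.mul ((kX.mul k21).add (kY.mul k22))))).add (continuousOn_const.mul ((kX.mul k1).add (kY.mul k2)))).add (continuousOn_const.mul (k0.sub kc)))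
  · exact kE.mul ((kY.neg.mul k1).add (kX.mul k2))
  · exact kE.mul (((kX.neg.mul k1).add (kY.neg.mul ((kY.neg.mul k11).add (kX.mul k12)))).add ((kY.neg.mul k2).add (kX.mul ((kY.neg.mul k21).add (kX.mul k22)))))
  · intro t h hd
    have hc := cos_pos_dom hd
    have hs := hsub _ (hT t h hd)
    have e0 : (PP r t h) 0 = r * exp t * cos h := by simp [PP]
    rw [e0] at hs
    set X := r * exp t * cos h with hX
    set Y := r * exp t * sin h with hY
    have hXp : 0 < X := by positivity
    have htan : tan h = Y / X := by
      rw [tan_eq_sin_div_cos, hX, hY]; field_simp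
    have ha2 : (a:ℝ) ^ 2 = 1 := by rcases ha with h | h <;> simp [h]
    simp only
    rw [htan]
    have key := mul_nonneg (exp_pos (a * t / 2)).le (mul_nonneg (show 0 ≤ (X ^ 2 + Y ^ 2) / X by positivity) hs)
    set E := exp (a * t / 2)
    set p := PP r t h
    rw [← sub_nonneg]
    refine key.trans_eq ?_
    have e1 : (a:ℝ) / 2 * (a / 2) = 1 / 4 := by linear_combination ha2 / 4
    rw [e1]
    field_simp
    ring


lemma mp_pt : MeasurePreserving (fun p : ℝ × ℝ => pt p.1 p.2) volume volume := by
  have h1 := (volume_preserving_finTwoArrow ℝ).symm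
  have h2 := (PiLp.volume_preserving_toLp (Fin 2)).comp h1
  have e : (fun p : ℝ × ℝ => pt p.1 p.2) = WithLp.toLp 2 ∘ (MeasurableEquiv.finTwoArrow (α := ℝ)).symm := by
    ext p i
    fin_cases i <;> simp [pt, MeasurableEquiv.finTwoArrow]
  rw [e]
  exact h2

lemma me_pt : MeasurableEmbedding (fun p : ℝ × ℝ => pt p.1 p.2) := by
  have h1 := (MeasurableEquiv.toLp 2 (Fin 2 → ℝ)).measurableEmbedding.comp (MeasurableEquiv.finTwoArrow (α := ℝ)).symm.measurableEmbedding
  convert h1 using 1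
  ext p i
  fin_cases i <;> simp [pt, MeasurableEquiv.finTwoArrow]

lemma integral_pt (f : E2 → ℝ) : ∫ x, f x = ∫ p : ℝ × ℝ, f (pt p.1 p.2) :=
  (mp_pt.integral_comp me_pt f).symm

lemma gam_norm {ρ : ℝ} (hρ : 0 ≤ ρ) (θ : ℝ) : ‖gam ρ θ‖ = ρ := by
  rw [gam, norm_pt]
  have : (ρ * cos θ) ^ 2 + (ρ * sin θ) ^ 2 = ρ ^ 2 := by
    linear_combination ρ ^ 2 * (sin_sq_add_cos_sq θ)
  rw [this, sqrt_sq hρ]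

lemma integral_ball_polar {r : ℝ} (hr : 0 < r) (f : E2 → ℝ) :
    ∫ x in ball (0 : E2) r, f x = ∫ p in Icc ((0 : ℝ), -π) (r, π), p.1 * f (gam p.1 p.2) := by
  rw [← integral_indicator isOpen_ball.measurableSet, integral_pt, ← integral_comp_polarCoord_symm]
  have e1 : ∀ p ∈ polarCoord.target, p.1 • (ball (0 : E2) r).indicator f (pt (polarCoord.symm p).1 (polarCoord.symm p).2)
      = (Ioo 0 r ×ˢ Ioo (-π) π).indicator (fun p : ℝ × ℝ => p.1 * f (gam p.1 p.2)) p := by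
    intro p hp
    rw [polarCoord_target] at hp
    rw [polarCoord_symm_apply]
    change p.1 • (ball (0 : E2) r).indicator f (gam p.1 p.2) = _
    have hm : gam p.1 p.2 ∈ ball (0 : E2) r ↔ p.1 < r := by
      rw [mem_ball_zero_iff, gam_norm hp.1.le]
    by_cases h : p.1 < r
    · rw [indicator_of_mem (hm.2 h), indicator_of_mem (show p ∈ Ioo 0 r ×ˢ Ioo (-π) π from ⟨⟨hp.1, h⟩, hp.2⟩), smul_eq_mul]
    · rw [indicator_of_notMem (fun h' => h (hm.1 h')), indicator_of_notMem (fun h' : p ∈ Ioo 0 r ×ˢ Ioo (-π) π => h h'.1.2), smul_zero]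
  rw [setIntegral_congr_fun (polarCoord.open_target.measurableSet) e1, setIntegral_indicator (measurableSet_Ioo.prod measurableSet_Ioo)]
  have e2 : polarCoord.target ∩ Ioo 0 r ×ˢ Ioo (-π) π = Ioo 0 r ×ˢ Ioo (-π) π := by
    rw [polarCoord_target]
    apply inter_eq_right.2
    exact prod_mono (fun x hx => hx.1) subset_rfl
  rw [e2, ← Icc_prod_Icc]
  refine setIntegral_congr_set ?_
  exact Measure.set_prod_ae_eq Ioo_ae_eq_Icc Ioo_ae_eq_Icc

lemma disc_div {X1 X2 : E2 → ℝ} {M : Set E2} {r : ℝ} (hr : 0 < r) (hM : IsOpen M) (hb : closedBall (0 : E2) r ⊆ M)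
    (h1 : ContDiffOn ℝ 1 X1 M) (h2 : ContDiffOn ℝ 1 X2 M) :
    ∫ x in ball (0 : E2) r, (dd 0 X1 x + dd 1 X2 x) =
      ∫ θ in (-π)..π, (r * cos θ * X1 (gam r θ) + r * sin θ * X2 (gam r θ)) := by
  rw [integral_ball_polar hr]
  have d1 : ∀ x ∈ M, DifferentiableAt ℝ X1 x := fun x hx => (h1.contDiffAt (hM.mem_nhds hx)).differentiableAt (by norm_num)
  have d2 : ∀ x ∈ M, DifferentiableAt ℝ X2 x := fun x hx => (h2.contDiffAt (hM.mem_nhds hx)).differentiableAt (by norm_num)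
  set f : ℝ × ℝ → ℝ := fun q => q.1 * cos q.2 * X1 (gam q.1 q.2) + q.1 * sin q.2 * X2 (gam q.1 q.2) with hf
  set g : ℝ × ℝ → ℝ := fun q => -sin q.2 * X1 (gam q.1 q.2) + cos q.2 * X2 (gam q.1 q.2) with hg
  have hQ : ∀ q ∈ Icc ((0 : ℝ), -π) (r, π), gam q.1 q.2 ∈ M := by
    intro q hq
    apply hb
    rw [mem_closedBall_zero_iff, gam_norm hq.1.1]
    exact hq.2.1
  have dg : ∀ q : ℝ × ℝ, DifferentiableAt ℝ (fun q : ℝ × ℝ => gam q.1 q.2) q := by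
    intro q
    simp only [gam, pt_eq]
    fun_prop
  have cg : Continuous (fun q : ℝ × ℝ => gam q.1 q.2) := continuous_iff_continuousAt.2 fun q => (dg q).continuousAt
  have df : ∀ q : ℝ × ℝ, gam q.1 q.2 ∈ M → DifferentiableAt ℝ f q := by
    intro q hq
    have k1 := (d1 _ hq).comp q (dg q)
    have k2 := (d2 _ hq).comp q (dg q)
    exact ((by fun_prop : DifferentiableAt ℝ (fun q : ℝ × ℝ => q.1 * cos q.2) q).mul k1).add
      ((by fun_prop : DifferentiableAt ℝ (fun q : ℝ × ℝ => q.1 * sin q.2) q).mul k2)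
  have dg' : ∀ q : ℝ × ℝ, gam q.1 q.2 ∈ M → DifferentiableAt ℝ g q := by
    intro q hq
    have k1 := (d1 _ hq).comp q (dg q)
    have k2 := (d2 _ hq).comp q (dg q)
    exact ((by fun_prop : DifferentiableAt ℝ (fun q : ℝ × ℝ => - sin q.2) q).mul k1).add
      ((by fun_prop : DifferentiableAt ℝ (fun q : ℝ × ℝ => cos q.2) q).mul k2)
  have ef : ∀ q : ℝ × ℝ, gam q.1 q.2 ∈ M → fderiv ℝ f q (1, 0) + fderiv ℝ g q (0, 1) =
      q.1 * (dd 0 X1 (gam q.1 q.2) + dd 1 X2 (gam q.1 q.2)) := by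
    rintro ⟨ρ, θ⟩ hq
    simp only at hq
    have s1 : HasDerivAt (fun s => f (s, θ)) (fderiv ℝ f (ρ, θ) (1, 0)) ρ :=
      (df _ hq).hasFDerivAt.comp_hasDerivAt ρ ((hasDerivAt_id ρ).prodMk (hasDerivAt_const ρ θ))
    have s2 : HasDerivAt (fun s => g (ρ, s)) (fderiv ℝ g (ρ, θ) (0, 1)) θ :=
      (dg' _ hq).hasFDerivAt.comp_hasDerivAt θ ((hasDerivAt_const θ ρ).prodMk (hasDerivAt_id θ))
    have a1 : HasDerivAt (fun s : ℝ => s * cos θ) (cos θ) ρ := by simpa using (hasDerivAt_id ρ).mul_const (cos θ)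
    have a2 : HasDerivAt (fun s : ℝ => s * sin θ) (sin θ) ρ := by simpa using (hasDerivAt_id ρ).mul_const (sin θ)
    have b1 : HasDerivAt (fun s : ℝ => ρ * cos s) (-(ρ * sin θ)) θ := ((hasDerivAt_cos θ).const_mul ρ).congr_deriv (by ring)
    have b2 : HasDerivAt (fun s : ℝ => ρ * sin s) (ρ * cos θ) θ := (hasDerivAt_sin θ).const_mul ρ
    have t1 := (a1.mul (chain_pt (X := fun s => s * cos θ) (Y := fun s => s * sin θ) (s := ρ) (d1 _ hq) a1 a2)).add (a2.mul (chain_pt (X := fun s => s * cos θ) (Y := fun s => s * sin θ) (s := ρ) (d2 _ hq) a1 a2))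
    have t2 := ((hasDerivAt_sin θ).neg.mul (chain_pt (X := fun s => ρ * cos s) (Y := fun s => ρ * sin s) (s := θ) (d1 _ hq) b1 b2)).add ((hasDerivAt_cos θ).mul (chain_pt (X := fun s => ρ * cos s) (Y := fun s => ρ * sin s) (s := θ) (d2 _ hq) b1 b2))
    rw [s1.unique t1, s2.unique t2]
    simp only [gam, Pi.neg_apply]
    linear_combination ρ * (dd 0 X1 (pt (ρ * cos θ) (ρ * sin θ)) + dd 1 X2 (pt (ρ * cos θ) (ρ * sin θ))) * (sin_sq_add_cos_sq θ)
  have hle : ((0 : ℝ), -π) ≤ (r, π) := ⟨hr.le, by simp only; linarith [pi_pos]⟩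
  have key := integral_divergence_prod_Icc_of_hasFDerivAt_off_countable_of_le f g (fderiv ℝ f) (fderiv ℝ g) (0, -π) (r, π)
    hle ∅ countable_empty
    (fun q hq => (df q (hQ q hq)).continuousAt.continuousWithinAt) (fun q hq => (dg' q (hQ q hq)).continuousAt.continuousWithinAt)
    (fun q hq => (df q (hQ q ⟨⟨hq.1.1.1.le, hq.1.2.1.le⟩, ⟨hq.1.1.2.le, hq.1.2.2.le⟩⟩)).hasFDerivAt)
    (fun q hq => (dg' q (hQ q ⟨⟨hq.1.1.1.le, hq.1.2.1.le⟩, ⟨hq.1.1.2.le, hq.1.2.2.le⟩⟩)).hasFDerivAt) ?_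
  · rw [setIntegral_congr_fun measurableSet_Icc (fun q hq => ef q (hQ q hq))] at key
    rw [key]
    simp [hf, hg, gam]
  · refine IntegrableOn.congr_fun ?_ (fun q hq => (ef q (hQ q hq)).symm) measurableSet_Icc
    refine ContinuousOn.integrableOn_compact isCompact_Icc ?_
    have c1 := (dd_contDiffOn (n := 0) hM h1 0).continuousOn.comp cg.continuousOn hQ
    have c2 := (dd_contDiffOn (n := 0) hM h2 1).continuousOn.comp cg.continuousOn hQ
    exact continuousOn_fst.mul (c1.add c2)


lemma Ph.extend {a : ℤ} {u : E2 → ℝ} {Ω : Set E2} {r : ℝ} (h : Ph a u Ω r) : ∃ R, r < R ∧ Ph a u Ω R := by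
  have hK : IsCompact (closedBall (0 : E2) r ∩ {x : E2 | 0 ≤ x 0}) :=
    (isCompact_closedBall _ _).inter_right (isClosed_le continuous_const (by fun_prop))
  obtain ⟨δ, hδ, hs⟩ := hK.exists_cthickening_subset_open h.op h.ball
  have hr := h.rpos
  refine ⟨r + δ, by linarith, h.ha, h.op, by linarith, ?_, h.cont, h.c2, h.pde, h.flux⟩
  rintro x ⟨hx, hx0⟩
  apply hs
  rw [mem_closedBall_zero_iff] at hx
  rw [mem_setOf_eq] at hx0
  refine mem_cthickening_of_dist_le x ((r / (r + δ)) • x) δ _ ⟨?_, ?_⟩ ?_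
  · rw [mem_closedBall_zero_iff, norm_smul, norm_of_nonneg (by positivity)]
    calc r / (r + δ) * ‖x‖ ≤ r / (r + δ) * (r + δ) := by gcongr
      _ = r := by field_simp
  · show 0 ≤ (r / (r + δ)) * x 0
    positivity
  · rw [dist_eq_norm]
    have : x - (r / (r + δ)) • x = (δ / (r + δ)) • x := by
      nth_rewrite 1 [← one_smul ℝ x]
      rw [← sub_smul]; congr 1; field_simp; ring
    rw [this, norm_smul, norm_of_nonneg (by positivity)]
    calc δ / (r + δ) * ‖x‖ ≤ δ / (r + δ) * (r + δ) := by gcongr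
      _ = δ := by field_simp

lemma Ph.flux_unif {a : ℤ} {u : E2 → ℝ} {Ω : Set E2} {r : ℝ} (h : Ph a u Ω r) {η : ℝ} (hη : 0 < η) :
    ∃ δ > 0, ∀ x y : ℝ, 0 < x → x < δ → |y| ≤ r → pt x y ∈ Ω ∧
      (0 < u (pt x y) → |x ^ a * (u (pt x y) * dd 0 u (pt x y))| ≤ η) := by
  set Q : E2 → Prop := fun x => x ∈ Ω ∧ (x ∈ Ω ∩ {x : E2 | 0 < x 0} ∩ {x : E2 | 0 < u x} → |(x 0) ^ a * (u x * dd 0 u x)| ≤ η)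
  set U : Set E2 := {x | ∀ᶠ y in 𝓝 x, Q y}
  have hU : IsOpen U := isOpen_setOf_eventually_nhds
  set K : Set E2 := (fun y => pt 0 y) '' Icc (-r) r
  have hK : IsCompact K := isCompact_Icc.image (continuous_pt_comp continuous_const continuous_id)
  have hKU : K ⊆ U := by
    rintro _ ⟨y, hy, rfl⟩
    have hm : pt 0 y ∈ Ω := by
      apply h.ball
      refine ⟨?_, by simp⟩
      rw [mem_closedBall_zero_iff, norm_pt]
      simp [sqrt_sq_eq_abs, abs_le, hy.1, hy.2]
    have h1 := h.flux (pt 0 y) hm (by simp)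
    have h2 := h1.eventually (Metric.closedBall_mem_nhds (0:ℝ) hη)
    rw [eventually_nhdsWithin_iff] at h2
    filter_upwards [h2, h.op.mem_nhds hm] with x hx hxΩ
    refine ⟨hxΩ, fun hP => ?_⟩
    have := hx hP
    rwa [Real.dist_eq, sub_zero] at this
  obtain ⟨δ, hδ, hs⟩ := hK.exists_thickening_subset_open hU hKU
  refine ⟨δ, hδ, fun x y hx hxδ hy => ?_⟩
  have hm : pt x y ∈ U := by
    apply hs
    rw [mem_thickening_iff]
    refine ⟨pt 0 y, ⟨y, abs_le.1 hy, rfl⟩, ?_⟩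
    rw [dist_eq_norm, pt_sub, norm_pt]
    simp [sqrt_sq_eq_abs, abs_of_pos hx, hxδ]
  have hq : Q (pt x y) := Eventually.self_of_nhds hm
  refine ⟨hq.1, fun hu => ?_⟩
  have := hq.2 ⟨⟨hq.1, by simpa using hx⟩, hu⟩
  simpa using this

lemma dS0_bound : ∃ C > 0, ∀ s > 0, ∀ τ, |deriv (S0 s) τ| ≤ C / s := by
  have hcd : Continuous (deriv Real.smoothTransition) :=
    (Real.smoothTransition.contDiff (n := 1)).continuous_deriv (by norm_num)
  obtain ⟨C, hC⟩ := isCompact_Icc.exists_bound_of_continuousOn (s := Icc (0:ℝ) 1) hcd.continuousOn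
  have hCb : ∀ τ, |deriv Real.smoothTransition τ| ≤ max C 1 := by
    intro τ
    by_cases h0 : τ < 0
    · have : Real.smoothTransition =ᶠ[𝓝 τ] fun _ => 0 := by
        filter_upwards [gt_mem_nhds h0] with y hy using Real.smoothTransition.zero_of_nonpos (le_of_lt hy)
      rw [this.deriv_eq]; simp
    by_cases h1 : 1 < τ
    · have : Real.smoothTransition =ᶠ[𝓝 τ] fun _ => 1 := by
        filter_upwards [lt_mem_nhds h1] with y hy using Real.smoothTransition.one_of_one_le (le_of_lt hy)
      rw [this.deriv_eq]; simp
    exact (hC τ ⟨by linarith, by linarith⟩).trans (le_max_left _ _)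
  refine ⟨max C 1, by positivity, fun s hs τ => ?_⟩
  have hd : HasDerivAt (S0 s) (deriv Real.smoothTransition (τ / s - 1) * (1 / s)) τ := by
    have h1 : HasDerivAt Real.smoothTransition (deriv Real.smoothTransition (τ / s - 1)) (τ / s - 1) :=
      ((Real.smoothTransition.contDiff (n := 1)).differentiable (by norm_num) _).hasDerivAt
    exact h1.comp τ (((hasDerivAt_id τ).div_const s).sub_const 1)
  rw [hd.deriv, abs_mul, abs_of_pos (show 0 < 1 / s by positivity), div_eq_mul_one_div (max C 1) s]
  gcongr
  exact hCb _

lemma dS0_zero {s τ : ℝ} (hs : 0 < s) (h : τ < s ∨ 2 * s < τ) : deriv (S0 s) τ = 0 := by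
  rcases h with h | h
  · have : S0 s =ᶠ[𝓝 τ] fun _ => 0 := by
      filter_upwards [gt_mem_nhds h] with y hy using S0_zero hs (le_of_lt hy)
    rw [this.deriv_eq]; simp
  · have : S0 s =ᶠ[𝓝 τ] fun _ => 1 := by
      filter_upwards [lt_mem_nhds h] with y hy using S0_one hs (le_of_lt hy)
    rw [this.deriv_eq]; simp

lemma dd_coord {f : ℝ → ℝ} {f' : ℝ} {x : E2} (hf : HasDerivAt f f' (x 0)) :
    dd 0 (fun y : E2 => f (y 0)) x = f' ∧ dd 1 (fun y : E2 => f (y 0)) x = 0 := by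
  have hp : HasFDerivAt (fun y : E2 => y 0) (EuclideanSpace.proj 0 : E2 →L[ℝ] ℝ) x :=
    (EuclideanSpace.proj (𝕜 := ℝ) (0 : Fin 2)).hasFDerivAt
  have := hf.comp_hasFDerivAt x hp
  unfold dd
  have e : fderiv ℝ (fun y : E2 => f (y 0)) x = f' • (EuclideanSpace.proj 0 : E2 →L[ℝ] ℝ) := this.fderiv
  rw [e]
  simp [e2]

/-- The cut-off identity. -/
lemma Ph.identity {a : ℤ} {u : E2 → ℝ} {Ω : Set E2} {r : ℝ} (h : Ph a u Ω r) {ε s : ℝ} (hε : 0 < ε) (hs : 0 < s) :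
    ∫ x in Metric.ball (0 : E2) r, (deriv (S0 s) (x 0) * ((x 0) ^ a * (S1 ε (u x) * dd 0 u x)) +
        S0 s (x 0) * ((x 0) ^ a * (S0 ε (u x) * ((dd 0 u x) ^ 2 + (dd 1 u x) ^ 2)))) =
      ∫ θ in (-π)..π, S0 s (r * cos θ) * ((r * cos θ) ^ a * (S1 ε (u (gam r θ)) *
        (r * cos θ * dd 0 u (gam r θ) + r * sin θ * dd 1 u (gam r θ)))) := by
  set N := Ω ∩ {x : E2 | 0 < x 0} with hN
  set v : E2 → ℝ := fun y => S2 ε (u y) with hv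
  have cv : ContDiffOn ℝ 2 v N := h.contDiff_comp (cut_S2 hε)
  set X : Fin 2 → E2 → ℝ := fun i x => S0 s (x 0) * ((x 0) ^ a * dd i v x) with hX
  set Z : Set E2 := {x : E2 | x 0 < s} with hZ
  have oZ : IsOpen Z := isOpen_lt (by fun_prop) continuous_const
  have hz : ∀ i, ∀ x ∈ Z, X i =ᶠ[𝓝 x] fun _ => 0 := by
    intro i x hx
    filter_upwards [oZ.mem_nhds hx] with y hy
    simp only [hX]
    rw [S0_zero hs (le_of_lt hy), zero_mul]
  have cw : ∀ x : E2, x ∈ N → ContDiffAt ℝ 1 (fun y : E2 => (y 0) ^ a) x := by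
    intro x hx
    have h0 : x 0 ≠ 0 := ne_of_gt hx.2
    have c0 : ContDiffAt ℝ 1 (fun y : E2 => y 0) x := by fun_prop
    rcases h.ha with e | e
    · rw [e]; simpa using c0
    · rw [e]; simp only [zpow_neg_one]; exact c0.inv h0
  have cl : ∀ x : E2, ContDiffAt ℝ 1 (fun y : E2 => S0 s (y 0)) x := by
    intro x
    have c0 : ContDiffAt ℝ 1 (fun y : E2 => y 0) x := by fun_prop
    exact (S0_contDiff s).contDiffAt.comp x c0
  have cd : ∀ i, ∀ x ∈ N, ContDiffAt ℝ 1 (dd i v) x := fun i x hx =>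
    (dd_contDiffOn (n := 1) h.isOpenN cv i).contDiffAt (h.isOpenN.mem_nhds hx)
  have cX : ∀ i, ContDiffOn ℝ 1 (X i) (N ∪ Z) := by
    intro i x hx
    apply ContDiffAt.contDiffWithinAt
    rcases hx with hx | hx
    · exact (cl x).mul ((cw x hx).mul (cd i x hx))
    · exact contDiffAt_const.congr_of_eventuallyEq (hz i x hx)
  have key := disc_div h.rpos (h.isOpenN.union oZ) (?_ : closedBall (0:E2) r ⊆ N ∪ Z) (cX 0) (cX 1)
  · have lhs : ∀ x ∈ Metric.ball (0:E2) r, dd 0 (X 0) x + dd 1 (X 1) x = deriv (S0 s) (x 0) * ((x 0) ^ a * (S1 ε (u x) * dd 0 u x)) +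
        S0 s (x 0) * ((x 0) ^ a * (S0 ε (u x) * ((dd 0 u x) ^ 2 + (dd 1 u x) ^ 2))) := by
      intro x hxb
      by_cases hx : x ∈ Z
      · rw [dd_congr (hz 0 x hx), dd_congr (hz 1 x hx), dd_const, dd_const, S0_zero hs (le_of_lt hx), dS0_zero hs (Or.inl hx)]
        simp
      · have hx0 : 0 < x 0 := lt_of_lt_of_le hs (not_lt.1 hx)
        have hxN : x ∈ N := ⟨h.ball ⟨ball_subset_closedBall hxb, hx0.le⟩, hx0⟩
        have l1 := dd_coord (x := x) ((S0_contDiff s).differentiable (by norm_num) (x 0)).hasDerivAt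
        have l2 := dd_coord (x := x) (hasDerivAt_zpow a (x 0) (Or.inl hx0.ne'))
        have dl := (cl x).differentiableAt (by norm_num)
        have dw := (cw x hxN).differentiableAt (by norm_num)
        have dv := fun i => (cd i x hxN).differentiableAt (by norm_num)
        have m0 : dd 0 (X 0) x = _ := dd_mul dl (dw.mul (dv 0)) 0
        have m1 : dd 1 (X 1) x = _ := dd_mul dl (dw.mul (dv 1)) 1
        have n0 := dd_mul dw (dv 0) 0
        have n1 := dd_mul dw (dv 1) 1
        have eq := h.eq_comp (cut_S2 hε) hxN
        have ev := h.dd_comp (cut_S2 hε) hxN 0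
        rw [m0, m1, l1.1, l1.2]
        have n0' : dd 0 ((fun y : E2 => y 0 ^ a) * dd 0 v) x = _ := n0
        have n1' : dd 1 ((fun y : E2 => y 0 ^ a) * dd 1 v) x = _ := n1
        rw [n0', n1', l2.1, l2.2]
        simp only [Pi.mul_apply]
        have hz1 : (x 0) ^ a = (x 0) ^ (a - 1) * x 0 := by rw [← zpow_add_one₀ hx0.ne']; simp
        rw [← hv] at eq ev
        rw [hz1]
        linear_combination S0 s (x 0) * (x 0) ^ (a - 1) * eq + deriv (S0 s) (x 0) * ((x 0) ^ (a - 1) * x 0) * ev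
    rw [setIntegral_congr_fun isOpen_ball.measurableSet lhs] at key
    rw [key]
    refine intervalIntegral.integral_congr fun θ _ => ?_
    have e0 : (gam r θ) 0 = r * cos θ := by simp [gam]
    simp only [hX, e0]
    by_cases hx : gam r θ ∈ Z
    · have : r * cos θ < s := by rw [← e0]; exact hx
      rw [S0_zero hs this.le]; ring
    · have hx0 : 0 < gam r θ 0 := lt_of_lt_of_le hs (not_lt.1 hx)
      have hxN : gam r θ ∈ N := ⟨h.ball ⟨by rw [mem_closedBall_zero_iff, gam_norm h.rpos.le], hx0.le⟩, hx0⟩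
      rw [h.dd_comp (cut_S2 hε) hxN 0, h.dd_comp (cut_S2 hε) hxN 1]
      ring
  · intro x hx
    by_cases hx0 : 0 < x 0
    · exact Or.inl ⟨h.ball ⟨hx, hx0.le⟩, hx0⟩
    · exact Or.inr (lt_of_le_of_lt (not_lt.1 hx0) hs)


lemma integrable_of_fatou {α : Type*} [MeasurableSpace α] {μ : Measure α} {f : ℕ → α → ℝ} {g : α → ℝ} {C : ℝ≥0∞} (hC : C < ∞)
    (hm : ∀ n, AEStronglyMeasurable (f n) μ) (hl : ∀ᵐ x ∂μ, Tendsto (fun n => f n x) atTop (𝓝 (g x)))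
    (hb : ∀ᶠ n in atTop, ∫⁻ x, ‖f n x‖ₑ ∂μ ≤ C) : Integrable g μ := by
  refine ⟨aestronglyMeasurable_of_tendsto_ae atTop hm hl, ?_⟩
  refine lt_of_le_of_lt ?_ hC
  calc ∫⁻ x, ‖g x‖ₑ ∂μ = ∫⁻ x, liminf (fun n => ‖f n x‖ₑ) atTop ∂μ := by
        refine lintegral_congr_ae ?_
        filter_upwards [hl] with x hx
        exact (hx.enorm.liminf_eq).symm
    _ ≤ liminf (fun n => ∫⁻ x, ‖f n x‖ₑ ∂μ) atTop := lintegral_liminf_le' fun n => (hm n).enorm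
    _ ≤ C := by
        refine (liminf_le_liminf hb).trans ?_
        simp

section cont
variable {a : ℤ} {u : E2 → ℝ} {Ω : Set E2} {r ε s : ℝ}

lemma Ph.cont_N (h : Ph a u Ω r) (hε : 0 < ε) {Γ : ℝ → ℝ} (hΓ : Continuous Γ)
    (hz : ∀ t ≤ ε, Γ t = 0) {φ : E2 → ℝ} (hφ : ContinuousOn φ (Ω ∩ {x : E2 | 0 < x 0} ∩ {x : E2 | 0 < u x})) :
    ContinuousOn (fun x => (x 0) ^ a * (Γ (u x) * φ x)) (Ω ∩ {x : E2 | 0 < x 0}) := by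
  intro x hx
  apply ContinuousAt.continuousWithinAt
  have hc : ContinuousAt u x := h.cont.continuousAt (h.isOpenN.mem_nhds hx)
  have hw : ContinuousAt (fun x : E2 => (x 0) ^ a) x :=
    ContinuousAt.zpow₀ (by fun_prop) a (Or.inl (ne_of_gt hx.2))
  refine hw.mul ?_
  by_cases hu : 0 < u x
  · exact (hΓ.continuousAt.comp hc).mul (hφ.continuousAt (h.isOpenP.mem_nhds ⟨hx, hu⟩))
  · refine (continuousAt_const (y := (0:ℝ))).congr ?_
    filter_upwards [hc.eventually (gt_mem_nhds (show u x < ε by linarith))] with y hy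
    rw [hz _ (le_of_lt hy), zero_mul]

lemma Ph.cont_ball (h : Ph a u Ω r) (hε : 0 < ε) (hs : 0 < s) {l Γ : ℝ → ℝ} (hl : Continuous l) (hlz : ∀ t < s, l t = 0) (hΓ : Continuous Γ)
    (hz : ∀ t ≤ ε, Γ t = 0) {φ : E2 → ℝ} (hφ : ContinuousOn φ (Ω ∩ {x : E2 | 0 < x 0} ∩ {x : E2 | 0 < u x})) :
    ContinuousOn (fun x => l (x 0) * ((x 0) ^ a * (Γ (u x) * φ x))) (closedBall 0 r) := by
  intro x hx
  apply ContinuousAt.continuousWithinAt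
  by_cases h0 : x 0 < s
  · refine (continuousAt_const (y := (0:ℝ))).congr ?_
    have oZ : IsOpen {x : E2 | x 0 < s} := isOpen_lt (by fun_prop) continuous_const
    filter_upwards [oZ.mem_nhds h0] with y hy
    rw [hlz _ hy, zero_mul]
  · have hx0 : 0 < x 0 := lt_of_lt_of_le hs (not_lt.1 h0)
    have hN : x ∈ Ω ∩ {x : E2 | 0 < x 0} := ⟨h.ball ⟨hx, hx0.le⟩, hx0⟩
    exact (by fun_prop : ContinuousAt (fun x : E2 => l (x 0)) x).mul ((h.cont_N hε hΓ hz hφ).continuousAt (h.isOpenN.mem_nhds hN))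

lemma Ph.cdd (h : Ph a u Ω r) (i : Fin 2) : ContinuousOn (dd i u) (Ω ∩ {x : E2 | 0 < x 0} ∩ {x : E2 | 0 < u x}) :=
  (dd_contDiffOn (n := 1) h.isOpenP h.c2 i).continuousOn
end cont

lemma vol_strip {r s : ℝ} (hs : 0 < s) (hr : 0 < r) : volume.real (Metric.ball (0:E2) r ∩ {x : E2 | s ≤ x 0 ∧ x 0 ≤ 2 * s}) ≤ s * (2 * r) := by
  have hsub : (fun p : ℝ × ℝ => pt p.1 p.2) ⁻¹' (Metric.ball (0:E2) r ∩ {x : E2 | s ≤ x 0 ∧ x 0 ≤ 2 * s}) ⊆ Icc s (2 * s) ×ˢ Icc (-r) r := by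
    rintro ⟨x, y⟩ ⟨h1, h2⟩
    simp only [mem_setOf_eq, pt_zero] at h2
    rw [mem_ball_zero_iff] at h1
    refine ⟨h2, ?_⟩
    have : |y| ≤ r := by
      refine le_trans ?_ h1.le
      rw [norm_pt, ← sqrt_sq_eq_abs]
      apply sqrt_le_sqrt
      nlinarith [sq_nonneg x]
    exact abs_le.1 this
  have := measure_mono (μ := volume) hsub
  rw [mp_pt.measure_preimage_emb me_pt, Measure.volume_eq_prod, Measure.prod_prod, Real.volume_Icc, Real.volume_Icc, ← ENNReal.ofReal_mul (by linarith)] at this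
  rw [Measure.real]
  refine (ENNReal.toReal_mono ENNReal.ofReal_ne_top this).trans_eq ?_
  rw [ENNReal.toReal_ofReal (by nlinarith)]
  ring

lemma Ph.err_tendsto {a : ℤ} {u : E2 → ℝ} {Ω : Set E2} {r : ℝ} (h : Ph a u Ω r) :
    Tendsto (fun n => ∫ x in Metric.ball (0 : E2) r, deriv (S0 (en n)) (x 0) * ((x 0) ^ a * (S1 (en n) (u x) * dd 0 u x))) atTop (𝓝 0) := by
  obtain ⟨C, hC, hCb⟩ := dS0_bound
  have hr := h.rpos
  rw [Metric.tendsto_atTop]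
  intro η hη
  obtain ⟨δ, hδ, hfl⟩ := h.flux_unif (η := η / (4 * r * C)) (by positivity)
  obtain ⟨n0, hn0⟩ := (Metric.tendsto_atTop.1 en_tendsto) (δ / 2) (by positivity)
  refine ⟨n0, fun n hn => ?_⟩
  have hs := en_pos n
  have hsd : 2 * en n < δ := by
    have := hn0 n hn
    rw [Real.dist_eq, sub_zero, abs_of_pos hs] at this
    linarith
  set s := en n
  set W := Metric.ball (0:E2) r ∩ {x : E2 | s ≤ x 0 ∧ x 0 ≤ 2 * s} with hW
  have e : ∫ x in Metric.ball (0 : E2) r, deriv (S0 s) (x 0) * ((x 0) ^ a * (S1 s (u x) * dd 0 u x))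
      = ∫ x in W, deriv (S0 s) (x 0) * ((x 0) ^ a * (S1 s (u x) * dd 0 u x)) := by
    refine (setIntegral_eq_of_subset_of_forall_diff_eq_zero isOpen_ball.measurableSet inter_subset_left ?_)
    intro x hx
    have : x 0 < s ∨ 2 * s < x 0 := by
      by_contra hcon
      push Not at hcon
      exact hx.2 ⟨hx.1, hcon⟩
    rw [dS0_zero hs this, zero_mul]
  rw [dist_zero_right, e]
  have hb := norm_setIntegral_le_of_norm_le_const (μ := volume) (s := W) (C := C / s * (η / (4 * r * C)))
    (f := fun x : E2 => deriv (S0 s) (x 0) * ((x 0) ^ a * (S1 s (u x) * dd 0 u x)))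
    (lt_of_le_of_lt (measure_mono inter_subset_left) measure_ball_lt_top) ?_
  · refine lt_of_le_of_lt hb ?_
    calc C / s * (η / (4 * r * C)) * volume.real W ≤ C / s * (η / (4 * r * C)) * (s * (2 * r)) := by
          gcongr
          exact vol_strip hs hr
      _ = η / 2 := by field_simp; ring
      _ < η := by linarith
  · intro x hx
    rw [norm_mul, Real.norm_eq_abs, Real.norm_eq_abs]
    refine mul_le_mul (hCb s hs _) ?_ (abs_nonneg _) (by positivity)
    by_cases hu : 0 < u x
    · have hx0 : 0 < x 0 := lt_of_lt_of_le hs hx.2.1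
      have hy : |x 1| ≤ r := by
        have := mem_ball_zero_iff.1 hx.1
        exact (PiLp.norm_apply_le x 1).trans this.le
      have := (hfl (x 0) (x 1) hx0 (lt_of_le_of_lt hx.2.2 hsd) hy).2
      rw [pt_eta] at this
      refine le_trans ?_ (this hu)
      rw [abs_mul, abs_mul (x 0 ^ a), abs_mul, abs_mul (u x)]
      refine mul_le_mul_of_nonneg_left (mul_le_mul_of_nonneg_right ?_ (abs_nonneg _)) (abs_nonneg _)
      rw [abs_of_nonneg (S1_nonneg hs _), abs_of_pos hu]
      exact (S1_le hs _).trans_eq (max_eq_left hu.le)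
    · rw [S1_zero hs (by linarith)]
      simp; positivity

/-- the energy density -/
noncomputable def gE (a : ℤ) (u : E2 → ℝ) (x : E2) : ℝ := (x 0) ^ a * ((dd 0 u x) ^ 2 + (dd 1 u x) ^ 2)
/-- the flux density on the arc -/
noncomputable def gF (a : ℤ) (u : E2 → ℝ) (x : E2) : ℝ := (x 0) ^ a * (u x * (x 0 * dd 0 u x + x 1 * dd 1 u x))

lemma S0_abs_mul_le {s t b : ℝ} : |S0 s t * b| ≤ |b| := by
  rw [abs_mul, abs_of_nonneg (S0_nonneg _ _)]
  exact mul_le_of_le_one_left (abs_nonneg _) (S0_le_one _ _)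

lemma Ph.main {a : ℤ} {u : E2 → ℝ} {Ω : Set E2} {r : ℝ} (h : Ph a u Ω r)
    (hF : IntegrableOn (gE a u) (Metric.ball (0:E2) r ∩ {x : E2 | 0 < x 0} ∩ {x : E2 | 0 < u x}) →
      IntegrableOn (fun θ => {x : E2 | 0 < u x}.indicator (gF a u) (gam r θ)) (Ioo (-(π/2)) (π/2))) :
    ∫ x in Metric.ball (0:E2) r ∩ {x : E2 | 0 < x 0} ∩ {x : E2 | 0 < u x}, gE a u x =
      ∫ θ in Ioo (-(π/2)) (π/2), {x : E2 | 0 < u x}.indicator (gF a u) (gam r θ) := by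
  have hr := h.rpos
  set A := Metric.ball (0:E2) r ∩ {x : E2 | 0 < x 0} ∩ {x : E2 | 0 < u x} with hA
  have hAo : IsOpen A := by
    have : A = Metric.ball (0:E2) r ∩ (Ω ∩ {x : E2 | 0 < x 0} ∩ {x : E2 | 0 < u x}) := by
      ext x
      constructor
      · rintro ⟨⟨h1, h2⟩, h3⟩
        exact ⟨h1, ⟨h.ball ⟨ball_subset_closedBall h1, (show 0 < x 0 from h2).le⟩, h2⟩, h3⟩
      · rintro ⟨h1, ⟨h0, h2⟩, h3⟩
        exact ⟨⟨h1, h2⟩, h3⟩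
    rw [this]
    exact isOpen_ball.inter h.isOpenP
  set f : ℕ → E2 → ℝ := fun n x => S0 (en n) (x 0) * ((x 0) ^ a * (S0 (en n) (u x) * ((dd 0 u x) ^ 2 + (dd 1 u x) ^ 2))) with hf
  set k : ℕ → E2 → ℝ := fun n x => S0 (en n) (x 0) * ((x 0) ^ a * (S1 (en n) (u x) * (x 0 * dd 0 u x + x 1 * dd 1 u x))) with hk
  have cf : ∀ n, ContinuousOn (f n) (closedBall 0 r) := fun n =>
    h.cont_ball (en_pos n) (en_pos n) (S0_cont _) (fun t ht => S0_zero (en_pos n) ht.le) (S0_cont _) (fun t ht => S0_zero (en_pos n) ht)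
      (((h.cdd 0).pow 2).add ((h.cdd 1).pow 2))
  have ck : ∀ n, ContinuousOn (k n) (closedBall 0 r) := fun n =>
    h.cont_ball (en_pos n) (en_pos n) (S0_cont _) (fun t ht => S0_zero (en_pos n) ht.le) (S1_cont _) (fun t ht => S1_zero (en_pos n) ht)
      (((by fun_prop : Continuous (fun x : E2 => x 0)).continuousOn.mul (h.cdd 0)).add ((by fun_prop : Continuous (fun x : E2 => x 1)).continuousOn.mul (h.cdd 1)))
  have ce : ∀ n, ContinuousOn (fun x : E2 => deriv (S0 (en n)) (x 0) * ((x 0) ^ a * (S1 (en n) (u x) * dd 0 u x))) (closedBall 0 r) := fun n =>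
    h.cont_ball (en_pos n) (en_pos n) ((S0_contDiff _).continuous_deriv (by norm_num)) (fun t ht => dS0_zero (en_pos n) (Or.inl ht)) (S1_cont _) (fun t ht => S1_zero (en_pos n) ht)
      (h.cdd 0)
  have fi : ∀ n, IntegrableOn (f n) (Metric.ball 0 r) := fun n =>
    ((cf n).integrableOn_compact (isCompact_closedBall _ _)).mono_set ball_subset_closedBall
  have ei := fun n : ℕ => ContinuousOn.integrableOn_compact (μ := volume) (isCompact_closedBall (0:E2) r) (ce n) |>.mono_set ball_subset_closedBall
  set I := Ioo (-(π/2)) (π/2) with hI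
  have hsub : I ⊆ Ioc (-π) π := fun θ hθ => ⟨by linarith [hθ.1, pi_pos], by linarith [hθ.2, pi_pos]⟩
  have id : ∀ n, (∫ x in Metric.ball (0 : E2) r, deriv (S0 (en n)) (x 0) * ((x 0) ^ a * (S1 (en n) (u x) * dd 0 u x)))
      + ∫ x in Metric.ball (0:E2) r, f n x = ∫ θ in I, k n (gam r θ) := by
    intro n
    rw [← integral_add (ei n) (fi n), h.identity (en_pos n) (en_pos n), intervalIntegral.integral_of_le (by linarith [pi_pos])]
    have e : ∀ θ, S0 (en n) (r * cos θ) * ((r * cos θ) ^ a * (S1 (en n) (u (gam r θ)) *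
        (r * cos θ * dd 0 u (gam r θ) + r * sin θ * dd 1 u (gam r θ)))) = k n (gam r θ) := by
      intro θ; simp [hk, gam]
    simp only [e]
    refine setIntegral_eq_of_subset_of_forall_diff_eq_zero measurableSet_Ioc hsub ?_
    intro θ hθ
    have : cos θ ≤ 0 := by
      by_contra hc
      push Not at hc
      apply hθ.2
      constructor
      · by_contra h1
        push Not at h1
        have := cos_nonpos_of_pi_div_two_le_of_le (x := -θ) (by linarith) (by linarith [hθ.1.1, pi_pos])
        rw [cos_neg] at this; linarith
      · by_contra h1
        push Not at h1
        have := cos_nonpos_of_pi_div_two_le_of_le h1 (by linarith [hθ.1.2, pi_pos])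
        linarith
    simp only [hk]
    rw [S0_zero (en_pos n), zero_mul]
    have e0 : (gam r θ) 0 = r * cos θ := by simp [gam]
    rw [e0]
    have := en_pos n
    nlinarith
  -- pointwise facts
  have lf : ∀ x ∈ Metric.ball (0:E2) r, Tendsto (fun n => f n x) atTop (𝓝 (A.indicator (gE a u) x)) := by
    intro x hxb
    by_cases hx : x ∈ A
    · rw [indicator_of_mem hx]
      have := (S0_tendsto hx.1.2).mul (((S0_tendsto hx.2).mul_const ((dd 0 u x) ^ 2 + (dd 1 u x) ^ 2)).const_mul ((x 0) ^ a))
      simpa [gE, hf] using this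
    · rw [indicator_of_notMem hx]
      refine tendsto_const_nhds.congr fun n => ?_
      simp only [hf]
      by_cases h0 : 0 < x 0
      · have : ¬ 0 < u x := fun hu => hx ⟨⟨hxb, h0⟩, hu⟩
        rw [S0_zero (en_pos n) (show u x ≤ en n by linarith [en_pos n])]; ring
      · rw [S0_zero (en_pos n) (show x 0 ≤ en n by linarith [en_pos n])]; ring
  have bf : ∀ n, ∀ x ∈ Metric.ball (0:E2) r, ‖f n x‖ ≤ ‖A.indicator (gE a u) x‖ := by
    intro n x hxb
    by_cases hx : x ∈ A
    · rw [indicator_of_mem hx, Real.norm_eq_abs, Real.norm_eq_abs]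
      refine S0_abs_mul_le.trans ?_
      rw [gE, abs_mul, abs_mul (x 0 ^ a)]
      exact mul_le_mul_of_nonneg_left S0_abs_mul_le (abs_nonneg _)
    · have : f n x = 0 := by
        simp only [hf]
        by_cases h0 : 0 < x 0
        · have : ¬ 0 < u x := fun hu => hx ⟨⟨hxb, h0⟩, hu⟩
          rw [S0_zero (en_pos n) (show u x ≤ en n by linarith [en_pos n])]; ring
        · rw [S0_zero (en_pos n) (show x 0 ≤ en n by linarith [en_pos n])]; ring
      rw [this, norm_zero]; exact norm_nonneg _
  have hcos : ∀ θ ∈ I, 0 < (gam r θ) 0 := fun θ hθ => by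
    have := cos_pos_of_mem_Ioo hθ
    simp only [gam, pt_zero]; positivity
  have lk : ∀ θ ∈ I, Tendsto (fun n => k n (gam r θ)) atTop (𝓝 ({x : E2 | 0 < u x}.indicator (gF a u) (gam r θ))) := by
    intro θ hθ
    have h0 := hcos θ hθ
    set x := gam r θ
    have := (S0_tendsto h0).mul (((S1_tendsto (u x)).mul_const (x 0 * dd 0 u x + x 1 * dd 1 u x)).const_mul ((x 0) ^ a))
    convert this using 2
    by_cases hu : 0 < u x
    · rw [indicator_of_mem (show x ∈ {x : E2 | 0 < u x} from hu), max_eq_left hu.le, gF]; ring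
    · rw [indicator_of_notMem (show x ∉ {x : E2 | 0 < u x} from hu), max_eq_right (not_lt.1 hu)]; ring
  have bk : ∀ n, ∀ θ ∈ I, ‖k n (gam r θ)‖ ≤ ‖{x : E2 | 0 < u x}.indicator (gF a u) (gam r θ)‖ := by
    intro n θ hθ
    set x := gam r θ
    rw [Real.norm_eq_abs, Real.norm_eq_abs]
    by_cases hu : 0 < u x
    · rw [indicator_of_mem (show x ∈ {x : E2 | 0 < u x} from hu)]
      refine S0_abs_mul_le.trans ?_
      rw [gF, abs_mul, abs_mul (x 0 ^ a), abs_mul, abs_mul (u x)]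
      refine mul_le_mul_of_nonneg_left (mul_le_mul_of_nonneg_right ?_ (abs_nonneg _)) (abs_nonneg _)
      rw [abs_of_nonneg (S1_nonneg (en_pos n) _), abs_of_pos hu]
      exact (S1_le (en_pos n) _).trans_eq (max_eq_left hu.le)
    · simp only [hk]
      rw [S1_zero (en_pos n) (show u x ≤ en n by linarith [en_pos n])]
      simp
  have mk : ∀ n, AEStronglyMeasurable (fun θ => k n (gam r θ)) (volume.restrict I) := by
    intro n
    have : Continuous fun θ => k n (gam r θ) := by
      rw [← continuousOn_univ]
      refine (ck n).comp (continuous_gam r).continuousOn fun θ _ => ?_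
      rw [mem_closedBall_zero_iff, gam_norm hr.le]
    exact this.aestronglyMeasurable
  have iA : ∀ w : E2 → ℝ, ∫ x in A, w x = ∫ x in Metric.ball (0:E2) r, A.indicator w x := by
    intro w
    rw [setIntegral_indicator hAo.measurableSet, inter_eq_right.2 (fun x hx => hx.1.1)]
  have iA' : IntegrableOn (A.indicator (gE a u)) (Metric.ball 0 r) ↔ IntegrableOn (gE a u) A := by
    rw [integrableOn_indicator_iff hAo.measurableSet, inter_eq_left.2 (fun x hx => hx.1.1)]
  by_cases hFi : IntegrableOn (fun θ => {x : E2 | 0 < u x}.indicator (gF a u) (gam r θ)) I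
  · have tk : Tendsto (fun n => ∫ θ in I, k n (gam r θ)) atTop (𝓝 (∫ θ in I, {x : E2 | 0 < u x}.indicator (gF a u) (gam r θ))) := by
      refine tendsto_integral_of_dominated_convergence _ mk hFi.norm (fun n => ?_) ?_
      · exact (ae_restrict_iff' measurableSet_Ioo).2 (Eventually.of_forall (bk n))
      · exact (ae_restrict_iff' measurableSet_Ioo).2 (Eventually.of_forall lk)
    have tf : Tendsto (fun n => ∫ x in Metric.ball (0:E2) r, f n x) atTop (𝓝 (∫ θ in I, {x : E2 | 0 < u x}.indicator (gF a u) (gam r θ))) := by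
      have := tk.sub h.err_tendsto
      rw [sub_zero] at this
      refine this.congr fun n => ?_
      rw [← id n]; ring
    have hE : IntegrableOn (A.indicator (gE a u)) (Metric.ball 0 r) := by
      obtain ⟨C, hC⟩ : ∃ C : ℝ, ∀ᶠ n in atTop, ∫ x in Metric.ball (0:E2) r, f n x ≤ C :=
        ⟨_, tf.eventually (ge_mem_nhds (lt_add_one _))⟩
      refine integrable_of_fatou (C := ENNReal.ofReal C) ENNReal.ofReal_lt_top (fun n => (fi n).aestronglyMeasurable)
        ((ae_restrict_iff' isOpen_ball.measurableSet).2 (Eventually.of_forall lf)) ?_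
      filter_upwards [hC] with n hn
      have hfn : ∀ x, 0 ≤ f n x := by
        intro x
        simp only [hf]
        by_cases h0 : 0 < x 0
        · have := S0_nonneg (en n) (x 0)
          have := S0_nonneg (en n) (u x)
          positivity
        · rw [S0_zero (en_pos n) (show x 0 ≤ en n by linarith [en_pos n])]; simp
      have : ∀ x, ‖f n x‖ₑ = ENNReal.ofReal (f n x) := fun x => Real.enorm_of_nonneg (hfn x)
      simp only [this]
      rw [← ofReal_integral_eq_lintegral_ofReal (fi n) (Eventually.of_forall hfn)]
      exact ENNReal.ofReal_le_ofReal hn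
    rw [iA]
    refine tendsto_nhds_unique ?_ tf
    refine tendsto_integral_of_dominated_convergence _ (fun n => (fi n).aestronglyMeasurable) hE.norm (fun n => ?_) ?_
    · exact (ae_restrict_iff' isOpen_ball.measurableSet).2 (Eventually.of_forall (bf n))
    · exact (ae_restrict_iff' isOpen_ball.measurableSet).2 (Eventually.of_forall lf)
  · have hE : ¬ IntegrableOn (gE a u) A := fun hE => hFi (hF hE)
    rw [integral_undef hE, integral_undef hFi]


lemma PP_zero (r h : ℝ) : PP r 0 h = gam r h := by simp [PP, gam]

lemma PP_eq_gam (r t h : ℝ) : PP r t h = gam (r * exp t) h := rfl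

lemma Ph.PP_mem {a : ℤ} {u : E2 → ℝ} {Ω : Set E2} {R r T : ℝ} (h : Ph a u Ω R) (hr : 0 < r) (hT : r * exp T ≤ R) {t θ : ℝ}
    (ht : (t, θ) ∈ dom T) : PP r t θ ∈ Ω ∩ {x : E2 | 0 < x 0} := by
  have hc := cos_pos_dom ht
  have h0 : 0 < (PP r t θ) 0 := by simp only [PP, pt_zero]; positivity
  refine ⟨h.ball ⟨?_, h0.le⟩, h0⟩
  rw [mem_closedBall_zero_iff, PP_eq_gam, gam_norm (by positivity)]
  refine le_trans ?_ hT
  have : exp t ≤ exp T := exp_le_exp.2 ht.1.2.le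
  gcongr

lemma Ph.F_integrable {a : ℤ} {u : E2 → ℝ} {Ω : Set E2} {R r T κ M : ℝ} (h : Ph a u Ω R) (hr : 0 < r) (hT : r * exp T ≤ R)
    (hκ0 : 0 < κ) (hκ1 : κ ≤ 1) (hκT : κ < T) (hM : 0 ≤ M) (k : ℕ → ℝ)
    (hB : ∀ n t θ, (t, θ) ∈ dom T → |t| ≤ κ * cos θ → (cos θ) ^ a * |S2 (en n) (u (PP r t θ)) - k n| ≤ M * √(cos θ)) :
    IntegrableOn (fun θ => {x : E2 | 0 < u x}.indicator (gF a u) (gam r θ)) (Ioo (-(π/2)) (π/2)) := by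
  set I := Ioo (-(π/2)) (π/2) with hI
  have hT0 : 0 < T := hκ0.trans hκT
  have d0 : ∀ θ ∈ I, ((0:ℝ), θ) ∈ dom T := fun θ hθ => ⟨⟨by simpa using hT0, hT0⟩, hθ⟩
  have hcos : ∀ θ ∈ I, 0 < cos θ := fun θ hθ => cos_pos_of_mem_Ioo hθ
  have ha2 : |(a:ℝ)| ≤ 1 := by rcases h.ha with e | e <;> simp [e]
  set q : ℕ → ℝ → ℝ := fun n θ => ph0 (qq κ (en (n + 1)) 0 θ) with hq
  have hen : ∀ n, en (n + 1) < 1 := by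
    intro n; unfold en; rw [div_lt_one (by positivity)]; push_cast; linarith [(Nat.cast_nonneg n : (0:ℝ) ≤ n)]
  have q0 : ∀ n θ, 0 ≤ q n θ := fun n θ => ph0_nonneg _
  have q1 : ∀ n θ, q n θ ≤ 1 := by
    intro n θ
    simp only [hq, ph0]
    apply pow_le_one₀ (le_max_right _ _)
    refine max_le ?_ zero_le_one
    have : 0 ≤ sc θ := by unfold sc; positivity
    unfold qq
    have : 0 ≤ (κ ^ 2 * en (n + 1) ^ 2 + 0 ^ 2) * sc θ := by positivity
    nlinarith
  have ql : ∀ θ, Tendsto (fun n => q n θ) atTop (𝓝 (κ ^ 6)) := by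
    intro θ
    have e1 : Tendsto (fun n => en (n + 1)) atTop (𝓝 0) := en_tendsto.comp (tendsto_add_atTop_nat 1)
    have e2 : Tendsto (fun n => qq κ (en (n + 1)) 0 θ) atTop (𝓝 (κ ^ 2)) := by
      have := ((((e1.pow 2).const_mul (κ ^ 2)).add_const ((0:ℝ) ^ 2)).mul_const (sc θ)).const_sub (κ ^ 2)
      simpa [qq] using this
    have e3 := (e2.max (tendsto_const_nhds (x := (0:ℝ)))).pow 3
    rw [max_eq_left (by positivity)] at e3
    have : (κ ^ 2) ^ 3 = κ ^ 6 := by ring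
    rw [this] at e3
    exact e3
  set P : ℕ → ℝ → ℝ := fun n θ => S1 (en n) (u (gam r θ)) * (r * cos θ * dd 0 u (gam r θ) + r * sin θ * dd 1 u (gam r θ)) with hP
  set f : ℕ → ℝ → ℝ := fun n θ => q n θ * ((cos θ) ^ a * P n θ) with hf
  have hgN : ∀ θ ∈ I, gam r θ ∈ Ω ∩ {x : E2 | 0 < x 0} := fun θ hθ => by
    rw [← PP_zero]; exact h.PP_mem hr hT (d0 θ hθ)
  have ra : r ^ a ≠ 0 := zpow_ne_zero _ hr.ne'
  have fl : ∀ θ ∈ I, Tendsto (fun n => f n θ) atTop (𝓝 (κ ^ 6 * (r ^ a)⁻¹ * {x : E2 | 0 < u x}.indicator (gF a u) (gam r θ))) := by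
    intro θ hθ
    have := (ql θ).mul (((S1_tendsto (u (gam r θ))).mul_const (r * cos θ * dd 0 u (gam r θ) + r * sin θ * dd 1 u (gam r θ))).const_mul ((cos θ) ^ a))
    convert this using 2
    by_cases hu : 0 < u (gam r θ)
    · rw [indicator_of_mem (show gam r θ ∈ {x : E2 | 0 < u x} from hu), max_eq_left hu.le, gF]
      have e0 : gam r θ 0 = r * cos θ := by simp [gam]
      have e1 : gam r θ 1 = r * sin θ := by simp [gam]
      rw [e0, e1, mul_zpow]
      field_simp
    · rw [indicator_of_notMem (show gam r θ ∉ {x : E2 | 0 < u x} from hu), max_eq_right (not_lt.1 hu)]; ring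
  -- measurability
  have fm : ∀ n, AEStronglyMeasurable (f n) (volume.restrict I) := by
    intro n
    refine ContinuousOn.aestronglyMeasurable ?_ measurableSet_Ioo
    have c1 : ContinuousOn (q n) I := by
      have : ContinuousOn (fun θ => qq κ (en (n + 1)) 0 θ) I := by
        unfold qq sc
        refine continuousOn_const.sub (continuousOn_const.mul ?_)
        exact ContinuousOn.inv₀ (by fun_prop) fun θ hθ => pow_ne_zero _ (hcos θ hθ).ne'
      have hc3 : Continuous ph0 := by unfold ph0; fun_prop
      exact hc3.comp_continuousOn this
    have c2 := (h.cont_N (en_pos n) (S1_cont (en n)) (fun t ht => S1_zero (en_pos n) ht)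
      (((by fun_prop : Continuous (fun x : E2 => x 0)).continuousOn.mul (h.cdd 0)).add ((by fun_prop : Continuous (fun x : E2 => x 1)).continuousOn.mul (h.cdd 1)))).comp
      (continuous_gam r).continuousOn hgN
    refine (c1.mul (continuousOn_const (c := (r ^ a)⁻¹) |>.mul c2)).congr fun θ hθ => ?_
    have e0 : gam r θ 0 = r * cos θ := by simp [gam]
    have e1 : gam r θ 1 = r * sin θ := by simp [gam]
    simp only [hf, hP, Pi.mul_apply, Pi.add_apply, Function.comp, e0, e1, mul_zpow]
    field_simp
  -- bound
  have fb : ∀ n, ∫⁻ θ in I, ‖f n θ‖ₑ ≤ ENNReal.ofReal (401 * (2 * M) * ∫ h in I, 1 / √(cos h)) + ENNReal.ofReal M * volume I := by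
    intro n
    obtain ⟨ztt, zh, zhh, HD, hsub⟩ := D2_polar (T := T) (k := k n) (r := r) h.ha hr h.isOpenN (h.contDiff_comp (cut_S2 (en_pos n)))
      (fun t θ ht => h.PP_mem hr hT ht) (by
        intro x hx
        rw [h.eq_comp (cut_S2 (en_pos n)) hx]
        have h1 : 0 < x 0 := hx.2
        have := S0_nonneg (en n) (u x)
        positivity)
    have K := kato_lintegral (M := 2 * M) (m := fun θ => (cos θ) ^ a) (δ := en (n + 1)) hκ0 hκ1 hκT ha2 ?_ (fun θ hθ => zpow_pos (hcos θ hθ) a) HD hsub ?_ (by positivity)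
      (en_pos _) (hen n)
    rotate_left
    · intro θ hθ
      have hc := hcos θ hθ
      refine ((hasDerivAt_zpow a (cos θ) (Or.inl hc.ne')).comp θ (hasDerivAt_cos θ)).congr_deriv ?_
      rw [tan_eq_sin_div_cos, zpow_sub_one₀ hc.ne']
      field_simp
    · intro t θ ht htk
      have hb := hB n t θ ht htk
      have hc := cos_pos_dom ht
      rw [abs_mul, abs_of_pos (exp_pos _)]
      have he : exp (a * t / 2) ≤ 2 := by
        have : a * t / 2 ≤ (1:ℝ) / 2 := by
          have h1 : (a:ℝ) * t ≤ |(a:ℝ)| * |t| := by rw [← abs_mul]; exact le_abs_self _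
          have h2 : |t| ≤ 1 := htk.trans (by nlinarith [cos_le_one θ])
          nlinarith [abs_nonneg t, abs_nonneg (a:ℝ)]
        have h3 : exp (a * t / 2) ^ 2 ≤ 4 := by
          rw [← exp_nat_mul]
          refine (exp_le_exp.2 (show ((2:ℕ):ℝ) * (a * t / 2) ≤ 1 by push_cast; linarith)).trans ?_
          have := exp_one_lt_d9; linarith
        nlinarith [exp_pos (a * t / 2)]
      have hp : 0 ≤ (cos θ) ^ a * |S2 (en n) (u (PP r t θ)) - k n| := by positivity
      calc (cos θ) ^ a * (exp (a * t / 2) * |S2 (en n) (u (PP r t θ)) - k n|)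
          = exp (a * t / 2) * ((cos θ) ^ a * |S2 (en n) (u (PP r t θ)) - k n|) := by ring
        _ ≤ 2 * (M * √(cos θ)) := mul_le_mul he hb hp (by norm_num)
        _ = _ := by ring
    refine le_trans ?_ (add_le_add K le_rfl)
    rw [← setLIntegral_const, ← lintegral_add_right _ measurable_const]
    refine setLIntegral_mono' measurableSet_Ioo fun θ hθ => ?_
    have hc := hcos θ hθ
    have hm := zpow_pos hc a
    have hb := hB n 0 θ (d0 θ hθ) (by rw [abs_zero]; positivity)
    rw [← ofReal_norm_eq_enorm]
    rw [← ENNReal.ofReal_add (by have := q0 n θ; positivity) hM]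
    apply ENNReal.ofReal_le_ofReal
    have hgm := hgN θ hθ
    rw [← PP_zero] at hgm
    have D0 := h.dd_comp (cut_S2 (en_pos n)) hgm 0
    have D1 := h.dd_comp (cut_S2 (en_pos n)) hgm 1
    simp only [D0, D1]
    rw [PP_zero] at hb ⊢
    simp only [mul_zero, zero_div, exp_zero, mul_one, one_mul]
    set v := S2 (en n) (u (gam r θ)) - k n
    have eP : r * cos θ * (S1 (en n) (u (gam r θ)) * dd 0 u (gam r θ)) + r * sin θ * (S1 (en n) (u (gam r θ)) * dd 1 u (gam r θ)) = P n θ := by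
      simp only [hP]; ring
    rw [eP]
    simp only [hf]
    rw [norm_mul, norm_mul, Real.norm_eq_abs, Real.norm_eq_abs, Real.norm_eq_abs, abs_of_nonneg (q0 n θ), abs_of_pos hm]
    change q n θ * (cos θ ^ a * |P n θ|) ≤ cos θ ^ a * (q n θ * |2 * (P n θ + a / 2 * v)|) + M
    have t1 : |P n θ| ≤ |2 * (P n θ + a / 2 * v)| + |v| := by
      have i1 : |P n θ| ≤ |P n θ + a / 2 * v| + |a / 2 * v| := by
        have := abs_sub (P n θ + a / 2 * v) (a / 2 * v)
        simpa using this
      have i2 : |(a:ℝ) / 2 * v| ≤ |v| := by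
        rw [abs_mul, abs_div]
        have : |(a:ℝ)| / |2| ≤ 1 := by rw [abs_two]; linarith
        exact mul_le_of_le_one_left (abs_nonneg _) this
      rw [abs_mul 2, abs_two]
      linarith [abs_nonneg (P n θ + a / 2 * v)]
    have t2 : cos θ ^ a * |v| ≤ M := hb.trans (mul_le_of_le_one_right hM (sqrt_le_one.2 (cos_le_one θ)))
    have hq0 := q0 n θ
    have hq1 := q1 n θ
    calc q n θ * (cos θ ^ a * |P n θ|) ≤ q n θ * (cos θ ^ a * (|2 * (P n θ + a / 2 * v)| + |v|)) := by gcongr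
      _ = cos θ ^ a * (q n θ * |2 * (P n θ + a / 2 * v)|) + q n θ * (cos θ ^ a * |v|) := by ring
      _ ≤ cos θ ^ a * (q n θ * |2 * (P n θ + a / 2 * v)|) + M := by
        have : q n θ * (cos θ ^ a * |v|) ≤ 1 * M := mul_le_mul hq1 t2 (by positivity) zero_le_one
        linarith
  have hfin := integrable_of_fatou (μ := volume.restrict I) (C := ENNReal.ofReal (401 * (2 * M) * ∫ h in I, 1 / √(cos h)) + ENNReal.ofReal M * volume I)
    (by rw [hI, Real.volume_Ioo]; exact ENNReal.add_lt_top.2 ⟨ENNReal.ofReal_lt_top, ENNReal.mul_lt_top ENNReal.ofReal_lt_top ENNReal.ofReal_lt_top⟩) fm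
    ((ae_restrict_iff' measurableSet_Ioo).2 (Eventually.of_forall fl)) (Eventually.of_forall fb)
  have := hfin.const_mul ((κ ^ 6 * (r ^ a)⁻¹)⁻¹)
  refine this.congr (Eventually.of_forall fun θ => ?_)
  have : κ ^ 6 * (r ^ a)⁻¹ ≠ 0 := by positivity
  simp only
  rw [inv_mul_cancel_left₀ this]



lemma contRect {N : Set E2} {g : E2 → ℝ} (hg : ContinuousOn g N) {S : Set (ℝ × ℝ)} (hS : ∀ p ∈ S, pt p.1 p.2 ∈ N) :
    ContinuousOn (fun p : ℝ × ℝ => g (pt p.1 p.2)) S := hg.comp continuous_pt2.continuousOn hS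

/-- Weighted subsolution inequality on a rectangle. -/
lemma convex3_aux {N : Set E2} (hN : IsOpen N) {v : E2 → ℝ} (hv : ContDiffOn ℝ 2 v N)
    (hsub : ∀ x ∈ N, 0 ≤ x 0 * (dd 0 (dd 0 v) x + dd 1 (dd 1 v) x) - dd 0 v x)
    {x1 x2 c d : ℝ} (h1 : 0 < x1) (h12 : x1 ≤ x2) (hcd : c ≤ d)
    (hm : ∀ x y, x ∈ Icc x1 x2 → y ∈ Icc c d → pt x y ∈ N) {l : ℝ → ℝ} (hl : Continuous l)
    (hl0 : ∀ y ∈ Icc c d, 0 ≤ l y) :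
    (∫ x in x1..x2, -((∫ y in c..d, l y * dd 1 (dd 1 v) (pt x y)) / x)) ≤
      ∫ y in c..d, l y * (dd 0 v (pt x2 y) / x2 - dd 0 v (pt x1 y) / x1) := by
  set S := Icc x1 x2 ×ˢ Icc c d with hS
  have hSN : ∀ p ∈ S, pt p.1 p.2 ∈ N := fun p hp => hm _ _ hp.1 hp.2
  have c1 : ContDiffOn ℝ 1 (dd 0 v) N := dd_contDiffOn (n := 1) hN hv 0
  have c2 : ContDiffOn ℝ 1 (dd 1 v) N := dd_contDiffOn (n := 1) hN hv 1
  have c11 : ContinuousOn (dd 0 (dd 0 v)) N := (dd_contDiffOn (n := 0) hN c1 0).continuousOn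
  have c22 : ContinuousOn (dd 1 (dd 1 v)) N := (dd_contDiffOn (n := 0) hN c2 1).continuousOn
  have d1 : ∀ x ∈ N, DifferentiableAt ℝ (dd 0 v) x := fun x hx => (c1.contDiffAt (hN.mem_nhds hx)).differentiableAt (by norm_num)
  have hx0 : ∀ p ∈ S, p.1 ≠ 0 := fun p hp => by have := hp.1.1; linarith [h1] |> fun h => ne_of_gt h
  have hlS : ContinuousOn (fun p : ℝ × ℝ => l p.2) S := (hl.comp continuous_snd).continuousOn
  have hf1 : ContinuousOn (fun p : ℝ × ℝ => p.1) S := continuous_fst.continuousOn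
  set F : ℝ → ℝ → ℝ := fun x y => l y * ((dd 0 (dd 0 v) (pt x y) * x - dd 0 v (pt x y)) / x ^ 2) with hF
  set G : ℝ → ℝ → ℝ := fun x y => l y * dd 1 (dd 1 v) (pt x y) with hG
  have cF : ContinuousOn (fun p : ℝ × ℝ => F p.1 p.2) S :=
    hlS.mul ((((contRect c11 hSN).mul hf1).sub (contRect c1.continuousOn hSN)).div (hf1.pow 2) (fun p hp => pow_ne_zero 2 (hx0 p hp)))
  have cG : ContinuousOn (fun p : ℝ × ℝ => G p.1 p.2) S := hlS.mul (contRect c22 hSN)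
  have cGx : ContinuousOn (fun p : ℝ × ℝ => -(G p.1 p.2 / p.1)) S := (cG.div hf1 hx0).neg
  have swap := rect_swap h12 hcd cF
  have inner : ∀ y ∈ Icc c d, ∫ x in x1..x2, F x y = l y * (dd 0 v (pt x2 y) / x2 - dd 0 v (pt x1 y) / x1) := by
    intro y hy
    have : ∀ x ∈ uIcc x1 x2, HasDerivAt (fun x => l y * (dd 0 v (pt x y) / x)) (F x y) x := by
      intro x hx
      rw [uIcc_of_le h12] at hx
      have hxp : x ≠ 0 := by have := hx.1; intro h; linarith
      have e1 := chain_pt (X := fun s => s) (Y := fun _ => y) (d1 _ (hm x y hx hy)) (hasDerivAt_id x) (hasDerivAt_const x y)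
      have e2 := (e1.div (hasDerivAt_id x) hxp).const_mul (l y)
      refine e2.congr_deriv ?_
      simp only [hF, id]; ring
    rw [intervalIntegral.integral_eq_sub_of_hasDerivAt this]
    · ring
    · rw [intervalIntegrable_iff_integrableOn_Icc_of_le h12]
      exact (sliceT cF subset_rfl hy).integrableOn_Icc
  have e2 : ∫ y in c..d, ∫ x in x1..x2, F x y = ∫ y in c..d, l y * (dd 0 v (pt x2 y) / x2 - dd 0 v (pt x1 y) / x1) := by
    apply intervalIntegral.integral_congr
    intro y hy; rw [uIcc_of_le hcd] at hy; exact inner y hy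
  rw [← e2, ← swap]
  have sl : ∀ f : ℝ → ℝ → ℝ, ContinuousOn (fun p : ℝ × ℝ => f p.1 p.2) S → IntervalIntegrable (fun x => ∫ y in c..d, f x y) volume x1 x2 := by
    intro f hf
    refine rect_slice (f := fun y x => f x y) hcd h12 ?_
    exact hf.comp (f := fun p : ℝ × ℝ => (p.2, p.1)) (by fun_prop) (fun p hp => ⟨hp.2, hp.1⟩)
  have e3 : ∫ x in x1..x2, -((∫ y in c..d, G x y) / x) = ∫ x in x1..x2, ∫ y in c..d, -(G x y / x) := by
    apply intervalIntegral.integral_congr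
    intro x hx; simp only [intervalIntegral.integral_neg, intervalIntegral.integral_div]
  change (∫ x in x1..x2, -((∫ y in c..d, G x y) / x)) ≤ _
  rw [e3]
  refine intervalIntegral.integral_mono_on h12 (sl (fun x y => -(G x y / x)) cGx) (sl F cF) ?_
  intro x hx
  refine intervalIntegral.integral_mono_on hcd ?_ ?_ ?_
  · rw [intervalIntegrable_iff_integrableOn_Icc_of_le hcd]
    exact (sliceH (f := fun x y => -(G x y / x)) cGx subset_rfl hx).integrableOn_Icc
  · rw [intervalIntegrable_iff_integrableOn_Icc_of_le hcd]
    exact (sliceH cF subset_rfl hx).integrableOn_Icc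
  · intro y hy
    have hxp : 0 < x := lt_of_lt_of_le h1 hx.1
    have hs := hsub _ (hm x y hx hy)
    rw [pt_zero] at hs
    have : F x y - -(G x y / x) = l y * ((x * (dd 0 (dd 0 v) (pt x y) + dd 1 (dd 1 v) (pt x y)) - dd 0 v (pt x y)) / x ^ 2) := by
      simp only [hF, hG]; field_simp; ring
    have h3 : 0 ≤ l y * ((x * (dd 0 (dd 0 v) (pt x y) + dd 1 (dd 1 v) (pt x y)) - dd 0 v (pt x y)) / x ^ 2) :=
      mul_nonneg (hl0 y hy) (by positivity)
    linarith

lemma convex3 {N : Set E2} (hN : IsOpen N) {v : E2 → ℝ} (hv : ContDiffOn ℝ 2 v N)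
    (hsub : ∀ x ∈ N, 0 ≤ x 0 * (dd 0 (dd 0 v) x + dd 1 (dd 1 v) x) - dd 0 v x)
    {xs B R : ℝ} (hxs : 0 < xs) (hB : ∀ x y, 0 < x → x < xs → |y| ≤ R → pt x y ∈ N ∧ |dd 0 v (pt x y)| ≤ B * x)
    {φ : ℝ → ℝ} (hφ : ∀ y, |y| ≤ R → Tendsto (fun x => v (pt x y)) (𝓝[>] 0) (𝓝 (φ y)))
    {y0 y1 y2 : ℝ} (h0 : -R ≤ y0) (h01 : y0 < y1) (h12 : y1 < y2) (h2 : y2 ≤ R) :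
    φ y1 * (1 / (y1 - y0) + 1 / (y2 - y1)) ≤ φ y0 / (y1 - y0) + φ y2 / (y2 - y1) := by
  have hy : ∀ y ∈ Icc y0 y2, |y| ≤ R := fun y hy => abs_le.2 ⟨by linarith [hy.1], by linarith [hy.2]⟩
  have p1 : 0 < y1 - y0 := by linarith
  have p2 : 0 < y2 - y1 := by linarith
  set T : ℝ → ℝ := fun x => v (pt x y0) / (y1 - y0) + v (pt x y2) / (y2 - y1) - v (pt x y1) * (1 / (y1 - y0) + 1 / (y2 - y1)) with hT
  set T0 := φ y0 / (y1 - y0) + φ y2 / (y2 - y1) - φ y1 * (1 / (y1 - y0) + 1 / (y2 - y1)) with hT0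
  have hlim : Tendsto T (𝓝[>] 0) (𝓝 T0) :=
    (((hφ y0 (hy _ ⟨le_rfl, by linarith⟩)).div_const _).add ((hφ y2 (hy _ ⟨by linarith, le_rfl⟩)).div_const _)).sub
      ((hφ y1 (hy _ ⟨by linarith, by linarith⟩)).mul_const _)
  by_contra hcon
  have hneg : T0 < 0 := by rw [hT0]; push Not at hcon; linarith
  have ev : ∀ᶠ x in 𝓝[>] (0:ℝ), T x < T0 / 2 := hlim.eventually (gt_mem_nhds (by linarith))
  obtain ⟨x2', hx2', hTx⟩ := mem_nhdsGT_iff_exists_Ioo_subset.1 ev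
  have hx2'0 : 0 < x2' := hx2'
  set x2 := min x2' xs / 2 with hx2
  have x2pos : 0 < x2 := by positivity
  have x2l : x2 < x2' := by have := min_le_left x2' xs; rw [hx2]; linarith
  have x2s : x2 < xs := by have := min_le_right x2' xs; rw [hx2]; linarith
  have c1 : ContDiffOn ℝ 1 (dd 0 v) N := dd_contDiffOn (n := 1) hN hv 0
  have c2 : ContDiffOn ℝ 1 (dd 1 v) N := dd_contDiffOn (n := 1) hN hv 1
  have c22 : ContinuousOn (dd 1 (dd 1 v)) N := (dd_contDiffOn (n := 0) hN c2 1).continuousOn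
  have d0 : ∀ x ∈ N, DifferentiableAt ℝ v x := fun x hx => (hv.contDiffAt (hN.mem_nhds hx)).differentiableAt (by norm_num)
  have d2 : ∀ x ∈ N, DifferentiableAt ℝ (dd 1 v) x := fun x hx => (c2.contDiffAt (hN.mem_nhds hx)).differentiableAt (by norm_num)
  -- integration by parts on a vertical segment with an affine weight
  have ibp : ∀ x c d m q : ℝ, 0 < x → x < xs → y0 ≤ c → c ≤ d → d ≤ y2 →
      ∫ y in c..d, (m * y + q) * dd 1 (dd 1 v) (pt x y) =
        ((m * d + q) * dd 1 v (pt x d) - m * v (pt x d)) - ((m * c + q) * dd 1 v (pt x c) - m * v (pt x c)) := by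
    intro x c d m q hx0 hxs' hc hcd hd
    have hmem : ∀ y ∈ Icc c d, pt x y ∈ N := fun y hyy => (hB x y hx0 hxs' (hy y ⟨by linarith [hyy.1], by linarith [hyy.2]⟩)).1
    refine intervalIntegral.integral_eq_sub_of_hasDerivAt (f := fun y => (m * y + q) * dd 1 v (pt x y) - m * v (pt x y)) ?_ ?_
    · intro y hyy
      rw [uIcc_of_le hcd] at hyy
      have e1 := chain_pt (X := fun _ => x) (Y := fun s => s) (d0 _ (hmem y hyy)) (hasDerivAt_const y x) (hasDerivAt_id y)
      have e2 := chain_pt (X := fun _ => x) (Y := fun s => s) (d2 _ (hmem y hyy)) (hasDerivAt_const y x) (hasDerivAt_id y)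
      have e3 := ((((hasDerivAt_id y).const_mul m).add_const q).mul e2).sub (e1.const_mul m)
      refine e3.congr_deriv ?_
      simp only [id]; ring
    · rw [intervalIntegrable_iff_integrableOn_Icc_of_le hcd]
      refine ContinuousOn.integrableOn_Icc ?_
      refine ContinuousOn.mul (by fun_prop) ?_
      exact c22.comp (continuous_pt_comp continuous_const continuous_id).continuousOn hmem
  set l1 : ℝ → ℝ := fun y => (1 / (y1 - y0)) * y + (-(y0 / (y1 - y0))) with hl1
  set l2 : ℝ → ℝ := fun y => (-(1 / (y2 - y1))) * y + (y2 / (y2 - y1)) with hl2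
  have el1 : ∀ y, l1 y = (y - y0) / (y1 - y0) := fun y => by simp only [hl1]; ring
  have el2 : ∀ y, l2 y = (y2 - y) / (y2 - y1) := fun y => by simp only [hl2]; ring
  have b1 : ∀ y ∈ Icc y0 y1, 0 ≤ l1 y ∧ l1 y ≤ 1 := fun y hyy => by
    rw [el1]; exact ⟨div_nonneg (by linarith [hyy.1]) p1.le, (div_le_one p1).2 (by linarith [hyy.2])⟩
  have b2 : ∀ y ∈ Icc y1 y2, 0 ≤ l2 y ∧ l2 y ≤ 1 := fun y hyy => by
    rw [el2]; exact ⟨div_nonneg (by linarith [hyy.2]) p2.le, (div_le_one p2).2 (by linarith [hyy.1])⟩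
  have l1c : Continuous l1 := by simp only [hl1]; fun_prop
  have l2c : Continuous l2 := by simp only [hl2]; fun_prop
  have Teq : ∀ x, 0 < x → x < xs → (∫ y in y0..y1, l1 y * dd 1 (dd 1 v) (pt x y)) + (∫ y in y1..y2, l2 y * dd 1 (dd 1 v) (pt x y)) = T x := by
    intro x hx0 hx1
    have i1 := ibp x y0 y1 (1 / (y1 - y0)) (-(y0 / (y1 - y0))) hx0 hx1 le_rfl h01.le h12.le
    have i2 := ibp x y1 y2 (-(1 / (y2 - y1))) (y2 / (y2 - y1)) hx0 hx1 h01.le h12.le le_rfl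
    simp only [hl1, hl2]
    rw [i1, i2]; simp only [hT]
    field_simp
    ring
  have key : ∀ x1, 0 < x1 → x1 ≤ x2 → (-T0 / 2) * (log x2 - log x1) ≤ 2 * B * (y2 - y0) := by
    intro x1 hx1 hx12
    have xin : ∀ x ∈ Icc x1 x2, 0 < x ∧ x < xs := fun x hx => ⟨by linarith [hx.1], by linarith [hx.2]⟩
    have a1 := convex3_aux hN hv hsub hx1 hx12 h01.le (fun x y hx hyy => (hB x y (xin x hx).1 (xin x hx).2 (hy y ⟨hyy.1, by linarith [hyy.2]⟩)).1) l1c (fun y hyy => (b1 y hyy).1)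
    have a2 := convex3_aux hN hv hsub hx1 hx12 h12.le (fun x y hx hyy => (hB x y (xin x hx).1 (xin x hx).2 (hy y ⟨by linarith [hyy.1], hyy.2⟩)).1) l2c (fun y hyy => (b2 y hyy).1)
    have bd : ∀ (l : ℝ → ℝ) (c d : ℝ), y0 ≤ c → c ≤ d → d ≤ y2 → (∀ y ∈ Icc c d, 0 ≤ l y ∧ l y ≤ 1) →
        ∫ y in c..d, l y * (dd 0 v (pt x2 y) / x2 - dd 0 v (pt x1 y) / x1) ≤ 2 * B * (d - c) := by
      intro l c d hc hcd hd hl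
      have := intervalIntegral.norm_integral_le_of_norm_le_const (a := c) (b := d) (C := 2 * B) (f := fun y => l y * (dd 0 v (pt x2 y) / x2 - dd 0 v (pt x1 y) / x1)) ?_
      · rw [abs_of_nonneg (by linarith : 0 ≤ d - c)] at this
        exact (le_abs_self _).trans this
      · intro y hyy
        rw [uIoc_of_le hcd] at hyy
        have hyR := hy y ⟨by linarith [hyy.1], by linarith [hyy.2]⟩
        have q1 := (hB x1 y hx1 (by linarith) hyR).2
        have q2 := (hB x2 y x2pos x2s hyR).2
        have hl' := hl y ⟨hyy.1.le, hyy.2⟩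
        rw [norm_mul, Real.norm_of_nonneg hl'.1, Real.norm_eq_abs]
        have r1 : |dd 0 v (pt x1 y) / x1| ≤ B := by rw [abs_div, abs_of_pos hx1, div_le_iff₀ hx1]; exact q1
        have r2 : |dd 0 v (pt x2 y) / x2| ≤ B := by rw [abs_div, abs_of_pos x2pos, div_le_iff₀ x2pos]; exact q2
        have r3 := abs_sub (dd 0 v (pt x2 y) / x2) (dd 0 v (pt x1 y) / x1)
        calc _ ≤ 1 * |dd 0 v (pt x2 y) / x2 - dd 0 v (pt x1 y) / x1| := by
              apply mul_le_mul_of_nonneg_right hl'.2 (abs_nonneg _)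
          _ ≤ _ := by linarith
    have a3 := bd l1 y0 y1 le_rfl h01.le h12.le b1
    have a4 := bd l2 y1 y2 h01.le h12.le le_rfl b2
    have sl : ∀ (l : ℝ → ℝ) (c d : ℝ), y0 ≤ c → c ≤ d → d ≤ y2 → Continuous l →
        IntervalIntegrable (fun x => -((∫ y in c..d, l y * dd 1 (dd 1 v) (pt x y)) / x)) volume x1 x2 := by
      intro l c d hc hcd hd hl
      have hSN : ∀ p ∈ Icc x1 x2 ×ˢ Icc c d, pt p.1 p.2 ∈ N := fun p hp =>
        (hB p.1 p.2 (xin _ hp.1).1 (xin _ hp.1).2 (hy _ ⟨by linarith [hp.2.1], by linarith [hp.2.2]⟩)).1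
      have cG : ContinuousOn (fun p : ℝ × ℝ => l p.2 * dd 1 (dd 1 v) (pt p.1 p.2)) (Icc x1 x2 ×ˢ Icc c d) :=
        (hl.comp continuous_snd).continuousOn.mul (contRect c22 hSN)
      have := rect_slice (f := fun y x => l y * dd 1 (dd 1 v) (pt x y)) hcd hx12
        (cG.comp (f := fun p : ℝ × ℝ => (p.2, p.1)) (by fun_prop) (fun p hp => ⟨hp.2, hp.1⟩))
      have i2 : ContinuousOn (fun x : ℝ => x⁻¹) (uIcc x1 x2) := by
        rw [uIcc_of_le hx12]
        exact continuousOn_inv₀.mono (fun x hx => ne_of_gt (xin x hx).1)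
      simp only [div_eq_mul_inv]
      exact (this.mul_continuousOn i2).neg
    have s1 := sl l1 y0 y1 le_rfl h01.le h12.le l1c
    have s2 := sl l2 y1 y2 h01.le h12.le le_rfl l2c
    have a5 := intervalIntegral.integral_add s1 s2
    have a6 : ∫ x in x1..x2, (-T0 / 2) * x⁻¹ ≤ ∫ x in x1..x2, (-((∫ y in y0..y1, l1 y * dd 1 (dd 1 v) (pt x y)) / x) + -((∫ y in y1..y2, l2 y * dd 1 (dd 1 v) (pt x y)) / x)) := by
      refine intervalIntegral.integral_mono_on hx12 ?_ (s1.add s2) ?_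
      · refine IntervalIntegrable.const_mul ?_ _
        refine intervalIntegral.intervalIntegrable_inv (fun x hx => ?_) continuousOn_id
        rw [uIcc_of_le hx12] at hx; exact ne_of_gt (xin x hx).1
      · intro x hx
        have hp := (xin x hx).1
        have hTl : T x < T0 / 2 := hTx ⟨hp, by linarith [hx.2]⟩
        rw [← Teq x hp (xin x hx).2] at hTl
        rw [← neg_add, ← add_div, ← neg_div, div_eq_mul_inv (-(_ + _))]
        apply mul_le_mul_of_nonneg_right _ (inv_nonneg.2 hp.le)
        linarith
    rw [intervalIntegral.integral_const_mul, integral_inv_of_pos hx1 x2pos, log_div (ne_of_gt x2pos) (ne_of_gt hx1)] at a6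
    rw [a5] at a6
    linarith
  have hl : Tendsto (fun x1 => (-T0 / 2) * (log x2 - log x1)) (𝓝[>] 0) atTop := by
    refine Tendsto.const_mul_atTop (by linarith) ?_
    exact tendsto_atTop_add_const_left _ _ (tendsto_neg_atBot_atTop.comp tendsto_log_nhdsGT_zero)
  have ev1 := hl.eventually (eventually_gt_atTop (2 * B * (y2 - y0)))
  have ev2 : ∀ᶠ x in 𝓝[>] (0:ℝ), x ∈ Ioo 0 x2 := Ioo_mem_nhdsGT x2pos
  obtain ⟨x, e1, e2⟩ := (ev1.and ev2).exists
  exact absurd (key x e2.1 e2.2.le) (not_le.2 e1)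



/-- flux bound near the axis -/
def FluxB (a : ℤ) (u : E2 → ℝ) (Ω : Set E2) (R δ : ℝ) : Prop :=
  ∀ x y : ℝ, 0 < x → x < δ → |y| ≤ R → pt x y ∈ Ω ∧
      (0 < u (pt x y) → |x ^ a * (u (pt x y) * dd 0 u (pt x y))| ≤ 1)

section axis
variable {a : ℤ} {u : E2 → ℝ} {Ω : Set E2} {R δ ε : ℝ}

lemma FluxB.mem (hfl : FluxB a u Ω R δ) {x y : ℝ} (h0 : 0 < x) (h1 : x < δ) (hy : |y| ≤ R) :
    pt x y ∈ Ω ∩ {x : E2 | 0 < x 0} := ⟨(hfl x y h0 h1 hy).1, by simpa using h0⟩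

lemma FluxB.bd (hfl : FluxB a u Ω R δ) {x y : ℝ} (h0 : 0 < x) (h1 : x < δ) (hy : |y| ≤ R) (hu : 0 < u (pt x y)) :
    u (pt x y) * |dd 0 u (pt x y)| ≤ x ^ (-a) := by
  have := (hfl x y h0 h1 hy).2 hu
  rw [abs_mul, abs_mul, abs_of_pos hu, abs_of_pos (zpow_pos h0 a)] at this
  rw [zpow_neg, ← one_div, le_div_iff₀ (zpow_pos h0 a)]
  linarith

lemma Ph.axis_diff (h : Ph a u Ω R) (hfl : FluxB a u Ω R δ) (hε : 0 < ε) {Λ : ℝ → ℝ}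
    (hΛ : ∀ τ > 0, HasDerivAt Λ (τ ^ (-a)) τ) {x' x y : ℝ} (hx' : 0 < x') (hxx : x' ≤ x) (hx : x < δ) (hy : |y| ≤ R) :
    |S2 ε (u (pt x y)) - S2 ε (u (pt x' y))| ≤ Λ x - Λ x' := by
  have hN := h.isOpenN
  have hd : ∀ τ ∈ Icc x' x, HasDerivAt (fun τ => S2 ε (u (pt τ y))) (dd 0 (fun z => S2 ε (u z)) (pt τ y)) τ := by
    intro τ hτ
    have hm := hfl.mem (lt_of_lt_of_le hx' hτ.1) (lt_of_le_of_lt hτ.2 hx) hy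
    have hdf : DifferentiableAt ℝ (fun z => S2 ε (u z)) (pt τ y) :=
      ((h.contDiff_comp (cut_S2 hε)).contDiffAt (hN.mem_nhds hm)).differentiableAt (by norm_num)
    refine (chain_pt (X := fun s => s) (Y := fun _ => y) hdf (hasDerivAt_id τ) (hasDerivAt_const τ y)).congr_deriv ?_
    ring
  have key := image_norm_le_of_norm_deriv_right_le_deriv_boundary' (a := x') (b := x)
    (f := fun τ => S2 ε (u (pt τ y)) - S2 ε (u (pt x' y))) (f' := fun τ => dd 0 (fun z => S2 ε (u z)) (pt τ y))
    (B := fun τ => Λ τ - Λ x') (B' := fun τ => τ ^ (-a)) ?_ ?_ (by simp) ?_ ?_ ?_ (right_mem_Icc.2 hxx)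
  · exact key
  · exact fun τ hτ => ((hd τ hτ).continuousAt.sub continuousAt_const).continuousWithinAt
  · exact fun τ hτ => ((hd τ ⟨hτ.1, hτ.2.le⟩).sub_const _).hasDerivWithinAt
  · exact fun τ hτ => ((hΛ τ (lt_of_lt_of_le hx' hτ.1)).continuousAt.sub continuousAt_const).continuousWithinAt
  · exact fun τ hτ => ((hΛ τ (lt_of_lt_of_le hx' hτ.1)).sub_const _).hasDerivWithinAt
  · intro τ hτ
    have h0 := lt_of_lt_of_le hx' hτ.1
    have h1 := hτ.2.trans hx
    rw [h.dd_comp (cut_S2 hε) (hfl.mem h0 h1 hy), norm_mul, Real.norm_eq_abs, Real.norm_eq_abs, abs_of_nonneg (S1_nonneg hε _)]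
    by_cases hu : 0 < u (pt τ y)
    · refine le_trans ?_ (hfl.bd h0 h1 hy hu)
      apply mul_le_mul_of_nonneg_right _ (abs_nonneg _)
      simpa [hu.le] using S1_le hε (u (pt τ y))
    · rw [S1_zero hε (by linarith), zero_mul]; exact (zpow_pos h0 _).le

lemma S2_max (hε : 0 < ε) (t : ℝ) : S2 ε (max t 0) = S2 ε t := by
  rcases le_total t 0 with h | h
  · rw [max_eq_right h, S2_zero hε hε.le, S2_zero hε (by linarith)]
  · rw [max_eq_left h]

lemma S1_max (hε : 0 < ε) (t : ℝ) : S1 ε (max t 0) = S1 ε t := by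
  rcases le_total t 0 with h | h
  · rw [max_eq_right h, S1_zero hε hε.le, S1_zero hε (by linarith)]
  · rw [max_eq_left h]

lemma hasDeriv_half_sq (τ : ℝ) : HasDerivAt (fun x : ℝ => x ^ 2 / 2) (τ ^ (-(-1):ℤ)) τ := by
  refine ((hasDerivAt_pow 2 τ).div_const 2).congr_deriv ?_
  simp

lemma Ph.axis_w (h : Ph (-1) u Ω R) (hfl : FluxB (-1) u Ω R δ) {x' x y : ℝ} (hx' : 0 < x') (hxx : x' ≤ x) (hx : x < δ) (hy : |y| ≤ R) :
    |(max (u (pt x y)) 0) ^ 2 / 2 - (max (u (pt x' y)) 0) ^ 2 / 2| ≤ x ^ 2 / 2 - x' ^ 2 / 2 := by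
  refine le_of_tendsto (((S2_tendsto (u (pt x y))).sub (S2_tendsto (u (pt x' y)))).abs) (Eventually.of_forall fun n => ?_)
  exact h.axis_diff hfl (en_pos n) (fun τ _ => hasDeriv_half_sq τ) hx' hxx hx hy

lemma Ph.axis_lim (h : Ph (-1) u Ω R) (hδ : 0 < δ) (hfl : FluxB (-1) u Ω R δ) :
    ∃ f : ℝ → ℝ, ∀ y, |y| ≤ R → 0 ≤ f y ∧ Tendsto (fun x => max (u (pt x y)) 0) (𝓝[>] 0) (𝓝 (f y)) := by
  have : ∀ y, ∃ c, |y| ≤ R → 0 ≤ c ∧ Tendsto (fun x => max (u (pt x y)) 0) (𝓝[>] 0) (𝓝 c) := by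
    intro y
    by_cases hy : |y| ≤ R
    swap
    · exact ⟨0, fun h => absurd h hy⟩
    set g : ℝ → ℝ := fun x => (max (u (pt x y)) 0) ^ 2 / 2 + x ^ 2 / 2 with hg
    have hm : MonotoneOn g (Ioo 0 δ) := by
      intro x' hx' x hx hxx
      have := (abs_le.1 (h.axis_w hfl hx'.1 hxx hx.2 hy)).1
      simp only [hg]; linarith
    have hb : BddBelow (g '' Ioo 0 δ) := ⟨0, by rintro _ ⟨x, _, rfl⟩; simp only [hg]; positivity⟩
    have ht := hm.tendsto_nhdsWithin_Ioo_right (nonempty_Ioo.2 hδ) hb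
    set L := sInf (g '' Ioo 0 δ)
    have hx2 : Tendsto (fun x : ℝ => x ^ 2 / 2) (𝓝[>] 0) (𝓝 0) := by
      have : Tendsto (fun x : ℝ => x ^ 2 / 2) (𝓝 0) (𝓝 (0 ^ 2 / 2)) := (Continuous.tendsto (by fun_prop) 0)
      simp only [ne_eq, OfNat.ofNat_ne_zero, not_false_eq_true, zero_pow, zero_div] at this
      exact this.mono_left nhdsWithin_le_nhds
    have h3 := (((ht.sub hx2).const_mul 2).sqrt)
    refine ⟨√(2 * (L - 0)), fun _ => ⟨Real.sqrt_nonneg _, h3.congr fun x => ?_⟩⟩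
    simp only [hg]
    rw [show 2 * ((max (u (pt x y)) 0) ^ 2 / 2 + x ^ 2 / 2 - x ^ 2 / 2) = (max (u (pt x y)) 0) ^ 2 by ring]
    exact Real.sqrt_sq (le_max_right _ _)
  choose f hf using this
  exact ⟨f, hf⟩

/-- boundary trace of `u⁺` on the axis -/
def Trace (u : E2 → ℝ) (R : ℝ) (f : ℝ → ℝ) : Prop :=
  ∀ y, |y| ≤ R → 0 ≤ f y ∧ Tendsto (fun x => max (u (pt x y)) 0) (𝓝[>] 0) (𝓝 (f y))

lemma Ph.axis_S2 (h : Ph (-1) u Ω R) (hfl : FluxB (-1) u Ω R δ) {f : ℝ → ℝ} (hf : Trace u R f) (hε : 0 < ε)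
    {x y : ℝ} (hx0 : 0 < x) (hx : x < δ) (hy : |y| ≤ R) :
    |S2 ε (u (pt x y)) - S2 ε (f y)| ≤ x ^ 2 / 2 := by
  have t1 : Tendsto (fun x' => |S2 ε (u (pt x y)) - S2 ε (max (u (pt x' y)) 0)|) (𝓝[>] 0) (𝓝 |S2 ε (u (pt x y)) - S2 ε (f y)|) :=
    (tendsto_const_nhds.sub (((S2_cont ε).tendsto _).comp (hf y hy).2)).abs
  refine le_of_tendsto t1 ?_
  filter_upwards [Ioo_mem_nhdsGT hx0] with x' hx'
  rw [S2_max hε]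
  have := h.axis_diff hfl hε (fun τ _ => hasDeriv_half_sq τ) hx'.1 hx'.2.le hx hy
  have p := sq_nonneg x'
  linarith

lemma Ph.axis_wf (h : Ph (-1) u Ω R) (hfl : FluxB (-1) u Ω R δ) {f : ℝ → ℝ} (hf : Trace u R f)
    {x y : ℝ} (hx0 : 0 < x) (hx : x < δ) (hy : |y| ≤ R) :
    |(max (u (pt x y)) 0) ^ 2 / 2 - (f y) ^ 2 / 2| ≤ x ^ 2 / 2 := by
  have t := ((S2_tendsto (u (pt x y))).sub (S2_tendsto (f y))).abs
  rw [max_eq_left (hf y hy).1] at t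
  exact le_of_tendsto t (Eventually.of_forall fun n => h.axis_S2 hfl hf (en_pos n) hx0 hx hy)

lemma Ph.axis_S1lim {f : ℝ → ℝ} (hf : Trace u R f) (hε : 0 < ε) {y : ℝ} (hy : |y| ≤ R) :
    Tendsto (fun x => S1 ε (u (pt x y))) (𝓝[>] 0) (𝓝 (S1 ε (f y))) := by
  refine (((S1_cont ε).tendsto _).comp (hf y hy).2).congr fun x => ?_
  exact S1_max hε _

lemma Ph.axis_convex (h : Ph (-1) u Ω R) (hδ : 0 < δ) (hfl : FluxB (-1) u Ω R δ) {f : ℝ → ℝ} (hf : Trace u R f)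
    {y0 y1 y2 : ℝ} (h0 : -R ≤ y0) (h01 : y0 < y1) (h12 : y1 < y2) (h2 : y2 ≤ R) :
    f y1 * (1 / (y1 - y0) + 1 / (y2 - y1)) ≤ f y0 / (y1 - y0) + f y2 / (y2 - y1) := by
  have hy : ∀ y ∈ Icc y0 y2, |y| ≤ R := fun y hy => abs_le.2 ⟨by linarith [hy.1], by linarith [hy.2]⟩
  have b0 := hy y0 ⟨le_rfl, by linarith⟩
  have b1 := hy y1 ⟨by linarith, by linarith⟩
  have b2 := hy y2 ⟨by linarith, le_rfl⟩
  have lim : ∀ y, |y| ≤ R → Tendsto (fun n => S1 (en n) (f y)) atTop (𝓝 (f y)) := fun y hyy => by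
    have := S1_tendsto (f y); rwa [max_eq_left (hf y hyy).1] at this
  refine le_of_tendsto_of_tendsto ((lim y1 b1).mul_const _) (((lim y0 b0).div_const _).add ((lim y2 b2).div_const _))
    (Eventually.of_forall fun n => ?_)
  have hε := en_pos n
  refine convex3 h.isOpenN (h.contDiff_comp (cut_S1 hε)) ?_ hδ (B := 1 / en n) ?_ (φ := fun y => S1 (en n) (f y)) (fun y hyy => Ph.axis_S1lim hf hε hyy) h0 h01 h12 h2
  · intro x hx
    have := h.eq_comp (cut_S1 hε) hx
    have hx0 : 0 < x 0 := hx.2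
    have p : 0 ≤ x 0 * (deriv (S0 (en n)) (u x) * ((dd 0 u x) ^ 2 + (dd 1 u x) ^ 2)) :=
      mul_nonneg hx0.le (mul_nonneg ((cut_S1 hε).nonneg _) (by positivity))
    rw [← this] at p
    push_cast at p
    linarith
  · intro x y hx0 hx1 hyy
    have hm := hfl.mem hx0 hx1 hyy
    refine ⟨hm, ?_⟩
    rw [h.dd_comp (cut_S1 hε) hm, abs_mul, abs_of_nonneg (S0_nonneg _ _)]
    by_cases hu : en n < u (pt x y)
    · have := hfl.bd hx0 hx1 hyy (hε.trans hu)
      simp only [neg_neg, zpow_one] at this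
      have q : S0 (en n) (u (pt x y)) * |dd 0 u (pt x y)| ≤ |dd 0 u (pt x y)| := by
        have := mul_le_mul_of_nonneg_right (S0_le_one (en n) (u (pt x y))) (abs_nonneg (dd 0 u (pt x y))); linarith
      refine q.trans ?_
      rw [one_div, ← div_eq_inv_mul, le_div_iff₀ hε]
      have := mul_le_mul_of_nonneg_right hu.le (abs_nonneg (dd 0 u (pt x y)))
      linarith
    · rw [S0_zero hε (not_lt.1 hu), zero_mul]; positivity

end axis



/-- a function on a strip whose vertical slices have definite size cannot have finite `1/x` weighted integral -/
lemma no_int {g : ℝ → ℝ → ℝ} {xs y1 y2 m : ℝ} (hxs : 0 < xs) (h12 : y1 ≤ y2) (hm : 0 < m)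
    (hg : Integrable (fun p : ℝ × ℝ => g p.1 p.2) ((volume.restrict (Ioo 0 xs)).prod (volume.restrict (Ioc y1 y2))))
    (hlow : ∀ x ∈ Ioo 0 xs, m * x⁻¹ ≤ ∫ y in Ioc y1 y2, g x y) : False := by
  have h1 := hg.integral_prod_left
  have h2 : IntegrableOn (fun x : ℝ => m * x⁻¹) (Ioo 0 xs) := by
    refine Integrable.mono' h1 (by fun_prop) ?_
    filter_upwards [ae_restrict_mem measurableSet_Ioo] with x hx
    rw [Real.norm_of_nonneg (mul_nonneg hm.le (inv_nonneg.2 hx.1.le))]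
    exact hlow x hx
  have h3 : IntegrableOn (fun x : ℝ => x⁻¹) (Ioo 0 xs) := by
    have := h2.const_mul m⁻¹
    refine this.congr (Eventually.of_forall fun x => ?_)
    simp only; field_simp
  have h4 : IntervalIntegrable (fun x : ℝ => x⁻¹) volume 0 xs := by
    rw [intervalIntegrable_iff_integrableOn_Ioo_of_le hxs.le]; exact h3
  rw [intervalIntegrable_inv_iff] at h4
  rcases h4 with h4 | h4
  · exact absurd h4.symm (ne_of_gt hxs)
  · exact h4 left_mem_uIcc

section axis
variable {a : ℤ} {u : E2 → ℝ} {Ω : Set E2} {R δ ε : ℝ}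

lemma Ph.axis_const (h : Ph (-1) u Ω R) (hδ : 0 < δ) (hfl : FluxB (-1) u Ω R δ) {f : ℝ → ℝ} (hf : Trace u R f)
    {r : ℝ} (hrR : r ≤ R)
    (hE : IntegrableOn (gE (-1) u) (Metric.ball (0:E2) r ∩ {x : E2 | 0 < x 0} ∩ {x : E2 | 0 < u x}))
    {y1 y2 : ℝ} (h1 : -r < y1) (h12 : y1 < y2) (h2 : y2 < r) : f y1 = f y2 := by
  by_contra hne
  have hyR : ∀ y ∈ Icc y1 y2, |y| ≤ R := fun y hy => abs_le.2 ⟨by linarith [hy.1], by linarith [hy.2]⟩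
  have b1 := hyR y1 ⟨le_rfl, h12.le⟩
  have b2 := hyR y2 ⟨h12.le, le_rfl⟩
  have lim : ∀ y, |y| ≤ R → Tendsto (fun n => S1 (en n) (f y)) atTop (𝓝 (f y)) := fun y hyy => by
    have := S1_tendsto (f y); rwa [max_eq_left (hf y hyy).1] at this
  obtain ⟨n, hn⟩ : ∃ n, S1 (en n) (f y1) ≠ S1 (en n) (f y2) := by
    by_contra hcon
    push Not at hcon
    refine hne (tendsto_nhds_unique (lim y1 b1) ((lim y2 b2).congr fun n => (hcon n).symm))
  set ε := en n with hεe
  have hε : 0 < ε := en_pos n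
  set v : E2 → ℝ := fun z => S1 ε (u z) with hv
  set D0 := |S1 ε (f y2) - S1 ε (f y1)| with hD0
  have D0p : 0 < D0 := abs_pos.2 (sub_ne_zero.2 (Ne.symm hn))
  have tl : Tendsto (fun x => |v (pt x y2) - v (pt x y1)|) (𝓝[>] 0) (𝓝 D0) :=
    ((Ph.axis_S1lim hf hε b2).sub (Ph.axis_S1lim hf hε b1)).abs
  have ev := tl.eventually (lt_mem_nhds (show D0 / 2 < D0 by linarith))
  obtain ⟨x1, hx1, hTx⟩ := mem_nhdsGT_iff_exists_Ioo_subset.1 ev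
  have hx1' : 0 < x1 := hx1
  set ym := max |y1| |y2| with hym
  have hymr : ym < r := max_lt (abs_lt.2 ⟨h1, by linarith⟩) (abs_lt.2 ⟨by linarith, h2⟩)
  have hym0 : 0 ≤ ym := (abs_nonneg y1).trans (le_max_left _ _)
  set xs := min (min x1 δ) (r - ym) with hxs
  have xsp : 0 < xs := lt_min (lt_min hx1' hδ) (by linarith)
  have xs1 : xs ≤ x1 := (min_le_left _ _).trans (min_le_left _ _)
  have xs2 : xs ≤ δ := (min_le_left _ _).trans (min_le_right _ _)
  have xs3 : xs ≤ r - ym := min_le_right _ _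
  have mN : ∀ x y, x ∈ Ioo 0 xs → y ∈ Icc y1 y2 → pt x y ∈ Ω ∩ {x : E2 | 0 < x 0} := fun x y hx hy =>
    hfl.mem hx.1 (by linarith [hx.2]) (hyR y hy)
  have mB : ∀ x y, x ∈ Ioo 0 xs → y ∈ Icc y1 y2 → pt x y ∈ Metric.ball (0:E2) r := by
    intro x y hx hy
    have hay : |y| ≤ ym := by
      rcases le_total 0 y with h | h
      · rw [abs_of_nonneg h]; exact hy.2.trans ((le_abs_self _).trans (le_max_right _ _))
      · rw [abs_of_nonpos h]; exact (neg_le_neg hy.1).trans ((neg_le_abs _).trans (le_max_left _ _))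
    rw [mem_ball_zero_iff]
    have e := norm_pt_sq x y
    have e2 := sq_abs y
    have : ‖pt x y‖ ^ 2 < r ^ 2 := by nlinarith [hx.1, hx.2, abs_nonneg y]
    exact lt_of_pow_lt_pow_left₀ 2 (by linarith) this
  have hN := h.isOpenN
  have vc : ContDiffOn ℝ 2 v (Ω ∩ {x : E2 | 0 < x 0}) := h.contDiff_comp (cut_S1 hε)
  have c2 : ContDiffOn ℝ 1 (dd 1 v) (Ω ∩ {x : E2 | 0 < x 0}) := dd_contDiffOn (n := 1) hN vc 1
  have d0 : ∀ x ∈ Ω ∩ {x : E2 | 0 < x 0}, DifferentiableAt ℝ v x := fun x hx => (vc.contDiffAt (hN.mem_nhds hx)).differentiableAt (by norm_num)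
  set m := D0 ^ 2 / (4 * (y2 - y1)) with hm
  have p12 : 0 < y2 - y1 := by linarith
  have mp : 0 < m := by positivity
  have slc : ∀ x ∈ Ioo 0 xs, ContinuousOn (fun y => dd 1 v (pt x y)) (Icc y1 y2) := fun x hx =>
    c2.continuousOn.comp (continuous_pt_comp continuous_const continuous_id).continuousOn (fun y hy => mN x y hx hy)
  have low : ∀ x ∈ Ioo 0 xs, m ≤ ∫ y in y1..y2, (dd 1 v (pt x y)) ^ 2 := by
    intro x hx
    have hD : D0 / 2 < |v (pt x y2) - v (pt x y1)| := hTx ⟨hx.1, by linarith [hx.2]⟩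
    have ii : ∀ g : ℝ → ℝ, ContinuousOn g (Icc y1 y2) → IntervalIntegrable g volume y1 y2 := fun g hg => by
      rw [intervalIntegrable_iff_integrableOn_Icc_of_le h12.le]; exact hg.integrableOn_Icc
    have ftc : ∫ y in y1..y2, dd 1 v (pt x y) = v (pt x y2) - v (pt x y1) := by
      refine intervalIntegral.integral_eq_sub_of_hasDerivAt (f := fun y => v (pt x y)) ?_ (ii _ (slc x hx))
      intro y hy
      rw [uIcc_of_le h12.le] at hy
      refine (chain_pt (X := fun _ => x) (Y := fun s => s) (d0 _ (mN x y hx hy)) (hasDerivAt_const y x) (hasDerivAt_id y)).congr_deriv ?_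
      simp
    set l := 2 * (y2 - y1) / D0 with hl
    have lp : 0 < l := by positivity
    have i3 : |∫ y in y1..y2, dd 1 v (pt x y)| ≤ ∫ y in y1..y2, (l / 2 * (dd 1 v (pt x y)) ^ 2 + 1 / (2 * l)) := by
      refine (intervalIntegral.abs_integral_le_integral_abs h12.le).trans ?_
      refine intervalIntegral.integral_mono_on h12.le (ii _ (slc x hx).abs) (ii _ ?_) ?_
      · exact (ContinuousOn.mul continuousOn_const ((slc x hx).pow 2)).add continuousOn_const
      · intro y hy
        have q := sq_nonneg (l * |dd 1 v (pt x y)| - 1)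
        rw [← sq_abs (dd 1 v (pt x y))]
        have : l / 2 * |dd 1 v (pt x y)| ^ 2 + 1 / (2 * l) - |dd 1 v (pt x y)| = (l * |dd 1 v (pt x y)| - 1) ^ 2 / (2 * l) := by
          field_simp; ring
        have : 0 ≤ (l * |dd 1 v (pt x y)| - 1) ^ 2 / (2 * l) := by positivity
        linarith
    rw [intervalIntegral.integral_add (f := fun y => l / 2 * (dd 1 v (pt x y)) ^ 2) (g := fun _ => 1 / (2 * l)) (ii _ (ContinuousOn.mul continuousOn_const ((slc x hx).pow 2))) intervalIntegrable_const, intervalIntegral.integral_const_mul,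
      intervalIntegral.integral_const, ftc] at i3
    set I := ∫ y in y1..y2, (dd 1 v (pt x y)) ^ 2
    have e1 : (y2 - y1) • (1 / (2 * l)) = D0 / 4 := by simp only [hl, smul_eq_mul]; field_simp; ring
    rw [e1] at i3
    have e2 : D0 / 4 ≤ l / 2 * I := by linarith
    have e3 : m = (D0 / 4) / (l / 2) := by simp only [hl, hm]; field_simp
    rw [e3, div_le_iff₀ (by positivity)]; linarith
  set A := Metric.ball (0:E2) r ∩ {x : E2 | 0 < x 0} ∩ {x : E2 | 0 < u x} with hA
  have hAm : MeasurableSet A := by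
    have : A = (Ω ∩ {x : E2 | 0 < x 0} ∩ {x : E2 | 0 < u x}) ∩ Metric.ball (0:E2) r := by
      ext z; simp only [hA, mem_inter_iff, mem_setOf_eq]
      constructor
      · rintro ⟨⟨q1, q2⟩, q3⟩
        refine ⟨⟨⟨h.ball ⟨?_, le_of_lt q2⟩, q2⟩, q3⟩, q1⟩
        exact (Metric.ball_subset_closedBall.trans (Metric.closedBall_subset_closedBall hrR)) q1
      · rintro ⟨⟨⟨q0, q2⟩, q3⟩, q1⟩; exact ⟨⟨q1, q2⟩, q3⟩
    rw [this]; exact (h.isOpenP.inter Metric.isOpen_ball).measurableSet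
  have i0 : Integrable (fun p : ℝ × ℝ => A.indicator (gE (-1) u) (pt p.1 p.2)) (volume : Measure (ℝ × ℝ)) :=
    (mp_pt.integrable_comp_emb me_pt).2 ((integrable_indicator_iff hAm).2 hE)
  refine no_int (g := fun x y => (dd 1 v (pt x y)) ^ 2 * x⁻¹) xsp h12.le mp ?_ ?_
  · rw [Measure.prod_restrict]
    refine Integrable.mono' (g := fun p : ℝ × ℝ => A.indicator (gE (-1) u) (pt p.1 p.2)) ?_ ?_ ?_
    · exact i0.integrableOn
    · refine ContinuousOn.aestronglyMeasurable ?_ (measurableSet_Ioo.prod measurableSet_Ioc)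
      refine ContinuousOn.mul (ContinuousOn.pow (contRect c2.continuousOn ?_) 2) ?_
      · exact fun p hp => mN _ _ hp.1 ⟨hp.2.1.le, hp.2.2⟩
      · exact continuous_fst.continuousOn.inv₀ (fun p hp => ne_of_gt hp.1.1)
    · filter_upwards [ae_restrict_mem (measurableSet_Ioo.prod measurableSet_Ioc)] with p hp
      have hy : p.2 ∈ Icc y1 y2 := ⟨hp.2.1.le, hp.2.2⟩
      have hpN := mN _ _ hp.1 hy
      have x0 : 0 < p.1 := hp.1.1
      rw [Real.norm_of_nonneg (by positivity)]
      rw [h.dd_comp (cut_S1 hε) hpN]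
      by_cases hu : 0 < u (pt p.1 p.2)
      · rw [indicator_of_mem (show pt p.1 p.2 ∈ A from ⟨⟨mB _ _ hp.1 hy, hpN.2⟩, hu⟩)]
        simp only [gE, pt_zero, zpow_neg_one]
        rw [mul_comm]
        apply mul_le_mul_of_nonneg_left _ (inv_nonneg.2 x0.le)
        rw [mul_pow]
        have s1 : (S0 ε (u (pt p.1 p.2))) ^ 2 ≤ 1 := pow_le_one₀ (S0_nonneg _ _) (S0_le_one _ _)
        nlinarith [sq_nonneg (dd 0 u (pt p.1 p.2)), mul_le_mul_of_nonneg_right s1 (sq_nonneg (dd 1 u (pt p.1 p.2)))]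
      · rw [S0_zero hε (by linarith)]
        have : 0 ≤ A.indicator (gE (-1) u) (pt p.1 p.2) := by
          apply indicator_nonneg
          intro z hz
          have : 0 < z 0 := hz.1.2
          unfold gE; positivity
        simpa using this
  · intro x hx
    rw [integral_mul_const]
    apply mul_le_mul_of_nonneg_right _ (inv_nonneg.2 hx.1.le)
    rw [← intervalIntegral.integral_of_le h12.le]; exact low x hx

end axis



section axis
variable {a : ℤ} {u : E2 → ℝ} {Ω : Set E2} {R δ ε : ℝ}

lemma Ph.compact_bd (h : Ph a u Ω R) {K : Set E2} (hK : IsCompact K) (hKN : K ⊆ Ω ∩ {x : E2 | 0 < x 0}) :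
    ∃ C, 0 ≤ C ∧ ∀ z ∈ K, ∀ ε > 0, S2 ε (u z) ≤ C := by
  obtain ⟨C, hC⟩ := hK.exists_bound_of_continuousOn (h.cont.mono hKN)
  refine ⟨C ^ 2 / 2, by positivity, fun z hz ε hε => (S2_le hε _).trans ?_⟩
  have h1 := hC z hz
  rw [Real.norm_eq_abs] at h1
  have h2 : max (u z) 0 ≤ C := max_le ((le_abs_self _).trans h1) ((abs_nonneg _).trans h1)
  have h3 : 0 ≤ max (u z) 0 := le_max_right _ _
  have := pow_le_pow_left₀ h3 h2 2
  linarith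

lemma Ph.compact_bd1 (h : Ph a u Ω R) {d : ℝ} (hd : 0 < d) :
    ∃ C, 0 ≤ C ∧ ∀ x y, d ≤ x → ‖pt x y‖ ≤ R → ∀ ε > 0, S2 ε (u (pt x y)) ≤ C := by
  obtain ⟨C, h0, hC⟩ := h.compact_bd (K := Metric.closedBall (0:E2) R ∩ {x : E2 | d ≤ x 0})
    ((isCompact_closedBall _ _).inter_right (isClosed_le continuous_const (by fun_prop)))
    (fun z hz => ⟨h.ball ⟨hz.1, hd.le.trans hz.2⟩, lt_of_lt_of_le hd hz.2⟩)
  exact ⟨C, h0, fun x y hx hy ε hε => hC _ ⟨by rwa [mem_closedBall_zero_iff], by simpa using hx⟩ ε hε⟩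

lemma Ph.compact_bd2 (h : Ph a u Ω R) {d : ℝ} (hd : 0 < d) (hfl : FluxB a u Ω R δ) (hdδ : d < δ) :
    ∃ C, 0 ≤ C ∧ ∀ y, |y| ≤ R → ∀ ε > 0, S2 ε (u (pt d y)) ≤ C := by
  obtain ⟨C, h0, hC⟩ := h.compact_bd (K := (fun y => pt d y) '' Icc (-R) R)
    (isCompact_Icc.image (continuous_pt_comp continuous_const continuous_id))
    (by rintro _ ⟨y, hy, rfl⟩; exact hfl.mem hd hdδ (abs_le.2 hy))
  exact ⟨C, h0, fun y hy ε hε => hC _ ⟨y, abs_le.1 hy, rfl⟩ ε hε⟩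

lemma dd_neg (i : Fin 2) (u : E2 → ℝ) : dd i (fun z => -u z) = fun z => -dd i u z := by
  funext z; unfold dd; rw [fderiv_fun_neg]; rfl

lemma Ph.axis_trace (h : Ph (-1) u Ω R) (hδ : 0 < δ) (hfl : FluxB (-1) u Ω R δ) {f : ℝ → ℝ} (hf : Trace u R f)
    {r : ℝ} (hr : 0 < r) (hrR : r < R) {c : ℝ} (hc : ∀ y, |y| < r → f y = c) :
    (∀ y, |y| ≤ R → f y = c) ∨ (c = 0 ∧ ∃ K, 0 ≤ K ∧ ∀ s y, 0 < s → s < r → s ≤ |y| → |y| < R → f y ≤ K * (|y| - s)) := by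
  have hR : 0 < R := hr.trans hrR
  have hf0 : f 0 = c := hc 0 (by simpa using hr)
  have hc0 : 0 ≤ c := hf0 ▸ (hf 0 (by simpa using hR.le)).1
  rcases hc0.eq_or_lt with hc0 | hcp
  · right
    have hfR := (hf R (by rw [abs_of_pos hR])).1
    have hfR' := (hf (-R) (by rw [abs_neg, abs_of_pos hR])).1
    have dR : 0 < R - r := by linarith
    refine ⟨hc0.symm, (f R + f (-R)) / (R - r), by positivity, ?_⟩
    intro s y hs0 hs hsy hyR
    have fy := (hf y hyR.le).1
    have fs : f s = 0 := by rw [hc s (by rwa [abs_of_pos hs0]), ← hc0]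
    have fs' : f (-s) = 0 := by rw [hc (-s) (by rwa [abs_neg, abs_of_pos hs0]), ← hc0]
    rw [div_mul_eq_mul_div, le_div_iff₀ dR]
    rcases hsy.eq_or_lt with e | hsy
    · have : f y = 0 := by rw [hc y (by rw [← e]; exact hs), ← hc0]
      rw [this, ← e]; simp
    rcases le_total 0 y with hy | hy
    · rw [abs_of_nonneg hy] at hsy hyR ⊢
      have := h.axis_convex hδ hfl hf (y0 := s) (y1 := y) (y2 := R) (by linarith) hsy hyR le_rfl
      rw [fs, zero_div, zero_add] at this
      have p1 : 0 < y - s := by linarith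
      have p2 : 0 < R - y := by linarith
      rw [div_add_div _ _ p1.ne' p2.ne', mul_div_assoc', div_le_div_iff₀ (by positivity) p2] at this
      have e : f y * (R - s) * (R - y) ≤ (f R * (y - s)) * (R - y) := by nlinarith
      have e2 := le_of_mul_le_mul_right e p2
      nlinarith
    · rw [abs_of_nonpos hy] at hsy hyR ⊢
      have := h.axis_convex hδ hfl hf (y0 := -R) (y1 := y) (y2 := -s) le_rfl (by linarith) (by linarith) (by linarith)
      rw [fs', zero_div, add_zero] at this
      have p1 : 0 < -s - y := by linarith
      have p2 : 0 < y - -R := by linarith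
      rw [div_add_div _ _ p2.ne' p1.ne', mul_div_assoc', div_le_div_iff₀ (by positivity) p2] at this
      have e : f y * (R - s) * (y - -R) ≤ (f (-R) * (-s - y)) * (y - -R) := by nlinarith
      have e2 := le_of_mul_le_mul_right e p2
      nlinarith
  · left
    have hfh : f (r / 2) = c := hc _ (by rw [abs_of_pos (by positivity)]; linarith)
    have hfh' : f (-(r / 2)) = c := hc _ (by rw [abs_neg, abs_of_pos (by positivity)]; linarith)
    have rh : 0 < r / 2 := by positivity
    have ge : ∀ y, |y| ≤ R → c ≤ f y := by
      intro y hy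
      by_cases hyr : |y| < r
      · rw [hc y hyr]
      push Not at hyr
      rcases le_total 0 y with h0 | h0
      · rw [abs_of_nonneg h0] at hyr hy
        have := h.axis_convex hδ hfl hf (y0 := 0) (y1 := r / 2) (y2 := y) (by linarith) rh (by linarith) hy
        rw [hf0, hfh, mul_add, mul_one_div, mul_one_div, add_le_add_iff_left] at this
        exact (div_le_div_iff_of_pos_right (by linarith)).1 this
      · rw [abs_of_nonpos h0] at hyr hy
        have := h.axis_convex hδ hfl hf (y0 := y) (y1 := -(r / 2)) (y2 := 0) (by linarith) (by linarith) (by linarith) (by linarith)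
        rw [hf0, hfh', mul_add, mul_one_div, mul_one_div, add_le_add_iff_right] at this
        exact (div_le_div_iff_of_pos_right (by linarith)).1 this
    set xs := min δ (c / 2) with hxs
    have xsp : 0 < xs := lt_min hδ (by positivity)
    have ulow : ∀ x y, 0 < x → x < xs → |y| ≤ R → c / 2 ≤ u (pt x y) := by
      intro x y hx0 hx hy
      have h1 := (abs_le.1 (h.axis_wf hfl hf hx0 (hx.trans_le (min_le_left _ _)) hy)).1
      have h2 := ge y hy
      have h3 : x < c / 2 := hx.trans_le (min_le_right _ _)
      by_contra hcon
      push Not at hcon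
      have h4 : max (u (pt x y)) 0 < c / 2 := max_lt hcon (by positivity)
      have h5 : 0 ≤ max (u (pt x y)) 0 := le_max_right _ _
      nlinarith
    have hmN : ∀ x y, 0 < x → x < xs → |y| ≤ R → pt x y ∈ Ω ∩ {x : E2 | 0 < x 0} ∩ {x : E2 | 0 < u x} := fun x y hx0 hx hy =>
      ⟨hfl.mem hx0 (hx.trans_le (min_le_left _ _)) hy, lt_of_lt_of_le (by positivity) (ulow x y hx0 hx hy)⟩
    have conc : ∀ {y0 y1 y2 : ℝ}, -R ≤ y0 → y0 < y1 → y1 < y2 → y2 ≤ R →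
        -f y1 * (1 / (y1 - y0) + 1 / (y2 - y1)) ≤ -f y0 / (y1 - y0) + -f y2 / (y2 - y1) := by
      intro y0 y1 y2 q0 q1 q2 q3
      refine convex3 h.isOpenP (v := fun z => -u z) h.c2.neg ?_ xsp (B := 2 / c) ?_ (φ := fun y => -f y) ?_ q0 q1 q2 q3
      · intro z hz
        have := h.pde z hz
        simp only [dd_neg]
        push_cast at this
        linarith
      · intro x y hx0 hx hy
        have hm := hmN x y hx0 hx hy
        refine ⟨hm, ?_⟩
        have hb := hfl.bd hx0 (hx.trans_le (min_le_left _ _)) hy hm.2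
        simp only [neg_neg, zpow_one] at hb
        simp only [dd_neg, abs_neg]
        have := mul_le_mul_of_nonneg_right (ulow x y hx0 hx hy) (abs_nonneg (dd 0 u (pt x y)))
        rw [div_mul_eq_mul_div, le_div_iff₀ hcp]
        linarith
      · intro y hy
        refine ((hf y hy).2.neg).congr' ?_
        filter_upwards [Ioo_mem_nhdsGT xsp] with x hx
        rw [max_eq_left (le_of_lt (hmN x y hx.1 hx.2 hy).2)]
    intro y hy
    by_cases hyr : |y| < r
    · exact hc y hyr
    push Not at hyr
    refine le_antisymm ?_ (ge y hy)
    rcases le_total 0 y with h0 | h0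
    · rw [abs_of_nonneg h0] at hyr hy
      have := conc (y0 := 0) (y1 := r / 2) (y2 := y) (by linarith) rh (by linarith) hy
      rw [hf0, hfh, mul_add, mul_one_div, mul_one_div, add_le_add_iff_left] at this
      have := (div_le_div_iff_of_pos_right (by linarith)).1 this
      linarith
    · rw [abs_of_nonpos h0] at hyr hy
      have := conc (y0 := y) (y1 := -(r / 2)) (y2 := 0) (by linarith) (by linarith) (by linarith) (by linarith)
      rw [hf0, hfh', mul_add, mul_one_div, mul_one_div, add_le_add_iff_right] at this
      have := (div_le_div_iff_of_pos_right (by linarith)).1 this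
      linarith

end axis



set_option maxHeartbeats 1000000 in
lemma Ph.full {a : ℤ} {u : E2 → ℝ} {Ω : Set E2} {r : ℝ} (h : Ph a u Ω r) :
    ∫ x in Metric.ball (0:E2) r ∩ {x : E2 | 0 < x 0} ∩ {x : E2 | 0 < u x}, gE a u x =
      ∫ θ in Ioo (-(π/2)) (π/2), {x : E2 | 0 < u x}.indicator (gF a u) (gam r θ) := by
  refine h.main fun hE => ?_
  obtain ⟨R, hrR, hR⟩ := h.extend
  have hr := h.rpos
  have Rp : 0 < R := hr.trans hrR
  obtain ⟨δ, hδ, hfl⟩ := hR.flux_unif one_pos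
  replace hfl : FluxB a u Ω R δ := hfl
  set T := log (R / r) with hT
  have T0 : 0 < T := log_pos ((one_lt_div hr).2 hrR)
  have hTR : r * exp T = R := by rw [hT, exp_log (by positivity)]; field_simp
  set κ := min 1 (T / 2) with hκ
  have κ0 : 0 < κ := lt_min one_pos (by positivity)
  have κ1 : κ ≤ 1 := min_le_left _ _
  have κT : κ < T := lt_of_le_of_lt (min_le_right _ _) (by linarith)
  obtain ⟨d, dp, dδ⟩ : ∃ d, 0 < d ∧ d < δ := ⟨δ / 2, by positivity, by linarith⟩
  obtain ⟨C1, C10, hC1⟩ := hR.compact_bd1 dp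
  -- geometric facts
  have geo : ∀ t θ, (t, θ) ∈ dom T → ‖PP r t θ‖ < R ∧ |r * exp t * sin θ| < R := by
    intro t θ hd
    have e1 : r * exp t < R := by
      rw [← hTR]; exact mul_lt_mul_of_pos_left (exp_lt_exp.2 hd.1.2) hr
    constructor
    · rw [PP_eq_gam, gam_norm (by positivity)]; exact e1
    · rw [abs_mul, abs_of_pos (by positivity : 0 < r * exp t)]
      refine lt_of_le_of_lt ?_ e1
      have := mul_le_mul_of_nonneg_left (abs_sin_le_one θ) (by positivity : 0 ≤ r * exp t)
      linarith
  have cle : ∀ θ, 0 < cos θ → cos θ ≤ √(cos θ) := fun θ hc => by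
    have h1 : √(cos θ) ≤ 1 := Real.sqrt_le_one.2 (cos_le_one θ)
    have h2 := Real.mul_self_sqrt hc.le
    nlinarith [Real.sqrt_nonneg (cos θ)]
  rcases h.ha with ha | ha
  · subst ha
    obtain ⟨C2, C20, hC2⟩ := hR.compact_bd2 dp hfl dδ
    set c := r * exp (-1) with hc
    have cp : 0 < c := by positivity
    refine hR.F_integrable (M := C1 + C2 + 2 * √(d / c)) hr hTR.le κ0 κ1 κT (by positivity) (fun _ => 0) ?_
    intro n t θ hdom ht
    have hcos := cos_pos_dom hdom
    obtain ⟨g1, g2⟩ := geo t θ hdom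
    have hε := en_pos n
    rw [sub_zero, zpow_one, abs_of_nonneg (S2_nonneg hε _)]
    have sq0 := Real.sqrt_nonneg (cos θ)
    have hcl := cle θ hcos
    set x := r * exp t * cos θ with hx
    set y := r * exp t * sin θ with hy
    have xp : 0 < x := by positivity
    change cos θ * S2 (en n) (u (pt x y)) ≤ _
    by_cases hxd : d ≤ x
    · have h1 := hC1 x y hxd g1.le _ hε
      calc _ ≤ cos θ * C1 := mul_le_mul_of_nonneg_left h1 hcos.le
        _ ≤ √(cos θ) * C1 := mul_le_mul_of_nonneg_right hcl C10
        _ = C1 * √(cos θ) := mul_comm _ _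
        _ ≤ _ := mul_le_mul_of_nonneg_right (by have := Real.sqrt_nonneg (d / c); linarith) sq0
    · push Not at hxd
      have h1 := hR.axis_diff hfl hε (Λ := log) (fun τ hτ => by
        have := hasDerivAt_log hτ.ne'
        simpa using this) xp hxd.le dδ g2.le
      have h2 := hC2 y g2.le _ hε
      have h3 := (abs_le.1 h1).1
      rw [← log_div dp.ne' xp.ne'] at h3
      have h4 : log (d / x) ≤ 2 * √(d / x) := by
        have e1 : log (d / x) = 2 * log (√(d / x)) := by
          rw [Real.log_sqrt (by positivity)]; ring
        have e2 := Real.log_le_sub_one_of_pos (Real.sqrt_pos.2 (by positivity : 0 < d / x))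
        rw [e1]; linarith
      have hxc : c * cos θ ≤ x := by
        rw [hx, hc]
        have : exp (-1) ≤ exp t := by
          apply exp_le_exp.2
          have := (abs_le.1 ht).1
          have : κ * cos θ ≤ 1 := mul_le_one₀ κ1 hcos.le (cos_le_one θ)
          linarith
        apply mul_le_mul_of_nonneg_right _ hcos.le
        exact mul_le_mul_of_nonneg_left this hr.le
      have h5 : √(d / x) ≤ √(d / c) / √(cos θ) := by
        rw [← Real.sqrt_div (by positivity)]
        apply Real.sqrt_le_sqrt
        rw [div_div d c]
        exact div_le_div_of_nonneg_left dp.le (by positivity) hxc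
      have sp : 0 < √(cos θ) := Real.sqrt_pos.2 hcos
      have h6 : cos θ * (√(d / c) / √(cos θ)) = √(d / c) * √(cos θ) := by
        have := Real.mul_self_sqrt hcos.le
        field_simp
        nlinarith
      have h7 : S2 (en n) (u (pt x y)) ≤ C2 + 2 * (√(d / c) / √(cos θ)) := by linarith
      have h8 := mul_le_mul_of_nonneg_left h7 hcos.le
      have h9 := mul_le_mul_of_nonneg_right hcl C20
      have h10 := mul_nonneg C10 sq0
      calc _ ≤ _ := h8
        _ = cos θ * C2 + 2 * (√(d / c) * √(cos θ)) := by rw [← h6]; ring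
        _ ≤ _ := by nlinarith
  · subst ha
    obtain ⟨f, hf⟩ := hR.axis_lim hδ hfl
    replace hf : Trace u R f := hf
    set c := f 0 with hc
    have c0 : 0 ≤ c := (hf 0 (by simpa using Rp.le)).1
    have hcst : ∀ y, |y| < r → f y = c := by
      intro y hy
      have hy' := abs_lt.1 hy
      rcases lt_trichotomy y 0 with h0 | h0 | h0
      · exact hR.axis_const hδ hfl hf hrR.le hE hy'.1 h0 hr
      · rw [h0]
      · exact (hR.axis_const hδ hfl hf hrR.le hE (by linarith) h0 hy'.2).symm
    obtain ⟨K, K0, hK⟩ : ∃ K, 0 ≤ K ∧ ∀ n t θ, (t, θ) ∈ dom T → |t| ≤ κ * cos θ →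
        |S2 (en n) (f (r * exp t * sin θ)) - S2 (en n) c| ≤ K * (cos θ) ^ 2 := by
      rcases hR.axis_trace hδ hfl hf hr hrR hcst with h1 | ⟨h1, K, K0, h2⟩
      · refine ⟨0, le_rfl, fun n t θ hdom ht => ?_⟩
        rw [h1 _ (geo t θ hdom).2.le]; simp
      · refine ⟨(K * (3 * r)) ^ 2 / 2, by positivity, fun n t θ hdom ht => ?_⟩
        have hcos := cos_pos_dom hdom
        have hc1 := cos_le_one θ
        set y := r * exp t * sin θ with hy
        have hyR := (geo t θ hdom).2
        have fy0 := (hf y hyR.le).1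
        rw [h1, S2_zero (en_pos n) (en_pos n).le, sub_zero, abs_of_nonneg (S2_nonneg (en_pos n) _)]
        refine (S2_le (en_pos n) _).trans ?_
        rw [max_eq_left fy0]
        have fy : f y ≤ K * (3 * r) * cos θ := by
          set s := r * (1 - cos θ / 2) with hs
          by_cases hys : s ≤ |y|
          · have q := h2 s y (mul_pos hr (by linarith)) (by rw [hs]; nlinarith) hys hyR
            have q2 : |y| - s ≤ 3 * r * cos θ := by
              have e1 : |y| ≤ r * exp t := by
                rw [hy, abs_mul, abs_of_pos (by positivity : 0 < r * exp t)]
                have := mul_le_mul_of_nonneg_left (abs_sin_le_one θ) (by positivity : 0 ≤ r * exp t)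
                linarith
              have e0 : κ * cos θ ≤ cos θ := by nlinarith
              have e2 := (abs_le.1 (Real.abs_exp_sub_one_le (show |t| ≤ 1 by linarith))).2
              have e3 : exp t - 1 ≤ 2 * cos θ := by linarith
              have e4 := mul_le_mul_of_nonneg_left e3 hr.le
              have e5 := mul_pos hr hcos
              have e6 : s = r - r * cos θ / 2 := by rw [hs]; ring
              linarith
            have := mul_le_mul_of_nonneg_left q2 K0
            linarith
          · push Not at hys
            rw [hcst y (hys.trans (by rw [hs]; nlinarith)), h1]; positivity
        have := pow_le_pow_left₀ fy0 fy 2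
        rw [mul_pow] at this
        linarith
    set M := R ^ 2 / 2 + K + (C1 + c ^ 2 / 2) * (R / d) ^ 2 with hM
    have M0 : 0 ≤ M := by positivity
    refine hR.F_integrable (M := M) hr hTR.le κ0 κ1 κT M0 (fun n => S2 (en n) c) ?_
    intro n t θ hdom ht
    have hcos := cos_pos_dom hdom
    have hε := en_pos n
    obtain ⟨g1, g2⟩ := geo t θ hdom
    have hk := hK n t θ hdom ht
    suffices hs : |S2 (en n) (u (PP r t θ)) - S2 (en n) c| ≤ M * (cos θ) ^ 2 by
      rw [zpow_neg_one]
      calc _ ≤ (cos θ)⁻¹ * (M * (cos θ) ^ 2) := mul_le_mul_of_nonneg_left hs (inv_nonneg.2 hcos.le)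
        _ = M * cos θ := by field_simp
        _ ≤ _ := mul_le_mul_of_nonneg_left (cle θ hcos) M0
    set x := r * exp t * cos θ with hx
    set y := r * exp t * sin θ with hy
    have xp : 0 < x := by positivity
    have xR : x ≤ R * cos θ := by
      rw [hx, ← hTR]
      apply mul_le_mul_of_nonneg_right _ hcos.le
      exact mul_le_mul_of_nonneg_left (exp_le_exp.2 hdom.1.2.le) hr.le
    change |S2 (en n) (u (pt x y)) - S2 (en n) c| ≤ _
    have cs : 0 ≤ (cos θ) ^ 2 := by positivity
    have p3 : 0 ≤ (C1 + c ^ 2 / 2) * (R / d) ^ 2 * (cos θ) ^ 2 := by positivity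
    by_cases hxd : d ≤ x
    · have h1 := hC1 x y hxd g1.le _ hε
      have h2 := S2_le hε c
      rw [max_eq_left c0] at h2
      have h3 := S2_nonneg hε c
      have h4 := S2_nonneg hε (u (pt x y))
      have h5 : |S2 (en n) (u (pt x y)) - S2 (en n) c| ≤ C1 + c ^ 2 / 2 := by
        rw [abs_le]; constructor <;> linarith
      have h6 : 1 ≤ (R / d) ^ 2 * (cos θ) ^ 2 := by
        rw [← mul_pow]
        apply one_le_pow₀
        rw [div_mul_eq_mul_div, le_div_iff₀ dp]; linarith
      have h7 : (C1 + c ^ 2 / 2) * 1 ≤ (C1 + c ^ 2 / 2) * ((R / d) ^ 2 * (cos θ) ^ 2) :=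
        mul_le_mul_of_nonneg_left h6 (by positivity)
      have h8 : 0 ≤ R ^ 2 / 2 * (cos θ) ^ 2 := by positivity
      have h9 : 0 ≤ K * (cos θ) ^ 2 := by positivity
      rw [hM]; nlinarith
    · push Not at hxd
      have h1 := hR.axis_S2 hfl hf hε xp (hxd.trans dδ) g2.le
      have h2 := abs_sub_le (S2 (en n) (u (pt x y))) (S2 (en n) (f y)) (S2 (en n) c)
      have h3 := pow_le_pow_left₀ xp.le xR 2
      rw [mul_pow] at h3
      rw [hM]; nlinarith



lemma Ph.arc {a : ℤ} {u : E2 → ℝ} {Ω : Set E2} {r : ℝ} (h : Ph a u Ω r) :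
    ∫ x in sphere (0:E2) r ∩ {x : E2 | 0 < x 0} ∩ {x : E2 | 0 < u x}, r⁻¹ * gF a u x ∂μH[1] =
      ∫ θ in Ioo (-(π/2)) (π/2), {x : E2 | 0 < u x}.indicator (gF a u) (gam r θ) := by
  have hr := h.rpos
  set P : Set E2 := {x : E2 | 0 < u x} with hP
  set Q : Set E2 := Ω ∩ {x : E2 | 0 < x 0} ∩ P with hQ
  have sub : sphere (0:E2) r ∩ {x : E2 | 0 < x 0} ⊆ Ω := fun x hx => h.ball ⟨sphere_subset_closedBall hx.1, (show (0:ℝ) ≤ x 0 from le_of_lt (show (0:ℝ) < x 0 from hx.2))⟩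
  have hQm : MeasurableSet Q := h.isOpenP.measurableSet
  have m1 : MeasurableSet (sphere (0:E2) r ∩ {x : E2 | 0 < x 0} ∩ P) := by
    have : sphere (0:E2) r ∩ {x : E2 | 0 < x 0} ∩ P = sphere (0:E2) r ∩ Q := by
      ext x
      constructor
      · rintro ⟨q1, q2⟩; exact ⟨q1.1, ⟨sub q1, q1.2⟩, q2⟩
      · rintro ⟨q1, ⟨q2, q3⟩, q4⟩; exact ⟨⟨q1, q3⟩, q4⟩
    rw [this]; exact isClosed_sphere.measurableSet.inter hQm
  have fc : ContinuousOn (fun x => r⁻¹ * gF a u x) Q := by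
    have hz : ContinuousOn (fun x : E2 => (x 0) ^ a) Q :=
      ContinuousOn.zpow₀ (by fun_prop) a (fun x hx => Or.inl (ne_of_gt hx.1.2))
    have hu : ContinuousOn u Q := h.cont.mono inter_subset_left
    refine continuousOn_const.mul (hz.mul (hu.mul (ContinuousOn.add ?_ ?_)))
    · exact ContinuousOn.mul (by fun_prop) (h.cdd 0)
    · exact ContinuousOn.mul (by fun_prop) (h.cdd 1)
  rw [integral_arc hr (fun x => r⁻¹ * gF a u x) P m1 ?_]
  · congr 1; funext θ
    by_cases hθ : gam r θ ∈ P
    · rw [indicator_of_mem hθ, indicator_of_mem hθ]; field_simp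
    · rw [indicator_of_notMem hθ, indicator_of_notMem hθ, mul_zero]
  · set μ := Measure.map (gam r) (ENNReal.ofReal r • volume.restrict (Ioo (-(π/2)) (π/2))) with hμ
    have s1 : AEStronglyMeasurable (Q.indicator (fun x => r⁻¹ * gF a u x)) μ := by
      rw [aestronglyMeasurable_indicator_iff hQm]
      exact fc.aestronglyMeasurable hQm
    refine s1.congr ?_
    have hN : MeasurableSet (Ω ∩ {x : E2 | 0 < x 0}) := h.isOpenN.measurableSet
    have ae : ∀ᵐ x ∂μ, x ∈ Ω ∩ {x : E2 | 0 < x 0} := by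
      rw [hμ]
      refine (ae_map_iff (p := fun x => x ∈ Ω ∩ {x : E2 | 0 < x 0}) (continuous_gam r).aemeasurable hN).2 ?_
      refine Measure.ae_smul_measure ?_ _
      filter_upwards [ae_restrict_mem measurableSet_Ioo] with θ hθ
      have hc := cos_pos_of_mem_Ioo hθ
      have h0 : 0 < (gam r θ) 0 := by simp only [gam, pt_zero]; positivity
      refine ⟨sub ⟨?_, h0⟩, h0⟩
      rw [mem_sphere_zero_iff_norm, gam_norm hr.le]
    filter_upwards [ae] with x hx
    by_cases hxP : x ∈ P
    · rw [indicator_of_mem hxP, indicator_of_mem (show x ∈ Q from ⟨hx, hxP⟩)]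
    · rw [indicator_of_notMem hxP, indicator_of_notMem (fun q => hxP q.2)]

lemma grad_inner (u : E2 → ℝ) (x y : E2) : ⟪gradient u x, y⟫ = fderiv ℝ u x y := by
  unfold gradient
  exact InnerProductSpace.toDual_symm_apply

lemma grad_coord (u : E2 → ℝ) (x : E2) (i : Fin 2) : (gradient u x) i = dd i u x := by
  unfold dd
  rw [← grad_inner, e2, EuclideanSpace.inner_single_right]
  simp

lemma grad_norm (u : E2 → ℝ) (x : E2) : ‖gradient u x‖ ^ 2 = (dd 0 u x) ^ 2 + (dd 1 u x) ^ 2 := by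
  rw [EuclideanSpace.norm_sq_eq]; simp [Fin.sum_univ_two, grad_coord]

lemma grad_rad (u : E2 → ℝ) (r : ℝ) (x : E2) : ⟪gradient u x, r⁻¹ • x⟫ = r⁻¹ * (x 0 * dd 0 u x + x 1 * dd 1 u x) := by
  rw [grad_inner, map_smul]
  conv_lhs => rw [← pt_eta x, pt_eq, map_add, map_smul, map_smul]
  rw [← pt_eq, pt_eta]; rfl

lemma div2_eq {W : ℝ → ℝ} {W' : ℝ} {u : E2 → ℝ} {x : E2} (hW : HasDerivAt W W' (x 0))
    (hd : ∀ i, DifferentiableAt ℝ (dd i u) x) :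
    div2 (fun y => W (y 0) • gradient u y) x = W (x 0) * (dd 0 (dd 0 u) x + dd 1 (dd 1 u) x) + W' * dd 0 u x := by
  have e : ∀ i : Fin 2, (fun y : E2 => (W (y 0) • gradient u y) i) = fun y => W (y 0) * dd i u y := by
    intro i; funext y; simp [grad_coord]
  have hp : HasFDerivAt (fun y : E2 => y 0) (EuclideanSpace.proj 0 : E2 →L[ℝ] ℝ) x :=
    (EuclideanSpace.proj (𝕜 := ℝ) (0 : Fin 2)).hasFDerivAt
  have hWd : HasFDerivAt (fun y : E2 => W (y 0)) _ x := hW.comp_hasFDerivAt x hp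
  unfold div2
  rw [Fin.sum_univ_two]
  simp only [e]
  change dd 0 _ x + dd 1 _ x = _
  rw [dd_mul hWd.differentiableAt (hd 0), dd_mul hWd.differentiableAt (hd 1)]
  obtain ⟨w0, w1⟩ := dd_coord hW
  rw [w0, w1]; ring

lemma ehd_plus {u : E2 → ℝ} {Ω : Set E2} {r : ℝ} (hΩ : IsOpen Ω) (hsol : SolvesEHD u Ω) (hr : 0 < r)
    (hball : closedBall (0 : E2) r ∩ {x : E2 | 0 ≤ x 0} ⊆ Ω) : Ph 1 u Ω r := by
  obtain ⟨h1, h2, h3, h4, h5⟩ := hsol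
  have c2 : ContDiffOn ℝ 2 u (Ω ∩ {x : E2 | 0 < x 0} ∩ {x : E2 | 0 < u x}) :=
    h2.mono (fun x hx => ⟨hx.1, ne_of_gt hx.2⟩)
  have hop : IsOpen (Ω ∩ {x : E2 | 0 < x 0} ∩ {x : E2 | 0 < u x}) :=
    h1.isOpen_inter_preimage (hΩ.inter isOpen_half) isOpen_Ioi
  refine ⟨Or.inl rfl, hΩ, hr, hball, h1, c2, ?_, ?_⟩
  · intro x hx
    have := h3 x hx
    rw [div2_eq (W := fun t => t) (hasDerivAt_id _) (fun i => ((dd_contDiffOn (n := 1) hop c2 i).contDiffAt (hop.mem_nhds hx)).differentiableAt (by norm_num))] at this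
    push_cast; linarith
  · intro p hp hp0
    have := (h5 p hp hp0).1.mono_left (nhdsWithin_mono p (show Ω ∩ {x : E2 | 0 < x 0} ∩ {x : E2 | 0 < u x} ⊆ Ω ∩ {x : E2 | 0 < u x} from fun x hx => ⟨hx.1.1, hx.2⟩))
    refine this.congr fun x => ?_
    simp only [zpow_one, dd]; ring

lemma ehd_minus {u : E2 → ℝ} {Ω : Set E2} {r : ℝ} (hΩ : IsOpen Ω) (hsol : SolvesEHD u Ω) (hr : 0 < r)
    (hball : closedBall (0 : E2) r ∩ {x : E2 | 0 ≤ x 0} ⊆ Ω) : Ph (-1) (fun z => -u z) Ω r := by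
  obtain ⟨h1, h2, h3, h4, h5⟩ := hsol
  have es : {x : E2 | 0 < -u x} = {x : E2 | u x < 0} := by ext x; simp
  have c2 : ContDiffOn ℝ 2 u (Ω ∩ {x : E2 | 0 < x 0} ∩ {x : E2 | u x < 0}) :=
    h2.mono (fun x hx => ⟨hx.1, ne_of_lt hx.2⟩)
  have hop : IsOpen (Ω ∩ {x : E2 | 0 < x 0} ∩ {x : E2 | u x < 0}) :=
    h1.isOpen_inter_preimage (hΩ.inter isOpen_half) isOpen_Iio
  refine ⟨Or.inr rfl, hΩ, hr, hball, h1.neg, ?_, ?_, ?_⟩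
  · rw [es]; exact c2.neg
  · rw [es]
    intro x hx
    have hx0 : 0 < x 0 := hx.1.2
    have := h4 x hx
    rw [div2_eq (W := fun t => t⁻¹) (hasDerivAt_inv hx0.ne') (fun i => ((dd_contDiffOn (n := 1) hop c2 i).contDiffAt (hop.mem_nhds hx)).differentiableAt (by norm_num))] at this
    simp only [dd_neg]
    have e : x 0 * (-dd 0 (dd 0 u) x + -dd 1 (dd 1 u) x) + ((-1 : ℤ) : ℝ) * -dd 0 u x =
      -(x 0) ^ 2 * ((x 0)⁻¹ * (dd 0 (dd 0 u) x + dd 1 (dd 1 u) x) + -((x 0) ^ 2)⁻¹ * dd 0 u x) := by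
      push_cast; field_simp; ring
    rw [e, this, mul_zero]
  · intro p hp hp0
    rw [es]
    have := (h5 p hp hp0).2.mono_left (nhdsWithin_mono p (show Ω ∩ {x : E2 | 0 < x 0} ∩ {x : E2 | u x < 0} ⊆ Ω ∩ {x : E2 | u x < 0} from fun x hx => ⟨hx.1.1, hx.2⟩))
    refine this.congr fun x => ?_
    simp only [dd_neg, zpow_neg_one]; simp only [dd]; ring

lemma final_proof
    (u : E2 → ℝ) (Ω : Set E2) (hΩ : IsOpen Ω) (hsol : SolvesEHD u Ω)
    (r : ℝ) (hr : 0 < r)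
    (hball : closedBall (0 : E2) r ∩ {x : E2 | 0 ≤ x 0} ⊆ Ω) :
    (∫ x in ball (0 : E2) r ∩ {x : E2 | 0 < x 0} ∩ {x : E2 | 0 < u x},
        x 0 * ‖gradient u x‖ ^ 2)
      = (∫ x in sphere (0 : E2) r ∩ {x : E2 | 0 < x 0} ∩ {x : E2 | 0 < u x},
          x 0 * u x * ⟪gradient u x, r⁻¹ • x⟫ ∂μH[1]) ∧
    (∫ x in ball (0 : E2) r ∩ {x : E2 | 0 < x 0} ∩ {x : E2 | u x < 0},
        ‖gradient u x‖ ^ 2 / x 0)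
      = ∫ x in sphere (0 : E2) r ∩ {x : E2 | 0 < x 0} ∩ {x : E2 | u x < 0},
          u x * ⟪gradient u x, r⁻¹ • x⟫ / x 0 ∂μH[1] := by
  constructor
  · have h := ehd_plus hΩ hsol hr hball
    have e1 : (fun x : E2 => x 0 * ‖gradient u x‖ ^ 2) = gE 1 u := by
      funext x; rw [grad_norm]; simp [gE]
    have e2 : (fun x : E2 => x 0 * u x * ⟪gradient u x, r⁻¹ • x⟫) = fun x => r⁻¹ * gF 1 u x := by
      funext x; rw [grad_rad]; simp only [gF, zpow_one]; ring
    rw [e1, e2, h.arc]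
    exact h.full
  · have h := ehd_minus hΩ hsol hr hball
    have es : {x : E2 | u x < 0} = {x : E2 | 0 < -u x} := by ext x; simp
    have e1 : (fun x : E2 => ‖gradient u x‖ ^ 2 / x 0) = gE (-1) (fun z => -u z) := by
      funext x; rw [grad_norm]; simp only [gE, dd_neg, zpow_neg_one]; ring
    have e2 : (fun x : E2 => u x * ⟪gradient u x, r⁻¹ • x⟫ / x 0) = fun x => r⁻¹ * gF (-1) (fun z => -u z) x := by
      funext x; rw [grad_rad]; simp only [gF, dd_neg, zpow_neg_one]; ring
    rw [e1, e2, es, h.arc]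
    exact h.full

/-- Integration by parts identities: for a solution of the
two-phase system with vanishing flux on the axis, the weighted Dirichlet energies
over `B_r⁺` equal the corresponding weighted boundary flux integrals over `∂B_r⁺`
(with outward normal `ν = x/r` and 1-dimensional Hausdorff surface measure). -/
theorem energy_integration_by_parts
    (u : E2 → ℝ) (Ω : Set E2) (hΩ : IsOpen Ω) (hsol : SolvesEHD u Ω)
    (r : ℝ) (hr : 0 < r)
    (hball : closedBall (0 : E2) r ∩ {x : E2 | 0 ≤ x 0} ⊆ Ω) :
    (∫ x in ball (0 : E2) r ∩ {x : E2 | 0 < x 0} ∩ {x : E2 | 0 < u x},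
        x 0 * ‖gradient u x‖ ^ 2)
      = (∫ x in sphere (0 : E2) r ∩ {x : E2 | 0 < x 0} ∩ {x : E2 | 0 < u x},
          x 0 * u x * ⟪gradient u x, r⁻¹ • x⟫ ∂μH[1]) ∧
    (∫ x in ball (0 : E2) r ∩ {x : E2 | 0 < x 0} ∩ {x : E2 | u x < 0},
        ‖gradient u x‖ ^ 2 / x 0)
      = ∫ x in sphere (0 : E2) r ∩ {x : E2 | 0 < x 0} ∩ {x : E2 | u x < 0},
          u x * ⟪gradient u x, r⁻¹ • x⟫ / x 0 ∂μH[1] := by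
  exact final_proof u Ω hΩ hsol r hr hball
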